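/- Let A = ℂQ/⟨R⟩ be a connected, acyclic, tame bound quiver algebra and α ∈ ℕ^{Q_0} with P_A(α) ≠ ∅. Then dim C(α) = dim GL(α) if and only if none of the indecomposable irreducible components occurring in the generic decomposition of C(α) is an orbit closure. -/

import Mathlib

open Matrix
noncomputable section

/-- A (finite-vertex) quiver: vertices, arrows, tail and head maps. -/
structure Quiv where
  V : Type
  A : Type
  t : A → V
  h : A → V
  [fV : Fintype V]
  [dV : DecidableEq V]

attribute [instance] Quiv.fV Quiv.dV

/-- The `Quiver` structure on the vertices of `Q`: an arrow from `x` to `y` is an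
arrow of `Q` with tail `x` and head `y`.  This gives us `Quiver.Path x y`, the type of
oriented paths from `x` to `y` in `Q`. -/
instance quivToQuiver (Q : Quiv) : Quiver Q.V := ⟨fun x y => {a : Q.A // Q.t a = x ∧ Q.h a = y}⟩

/-- The space of matrix representations of `Q` of dimension vector `β`, with entries in a
commutative ring `R`. -/
def RepR (Q : Quiv) (R : Type) (β : Q.V → ℕ) := ∀ a : Q.A, Matrix (Fin (β (Q.h a))) (Fin (β (Q.t a))) R

/-- The representation space `rep(Q,β) = ∏_{a ∈ Q₁} ℂ^{β(ha) × β(ta)}`. -/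
abbrev QRep (Q : Quiv) (β : Q.V → ℕ) := RepR Q ℂ β

/-- Transport of a rectangular matrix along equalities of its sizes. -/
def castM {R : Type} {m n m' n' : ℕ} (hm : m = m') (hn : n = n')
    (M : Matrix (Fin m) (Fin n) R) : Matrix (Fin m') (Fin n') R :=
  M.submatrix (Fin.cast hm.symm) (Fin.cast hn.symm)

/-- The value `W(p)` of a representation `W` on an oriented path `p` (the product of the
matrices attached to the arrows of `p`; the trivial path gives the identity matrix). -/
def evalPath {Q : Quiv} {R : Type} [CommRing R] {β : Q.V → ℕ} (W : RepR Q R β) :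
    ∀ {x y : Q.V}, Quiver.Path x y → Matrix (Fin (β y)) (Fin (β x)) R
  | _, _, Quiver.Path.nil => 1
  | _, _, Quiver.Path.cons p e =>
      (castM (congrArg β e.2.2) (congrArg β e.2.1) (W e.1)) * evalPath W p
variable (Q : Quiv)

/-- A formal (finite) linear combination of parallel oriented paths in `Q`, together with its
endpoints: the element of the path algebra it represents lives in `e_y · ℂQ · e_x`. -/
def FormalRel := Σ (x : Q.V) (y : Q.V), (Quiver.Path x y →₀ ℂ)

variable {Q}

/-- Evaluation of a representation on a formal linear combination of parallel paths. -/
def evalLin {β : Q.V → ℕ} (W : QRep Q β) {x y : Q.V} (c : Quiver.Path x y →₀ ℂ) :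
    Matrix (Fin (β y)) (Fin (β x)) ℂ :=
  c.sum fun p k => k • evalPath W p

/-- Evaluation of a representation over `ℂ[x]` on a formal linear combination of paths. -/
def evalLinP {β : Q.V → ℕ} (W : RepR Q (Polynomial ℂ) β) {x y : Q.V}
    (c : Quiver.Path x y →₀ ℂ) : Matrix (Fin (β y)) (Fin (β x)) (Polynomial ℂ) :=
  c.sum fun p k => (Polynomial.C k) • evalPath W p

/-- The module variety `mod(A,β)` of the algebra `A = ℂQ/⟨S⟩`: all `β`-dimensional
representations of `Q` annihilating every relation in `S`. -/
def modSet (S : Set (FormalRel Q)) (β : Q.V → ℕ) : Set (QRep Q β) :=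
  {W | ∀ r ∈ S, evalLin W r.2.2 = 0}

/-- A set of relations is admissible if every path occurring in it has length at least two. -/
def AdmissibleRels (S : Set (FormalRel Q)) : Prop :=
  ∀ r ∈ S, ∀ p ∈ r.2.2.support, 2 ≤ p.length

/-- The base change group `GL(β) = ∏_x GL(β(x),ℂ)`. -/
abbrev GLb (β : Q.V → ℕ) := ∀ x : Q.V, Matrix.GeneralLinearGroup (Fin (β x)) ℂ

/-- The action of `GL(β)` on `rep(Q,β)` by simultaneous conjugation. -/
def gAct {β : Q.V → ℕ} (g : GLb β) (W : QRep Q β) : QRep Q β :=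
  fun a => ((g (Q.h a)).val) * W a * (((g (Q.t a))⁻¹).val)

/-- The character of `GL(β)` induced by the weight `σ`: `g ↦ ∏_x det(g(x))^{σ(x)}`.  -/
def chi {β : Q.V → ℕ} (σ : Q.V → ℤ) (g : GLb β) : ℂ :=
  ∏ x : Q.V, ((g x).val.det) ^ (σ x)

/-- Index type of the coordinates on `rep(Q,β)`. -/
def RepCoord (β : Q.V → ℕ) := Σ a : Q.A, Fin (β (Q.h a)) × Fin (β (Q.t a))

/-- The coordinates of a point of `rep(Q,β)`. -/
def repCoords {β : Q.V → ℕ} (W : QRep Q β) : RepCoord (Q := Q) β → ℂ :=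
  fun c => W c.1 c.2.1 c.2.2

/-- `F` is a polynomial function on `rep(Q,β)`. -/
def IsPolyFun {β : Q.V → ℕ} (F : QRep Q β → ℂ) : Prop :=
  ∃ P : MvPolynomial (RepCoord (Q := Q) β) ℂ, ∀ W, F W = MvPolynomial.eval (repCoords W) P

/-- `F` is a semi-invariant of weight `σ` on `rep(Q,β)`. -/
def IsSemiInvariant {β : Q.V → ℕ} (σ : Q.V → ℤ) (F : QRep Q β → ℂ) : Prop :=
  IsPolyFun F ∧ ∀ (g : GLb β) (W : QRep Q β), F (gAct g W) = chi σ g * F W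

/-- The orbit semigroup `S_Q(W)` of a representation `W ∈ rep(Q,β)`: all weights `σ` admitting
a semi-invariant of weight `σ` not vanishing at `W`. -/
def OrbitSemigroup {β : Q.V → ℕ} (W : QRep Q β) : Set (Q.V → ℤ) :=
  {σ | ∃ F : QRep Q β → ℂ, IsSemiInvariant σ F ∧ F W ≠ 0}

/-- `W` is `σ`-semi-stable: some positive multiple of `σ` lies in the orbit semigroup. -/
def SemiStable {β : Q.V → ℕ} (σ : Q.V → ℤ) (W : QRep Q β) : Prop :=
  ∃ n : ℕ, 1 ≤ n ∧ (fun x => (n : ℤ) * σ x) ∈ OrbitSemigroup W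

/-- The weight `σ` is `W`-saturated: if `nσ` lies in the orbit semigroup of `W` for some
integer `n ≥ 1`, then so does `σ`. -/
def WSaturated {β : Q.V → ℕ} (W : QRep Q β) (σ : Q.V → ℤ) : Prop :=
  (∃ n : ℕ, 1 ≤ n ∧ (fun x => (n : ℤ) * σ x) ∈ OrbitSemigroup W) → σ ∈ OrbitSemigroup W

/-- `Q` is connected: any two vertices are joined by an unoriented walk. -/
def QConnected (Q : Quiv) : Prop :=
  ∀ x y : Q.V, Relation.ReflTransGen
    (fun u v => ∃ a : Q.A, (Q.t a = u ∧ Q.h a = v) ∨ (Q.t a = v ∧ Q.h a = u)) x y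

/-- `Q` is acyclic: the only oriented path from a vertex to itself is the trivial one. -/
def QAcyclic (Q : Quiv) : Prop := ∀ (x : Q.V) (p : Quiver.Path x x), p = Quiver.Path.nil
section Capacity

variable (Q : Quiv) (β : Q.V → ℕ) (σ : Q.V → ℤ)

/-- Vertices where the weight `σ` is positive. -/
abbrev PosV := {x : Q.V // 0 < σ x}

/-- Vertices where the weight `σ` is negative. -/
abbrev NegV := {x : Q.V // σ x < 0}

/-- `σ₊` at a positive vertex. -/
abbrev posP (i : PosV Q σ) : ℕ := (σ i.1).toNat

/-- `σ₋` at a negative vertex. -/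
abbrev negP (j : NegV Q σ) : ℕ := (-σ j.1).toNat

/-- Row index type of the `N × N` block matrices: block rows are indexed by pairs `(j,q)`
with `q ∈ I_j⁻`, each of height `β(w_j)`; so `N = Σ_j σ₋(w_j)β(w_j)` rows in total. -/
abbrev RowT := Σ j : NegV Q σ, Fin (negP Q σ j) × Fin (β j.1)

/-- Column index type of the `N × N` block matrices: block columns indexed by pairs `(i,r)`
with `r ∈ I_i⁺`, each of width `β(v_i)`; so `N = Σ_i σ₊(v_i)β(v_i)` columns in total. -/
abbrev ColT := Σ i : PosV Q σ, Fin (posP Q σ i) × Fin (β i.1)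

/-- The index set `I_σ = {(i,j,p,q,r)}`. -/
structure BIdx where
  i : PosV Q σ
  j : NegV Q σ
  p : Quiver.Path i.1 j.1
  q : Fin (negP Q σ j)
  r : Fin (posP Q σ i)

variable {Q β σ}

/-- The block matrix `W^{i,j,p}_{q,r}`: its `(q,r)` block entry is `W(p)` and all other
entries vanish. -/
def blockMat (W : QRep Q β) (d : BIdx Q σ) : Matrix (RowT Q β σ) (ColT Q β σ) ℂ :=
  fun s u =>
    if hj : s.1 = d.j then
      if hi : u.1 = d.i then
        if Fin.cast (congrArg (negP Q σ) hj) s.2.1 = d.q ∧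
           Fin.cast (congrArg (posP Q σ) hi) u.2.1 = d.r then
          evalPath W d.p (Fin.cast (congrArg (fun z => β z.1) hj) s.2.2)
            (Fin.cast (congrArg (fun z => β z.1) hi) u.2.2)
        else 0
      else 0
    else 0

/-- The Brascamp–Lieb (completely positive) operator `T_{W,σ}` associated to the quiver
datum `(W,σ)`, with Kraus operators the block matrices `W^{i,j,p}_{q,r}`. -/
def BLop (W : QRep Q β) (X : Matrix (RowT Q β σ) (RowT Q β σ) ℂ) :
    Matrix (ColT Q β σ) (ColT Q β σ) ℂ :=
  ∑ᶠ d : BIdx Q σ, (blockMat W d)ᵀ * X * blockMat W d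

/-- The capacity `cap_Q(W,σ)` of the quiver datum `(W,σ)`: the infimum of
`Det (T_{W,σ}(X))` over real positive definite matrices `X` with `Det X = 1`. -/
def capQ (W : QRep Q β) : ℝ :=
  sInf {r : ℝ | ∃ X : Matrix (RowT Q β σ) (RowT Q β σ) ℝ, X.PosDef ∧ X.det = 1 ∧
    r = ((BLop (σ := σ) W (X.map Complex.ofReal)).det).re}

/-- `Span_ℂ(W^{i,j,p}_{q,r} : (i,j,p,q,r) ∈ I_σ)` contains a non-singular `N × N` matrix. -/
def SpanNonsingular (W : QRep Q β) (σ : Q.V → ℤ) : Prop :=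
  ∃ M ∈ Submodule.span ℂ (Set.range (blockMat (σ := σ) W)),
    Function.Bijective (Matrix.mulVecLin M)

end Capacity
section HomExt

variable {Q : Quiv}

/-- The space of morphisms of representations `Hom(V,W)`, as a subspace of
`∏_x Hom(V(x),W(x))` (in matrix form). -/
def HomS {α γ : Q.V → ℕ} (V : QRep Q α) (W : QRep Q γ) :
    Submodule ℂ (∀ x : Q.V, Matrix (Fin (γ x)) (Fin (α x)) ℂ) where
  carrier := {φ | ∀ a : Q.A, φ (Q.h a) * V a = W a * φ (Q.t a)}
  add_mem' := by
    intro φ ψ hφ hψ a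
    simp only [Pi.add_apply, Matrix.add_mul, Matrix.mul_add, hφ a, hψ a]
  zero_mem' := by intro a; simp
  smul_mem' := by
    intro c φ hφ a
    simp only [Pi.smul_apply, Matrix.smul_mul, Matrix.mul_smul, hφ a]

/-- `dim_ℂ Hom(V,W)`. -/
def dimHom {α γ : Q.V → ℕ} (V : QRep Q α) (W : QRep Q γ) : ℕ :=
  Module.finrank ℂ (HomS V W)

/-- A family of matrices is componentwise surjective (as linear maps). -/
def MorSurj {α γ : Q.V → ℕ} (φ : ∀ x : Q.V, Matrix (Fin (γ x)) (Fin (α x)) ℂ) : Prop :=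
  ∀ x, Function.Surjective (Matrix.mulVecLin (φ x))

/-- A family of matrices is componentwise injective (as linear maps). -/
def MorInj {α γ : Q.V → ℕ} (φ : ∀ x : Q.V, Matrix (Fin (γ x)) (Fin (α x)) ℂ) : Prop :=
  ∀ x, Function.Injective (Matrix.mulVecLin (φ x))

/-- Isomorphism of representations (possibly of different dimension vectors). -/
def RIso {α γ : Q.V → ℕ} (V : QRep Q α) (W : QRep Q γ) : Prop :=
  ∃ u : ∀ x : Q.V, ((Fin (α x) → ℂ) ≃ₗ[ℂ] (Fin (γ x) → ℂ)),
    ∀ a : Q.A, (u (Q.h a)).toLinearMap ∘ₗ (V a).mulVecLin =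
      (W a).mulVecLin ∘ₗ (u (Q.t a)).toLinearMap

/-- The space of `1`-cochains from `V` to `W`: families `φ(a) : V(ta) → W(ha)`. -/
abbrev C1sp (α γ : Q.V → ℕ) := ∀ a : Q.A, Matrix (Fin (γ (Q.h a))) (Fin (α (Q.t a))) ℂ

/-- The derivative (Leibniz rule) of a path with respect to a `1`-cochain `φ`:
`D_{a_s ⋯ a_1}(φ) = Σ_k W(a_s ⋯ a_{k+1}) φ(a_k) V(a_{k-1} ⋯ a_1)`. -/
def der {α γ : Q.V → ℕ} (V : QRep Q α) (W : QRep Q γ) (φ : C1sp (Q := Q) α γ) :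
    ∀ {x y : Q.V}, Quiver.Path x y → Matrix (Fin (γ y)) (Fin (α x)) ℂ
  | _, _, Quiver.Path.nil => 0
  | _, _, Quiver.Path.cons p e =>
      castM (congrArg γ e.2.2) (congrArg α e.2.1) (φ e.1) * evalPath V p
      + castM (congrArg γ e.2.2) (congrArg γ e.2.1) (W e.1) * der V W φ p

lemma der_add {α γ : Q.V → ℕ} (V : QRep Q α) (W : QRep Q γ) (φ ψ : C1sp (Q := Q) α γ)
    {x y : Q.V} (p : Quiver.Path x y) :
    der V W (φ + ψ) p = der V W φ p + der V W ψ p := by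
  induction p with
  | nil => simp [der]
  | cons p e ih =>
      simp only [der, ih, Pi.add_apply, castM, Matrix.submatrix_add, Matrix.add_mul,
        Matrix.mul_add]
      abel

lemma der_smul {α γ : Q.V → ℕ} (V : QRep Q α) (W : QRep Q γ) (c : ℂ) (φ : C1sp (Q := Q) α γ)
    {x y : Q.V} (p : Quiver.Path x y) :
    der V W (c • φ) p = c • der V W φ p := by
  induction p with
  | nil => simp [der]
  | cons p e ih =>
      simp only [der, ih, Pi.smul_apply, castM, Matrix.submatrix_smul, Matrix.smul_mul,
        Matrix.mul_smul, smul_add]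

lemma der_zero {α γ : Q.V → ℕ} (V : QRep Q α) (W : QRep Q γ)
    {x y : Q.V} (p : Quiver.Path x y) :
    der V W (0 : C1sp (Q := Q) α γ) p = 0 := by
  induction p with
  | nil => simp [der]
  | cons p e ih =>
      simp [der, ih, castM]

/-- The derivative of a formal linear combination of parallel paths. -/
def derRel {α γ : Q.V → ℕ} (V : QRep Q α) (W : QRep Q γ) (φ : C1sp (Q := Q) α γ)
    {x y : Q.V} (c : Quiver.Path x y →₀ ℂ) : Matrix (Fin (γ y)) (Fin (α x)) ℂ :=
  c.sum fun p k => k • der V W φ p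

/-- The space of `1`-cocycles relative to the set of relations `S`: cochains whose
derivative kills every relation in `S`. -/
def Z1 (S : Set (FormalRel Q)) {α γ : Q.V → ℕ} (V : QRep Q α) (W : QRep Q γ) :
    Submodule ℂ (C1sp (Q := Q) α γ) where
  carrier := {φ | ∀ r ∈ S, derRel V W φ r.2.2 = 0}
  add_mem' := by
    intro φ ψ hφ hψ r hr
    have : derRel V W (φ + ψ) r.2.2 = derRel V W φ r.2.2 + derRel V W ψ r.2.2 := by
      simp only [derRel, der_add, smul_add]
      exact Finsupp.sum_add
    rw [this, hφ r hr, hψ r hr, add_zero]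
  zero_mem' := by
    intro r hr
    simp [derRel, der_zero]
  smul_mem' := by
    intro c φ hφ r hr
    have : derRel V W (c • φ) r.2.2 = c • derRel V W φ r.2.2 := by
      simp only [derRel, der_smul, Finsupp.smul_sum, smul_comm c]
    rw [this, hφ r hr, smul_zero]

/-- The coboundary map `d⁰ : ∏_x Hom(V(x),W(x)) → C¹`,
`f ↦ (a ↦ f(ha) V(a) − W(a) f(ta))`. -/
def d0map {α γ : Q.V → ℕ} (V : QRep Q α) (W : QRep Q γ) :
    (∀ x : Q.V, Matrix (Fin (γ x)) (Fin (α x)) ℂ) →ₗ[ℂ] C1sp (Q := Q) α γ where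
  toFun f := fun a => f (Q.h a) * V a - W a * f (Q.t a)
  map_add' f g := by
    funext a
    simp only [Pi.add_apply, Matrix.add_mul, Matrix.mul_add]
    abel
  map_smul' c f := by
    funext a
    simp only [Pi.smul_apply, Matrix.smul_mul, Matrix.mul_smul, smul_sub, RingHom.id_apply]

/-- The space of `1`-coboundaries. -/
def B1 {α γ : Q.V → ℕ} (V : QRep Q α) (W : QRep Q γ) : Submodule ℂ (C1sp (Q := Q) α γ) :=
  LinearMap.range (d0map V W)

/-- `dim_ℂ Ext¹(V,W)` over the algebra `ℂQ/⟨S⟩`, computed as the dimension of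
`Z¹/B¹` (for modules, `B¹ ⊆ Z¹`, so this is `dim Z¹ − dim B¹`). -/
def dimExt1 (S : Set (FormalRel Q)) {α γ : Q.V → ℕ} (V : QRep Q α) (W : QRep Q γ) : ℕ :=
  Module.finrank ℂ (Z1 S V W) - Module.finrank ℂ ↥((B1 V W) ⊓ (Z1 S V W))

end HomExt
section ProjPdim

variable {Q : Quiv}

/-- `P` is a projective module over `ℂQ/⟨S⟩` (in matrix-representation form):
every morphism from `P` to the target of a surjection of modules lifts. -/
def IsProjRep (S : Set (FormalRel Q)) {γ : Q.V → ℕ} (P : QRep Q γ) : Prop :=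
  ∀ (δ ε : Q.V → ℕ) (M : QRep Q δ) (N : QRep Q ε), M ∈ modSet S δ → N ∈ modSet S ε →
    ∀ g ∈ HomS M N, MorSurj g → ∀ f ∈ HomS P N,
      ∃ h ∈ HomS P M, ∀ x, g x * h x = f x

/-- `V` has projective dimension at most one over `ℂQ/⟨S⟩`: there is a short exact
sequence `0 → P₁ → P₀ → V → 0` with `P₀, P₁` projective. -/
def PdimLE1 (S : Set (FormalRel Q)) {β : Q.V → ℕ} (V : QRep Q β) : Prop :=
  ∃ (γ₀ γ₁ : Q.V → ℕ) (P₀ : QRep Q γ₀) (P₁ : QRep Q γ₁),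
    P₀ ∈ modSet S γ₀ ∧ P₁ ∈ modSet S γ₁ ∧ IsProjRep S P₀ ∧ IsProjRep S P₁ ∧
    ∃ i ∈ HomS P₁ P₀, ∃ p ∈ HomS P₀ V, MorInj i ∧ MorSurj p ∧
      ∀ x, LinearMap.range (Matrix.mulVecLin (i x)) = LinearMap.ker (Matrix.mulVecLin (p x))

/-- The set `P_A(α) = {V ∈ mod(A,α) : pdim_A V ≤ 1}` where `A = ℂQ/⟨S⟩`. -/
def PAset (S : Set (FormalRel Q)) (α : Q.V → ℕ) : Set (QRep Q α) :=
  {V | V ∈ modSet S α ∧ PdimLE1 S V}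

end ProjPdim

section Zariski

/-- The Zariski topology on the affine space `ι → ℂ`: generated by the complements of
hypersurfaces. -/
def zarPi (ι : Type) : TopologicalSpace (ι → ℂ) :=
  TopologicalSpace.generateFrom
    {U | ∃ p : MvPolynomial ι ℂ, U = {w | MvPolynomial.eval w p ≠ 0}}

variable {Q : Quiv}

/-- The Zariski topology on `rep(Q,β)`. -/
def zarTop (β : Q.V → ℕ) : TopologicalSpace (QRep Q β) :=
  TopologicalSpace.induced (repCoords (β := β)) (zarPi _)

/-- Zariski closure in `rep(Q,β)`. -/
def zclosure {β : Q.V → ℕ} (s : Set (QRep Q β)) : Set (QRep Q β) :=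
  @closure _ (zarTop β) s

/-- Zariski-open. -/
def zIsOpen {β : Q.V → ℕ} (s : Set (QRep Q β)) : Prop := @IsOpen _ (zarTop β) s

/-- Zariski-closed. -/
def zIsClosed {β : Q.V → ℕ} (s : Set (QRep Q β)) : Prop := @IsClosed _ (zarTop β) s

/-- Irreducibility in the Zariski topology. -/
def zIrred {β : Q.V → ℕ} (s : Set (QRep Q β)) : Prop := @IsIrreducible _ (zarTop β) s

/-- Dimension of a subset of `rep(Q,β)`: the topological Krull dimension in the
(subspace) Zariski topology. -/
def zdim {β : Q.V → ℕ} (s : Set (QRep Q β)) : WithBot ℕ∞ :=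
  @topologicalKrullDim s (TopologicalSpace.induced Subtype.val (zarTop β))

/-- `C(α)`: the closure of `P_A(α)`. -/
def Cset (S : Set (FormalRel Q)) (α : Q.V → ℕ) : Set (QRep Q α) := zclosure (PAset S α)

/-- `C` is an irreducible component of `M` (for `M` closed in `rep(Q,α)`): a maximal
irreducible closed subset of `M`. -/
def IsIrrCompOf {β : Q.V → ℕ} (C M : Set (QRep Q β)) : Prop :=
  zIrred C ∧ zIsClosed C ∧ C ⊆ M ∧
    ∀ C' : Set (QRep Q β), zIrred C' → zIsClosed C' → C' ⊆ M → C ⊆ C' → C' = C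

/-- `V` is an indecomposable representation: it is nonzero and its endomorphism algebra
has no idempotents other than `0` and `1`. -/
def IsIndecRep {α : Q.V → ℕ} (V : QRep Q α) : Prop :=
  (∃ x, α x ≠ 0) ∧
  ∀ φ ∈ HomS V V, (∀ x, φ x * φ x = φ x) → φ = 0 ∨ φ = fun x => (1 : Matrix _ _ ℂ)

/-- `C` is an indecomposable irreducible component of `M`: an irreducible component
containing a dense open subset of indecomposable representations. -/
def IsIndecComp {β : Q.V → ℕ} (C M : Set (QRep Q β)) : Prop :=
  IsIrrCompOf C M ∧
  ∃ U : Set (QRep Q β), zIsOpen U ∧ C ⊆ zclosure (C ∩ U) ∧ ∀ V ∈ C ∩ U, IsIndecRep V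

/-- The `GL(α)`-orbit of `V`. -/
def orbitOf {α : Q.V → ℕ} (V : QRep Q α) : Set (QRep Q α) := {W | ∃ g : GLb α, gAct g V = W}

/-- `C` is an orbit closure `closure(GL(α)·V)` of some module `V ∈ mod(A,α)`. -/
def IsOrbitClosure (S : Set (FormalRel Q)) {α : Q.V → ℕ} (C : Set (QRep Q α)) : Prop :=
  ∃ V ∈ modSet S α, C = zclosure (orbitOf V)

/-- The coordinates on `∏_x ℂ^{α(x) × α(x)}`, the ambient space of `GL(α)`. -/
def glCoords {α : Q.V → ℕ} (g : ∀ x : Q.V, Matrix (Fin (α x)) (Fin (α x)) ℂ) :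
    (Σ x : Q.V, Fin (α x) × Fin (α x)) → ℂ := fun c => g c.1 c.2.1 c.2.2

/-- The Zariski topology on `∏_x ℂ^{α(x) × α(x)}`. -/
def glTop (Q : Quiv) (α : Q.V → ℕ) :
    TopologicalSpace (∀ x : Q.V, Matrix (Fin (α x)) (Fin (α x)) ℂ) :=
  TopologicalSpace.induced glCoords (zarPi _)

/-- `GL(α)` as a (quasi-affine) subset of `∏_x ℂ^{α(x) × α(x)}`. -/
def glSet (Q : Quiv) (α : Q.V → ℕ) : Set (∀ x : Q.V, Matrix (Fin (α x)) (Fin (α x)) ℂ) :=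
  {g | ∀ x, IsUnit (g x)}

/-- The dimension of the group variety `GL(α)`. -/
def glDim (Q : Quiv) (α : Q.V → ℕ) : WithBot ℕ∞ :=
  @topologicalKrullDim (glSet Q α) (TopologicalSpace.induced Subtype.val (glTop Q α))

end Zariski
section Sums

variable {Q : Quiv}

/-- `W` is a direct sum of the representations `V i` (up to isomorphism of the underlying
block-diagonal structure). -/
def IsSumOf {ι : Type} [Fintype ι] [DecidableEq ι] {αs : ι → Q.V → ℕ} {δ : Q.V → ℕ}
    (W : QRep Q δ) (V : ∀ i, QRep Q (αs i)) : Prop :=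
  ∃ u : ∀ x : Q.V, ((Fin (δ x) → ℂ) ≃ₗ[ℂ] ((Σ i, Fin (αs i x)) → ℂ)),
    ∀ a : Q.A, (u (Q.h a)).toLinearMap ∘ₗ (W a).mulVecLin =
      (Matrix.blockDiagonal' (fun i => V i a)).mulVecLin ∘ₗ (u (Q.t a)).toLinearMap

/-- The constructible subset `C₁ ⊕ ⋯ ⊕ C_l ⊆ rep(Q,δ)`: representations isomorphic to a
direct sum `V₁ ⊕ ⋯ ⊕ V_l` with `V_i ∈ C_i`. -/
def sumSet {ι : Type} [Fintype ι] [DecidableEq ι] (αs : ι → Q.V → ℕ)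
    (Cs : ∀ i, Set (QRep Q (αs i))) (δ : Q.V → ℕ) : Set (QRep Q δ) :=
  {W | ∃ V : ∀ i, QRep Q (αs i), (∀ i, V i ∈ Cs i) ∧ IsSumOf W V}

/-- The generic `Ext¹` between two subsets:
`ext¹(C,D) = min {dim Ext¹(X,Y) : (X,Y) ∈ C × D}`. -/
def genExt1 (S : Set (FormalRel Q)) {α α' : Q.V → ℕ}
    (C : Set (QRep Q α)) (D : Set (QRep Q α')) : ℕ :=
  sInf {n : ℕ | ∃ X ∈ C, ∃ Y ∈ D, n = dimExt1 S X Y}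

end Sums

section ExtHigher

variable {Q : Quiv}

/-- A representation of `Q` packaged with its dimension vector. -/
def PRp (Q : Quiv) := Σ γ : Q.V → ℕ, QRep Q γ

instance : Inhabited (PRp Q) := ⟨⟨fun _ => 0, fun _ => 0⟩⟩

/-- `K` is a (first) syzygy of `M` over `ℂQ/⟨S⟩`: there is a short exact sequence
`0 → K → P → M → 0` with `P` a projective module. -/
def IsSyzOf (S : Set (FormalRel Q)) (K M : PRp Q) : Prop :=
  K.2 ∈ modSet S K.1 ∧ ∃ (γP : Q.V → ℕ) (P : QRep Q γP), P ∈ modSet S γP ∧ IsProjRep S P ∧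
    ∃ i ∈ HomS K.2 P, ∃ p ∈ HomS P M.2, MorInj i ∧ MorSurj p ∧
      ∀ x, LinearMap.range (Matrix.mulVecLin (i x)) = LinearMap.ker (Matrix.mulVecLin (p x))

/-- A chosen syzygy of `M` over `ℂQ/⟨S⟩`. -/
def syz (S : Set (FormalRel Q)) (M : PRp Q) : PRp Q :=
  Classical.epsilon (fun K => IsSyzOf S K M)

/-- `dim_ℂ Ext^l (M,N)` over `ℂQ/⟨S⟩`, via dimension shifting along syzygies:
`Ext⁰ = Hom`, `Ext¹` is computed by cochains, and `Ext^{l+2}(M,N) = Ext^{l+1}(ΩM,N)`. -/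
def dimExtN (S : Set (FormalRel Q)) : ℕ → PRp Q → PRp Q → ℕ
  | 0, M, N => dimHom M.2 N.2
  | 1, M, N => dimExt1 S M.2 N.2
  | (l+2), M, N => dimExtN S (l+1) (syz S M) N

/-- The simple representation `S_x` concentrated at the vertex `x`. -/
def simplePR (Q : Quiv) (x0 : Q.V) : PRp Q :=
  ⟨fun z => if z = x0 then 1 else 0, fun _ => 0⟩

/-- The Euler form pairing `⟨α, dim S_y⟩_B` of the algebra `B = ℂQ/⟨S⟩`:
`Σ_{l ≥ 0} (−1)^l Σ_x dim Ext^l_B(S_x,S_y) · α(x)`.  The weight `⟨α,−⟩_B` is the function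
`y ↦ eulerPair S α y`. -/
def eulerPair (S : Set (FormalRel Q)) (α : Q.V → ℕ) (y : Q.V) : ℤ :=
  ∑ᶠ l : ℕ, (-1 : ℤ)^l *
    ∑ x : Q.V, (α x : ℤ) * (dimExtN S l (simplePR Q x) (simplePR Q y) : ℤ)

/-- The set of relations annihilating `W`: the annihilator `Ann_{ℂQ}(W)`, so that
`B = ℂQ/Ann_{ℂQ}(W)`. -/
def annRel {β : Q.V → ℕ} (W : QRep Q β) : Set (FormalRel Q) :=
  {r | evalLin W r.2.2 = 0}

/-- The weight semigroup `L_W` of `W`: weights `σ` with `σ|_{supp β} = ⟨α,−⟩_B` for some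
dimension vector `α ∈ ℕ^{supp β}` with `P_B(α) ≠ ∅`, where `B = ℂQ/Ann_{ℂQ}(W)`. -/
def weightSgrp {β : Q.V → ℕ} (W : QRep Q β) : Set (Q.V → ℤ) :=
  {σ | ∃ α : Q.V → ℕ, (∀ x, β x = 0 → α x = 0) ∧ (PAset (annRel W) α).Nonempty ∧
    ∀ y, β y ≠ 0 → σ y = eulerPair (annRel W) α y}

end ExtHigher

section Tame

variable {Q : Quiv}

/-- Specialization of a representation over `ℂ[x]` at `λ ∈ ℂ`, i.e.
`M ⊗_{ℂ[x]} ℂ[x]/(x−λ)`. -/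
def polyEvalAt {γ : Q.V → ℕ} (M : RepR Q (Polynomial ℂ) γ) (lam : ℂ) : QRep Q γ :=
  fun a => (M a).map (fun p => Polynomial.eval lam p)

/-- The algebra `A = ℂQ/⟨S⟩` is tame: for every dimension `d` there are finitely many
`A`–`ℂ[x]`-bimodules `M₁,…,M_s`, free of finite rank over `ℂ[x]` (i.e. matrix
representations over `ℂ[x]` satisfying the relations), such that all but finitely many
isomorphism classes of `d`-dimensional indecomposable `A`-modules are of the form
`M_i ⊗_{ℂ[x]} ℂ[x]/(x−λ)`. -/
def IsTame (S : Set (FormalRel Q)) : Prop :=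
  ∀ d : ℕ, ∃ (s : ℕ) (γs : Fin s → (Q.V → ℕ)) (M : ∀ i, RepR Q (Polynomial ℂ) (γs i)),
    (∀ i, ∀ r ∈ S, evalLinP (M i) r.2.2 = 0) ∧
    ∃ (t : ℕ) (βs : Fin t → (Q.V → ℕ)) (E : ∀ k, QRep Q (βs k)),
      ∀ (α : Q.V → ℕ) (V : QRep Q α), V ∈ modSet S α → (∑ x, α x) = d → IsIndecRep V →
        (∃ k, RIso (E k) V) ∨ (∃ i lam, RIso (polyEvalAt (M i) lam) V)

end Tame

section Stability

variable {Q : Quiv}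

/-- `U` is a subrepresentation of `V` (a family of subspaces preserved by the structure
maps). -/
def SubRep {α : Q.V → ℕ} (V : QRep Q α) (U : ∀ x : Q.V, Submodule ℂ (Fin (α x) → ℂ)) : Prop :=
  ∀ a : Q.A, (U (Q.t a)).map (Matrix.mulVecLin (V a)) ≤ U (Q.h a)

/-- `V` is `θ`-stable: `V ≠ 0`, `θ · dim V = 0`, and `θ · dim V' < 0` for every proper
nonzero subrepresentation `V'` of `V`. -/
def ThetaStable {α : Q.V → ℕ} (θ : Q.V → ℤ) (V : QRep Q α) : Prop :=
  (∃ x, α x ≠ 0) ∧ (∑ x, θ x * (α x : ℤ)) = 0 ∧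
  ∀ U : ∀ x : Q.V, Submodule ℂ (Fin (α x) → ℂ), SubRep V U →
    (∃ x, U x ≠ ⊥) → (∃ x, U x ≠ ⊤) →
      (∑ x, θ x * (Module.finrank ℂ (U x) : ℤ)) < 0

/-- The morphism with components `f` from `P` is essential onto its image: any
subrepresentation of `P` mapping onto the image of `f` is all of `P`. -/
def IsEssentialTo {γ δ : Q.V → ℕ} (P : QRep Q γ)
    (f : ∀ x : Q.V, Matrix (Fin (δ x)) (Fin (γ x)) ℂ) : Prop :=
  ∀ U : ∀ x : Q.V, Submodule ℂ (Fin (γ x) → ℂ), SubRep P U →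
    (∀ x, (U x).map (Matrix.mulVecLin (f x)) = LinearMap.range (Matrix.mulVecLin (f x))) →
      ∀ x, U x = ⊤

end Stability

section Ideal

variable {Q : Quiv}

/-- The `(x,y)`-component of the two-sided ideal `⟨S⟩` of `ℂQ` generated by the
relations in `S`: the span of the translates `q·r·p` of relations `r ∈ S` by paths. -/
def idealComp (S : Set (FormalRel Q)) (x y : Q.V) : Submodule ℂ (Quiver.Path x y →₀ ℂ) :=
  Submodule.span ℂ {c | ∃ r ∈ S, ∃ (p : Quiver.Path x r.1) (q : Quiver.Path r.2.1 y),
    c = Finsupp.mapDomain (fun s => (p.comp s).comp q) r.2.2}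

/-- `W` is a faithful module over `A = ℂQ/⟨S⟩`: every element of `ℂQ` annihilating `W`
lies in the ideal `⟨S⟩`. -/
def FaithfulOver (S : Set (FormalRel Q)) {β : Q.V → ℕ} (W : QRep Q β) : Prop :=
  ∀ (x y : Q.V) (c : Quiver.Path x y →₀ ℂ), evalLin W c = 0 → c ∈ idealComp S x y

end Ideal
section Precomp

variable {Q : Quiv}

/-- Precomposition with a morphism `f : L → M` of representations, as a linear map
`Hom(M,N) → Hom(L,N)`, `φ ↦ φ ∘ f`. -/
def precompMap {γ₁ γ₀ δ : Q.V → ℕ} (L : QRep Q γ₁) (M : QRep Q γ₀) (N : QRep Q δ)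
    (f : ∀ x : Q.V, Matrix (Fin (γ₀ x)) (Fin (γ₁ x)) ℂ) (hf : f ∈ HomS L M) :
    (HomS M N) →ₗ[ℂ] (HomS L N) where
  toFun φ := ⟨fun x => φ.1 x * f x, by
    intro a
    have h1 : φ.1 (Q.h a) * M a = N a * φ.1 (Q.t a) := φ.2 a
    have h2 : f (Q.h a) * L a = M a * f (Q.t a) := hf a
    calc (φ.1 (Q.h a) * f (Q.h a)) * L a
        = φ.1 (Q.h a) * (f (Q.h a) * L a) := by rw [Matrix.mul_assoc]
      _ = φ.1 (Q.h a) * (M a * f (Q.t a)) := by rw [h2]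
      _ = (φ.1 (Q.h a) * M a) * f (Q.t a) := by rw [Matrix.mul_assoc]
      _ = (N a * φ.1 (Q.t a)) * f (Q.t a) := by rw [h1]
      _ = N a * (φ.1 (Q.t a) * f (Q.t a)) := by rw [Matrix.mul_assoc]⟩
  map_add' φ ψ := by
    apply Subtype.ext
    funext x
    simp [Matrix.add_mul]
  map_smul' c φ := by
    apply Subtype.ext
    funext x
    simp [Matrix.smul_mul]

end Precomp

section BipartiteQsig

variable (Q : Quiv) (β : Q.V → ℕ) (σ : Q.V → ℤ)

/-- The bipartite quiver `Q^σ`: its vertices are the vertices of `Q` where `σ` is positive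
together with those where `σ` is negative, and it has one arrow `a_p : v_i → w_j` for every
oriented path `p` in `Q` from `v_i` to `w_j`. -/
def Qsig : Quiv where
  V := PosV Q σ ⊕ NegV Q σ
  A := Σ (i : PosV Q σ) (j : NegV Q σ), Quiver.Path i.1 j.1
  t := fun a => Sum.inl a.1
  h := fun a => Sum.inr a.2.1
  fV := inferInstance
  dV := inferInstance

/-- The dimension vector `β` restricted to `Q^σ`. -/
def betaSig : (Qsig Q σ).V → ℕ := Sum.elim (fun i => β i.1) (fun j => β j.1)

/-- The weight `σ` restricted to `Q^σ`. -/
def sigSig : (Qsig Q σ).V → ℤ := Sum.elim (fun i => σ i.1) (fun j => σ j.1)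

/-- The morphism `φ : rep(Q,β) → rep(Q^σ,β)` given by `φ(W)(a_p) = W(p)`. -/
def phiSig (W : QRep Q β) : QRep (Qsig Q σ) (betaSig Q β σ) :=
  fun a => evalPath W a.2.2

end BipartiteQsig

section KrullAffine

/-- Noether normalization computes the Krull dimension of an affine domain. -/
theorem exists_noether_krullDim (A : Type) [CommRing A] [IsDomain A] [Algebra ℂ A]
    [Algebra.FiniteType ℂ A] :
    ∃ s : ℕ, ringKrullDim A = s ∧ Algebra.trdeg ℂ A = s := by
  obtain ⟨s, g, hg, hg_int⟩ := exists_integral_inj_algHom_of_fg ℂ A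
  refine ⟨s, ?_, ?_⟩
  · have hpoly : ringKrullDim (MvPolynomial (Fin s) ℂ) = s := by
      rw [MvPolynomial.ringKrullDim_of_isNoetherianRing]; simp
    algebraize [g.toRingHom]
    have hmap : algebraMap (MvPolynomial (Fin s) ℂ) A = g.toRingHom := rfl
    have hfaith : FaithfulSMul (MvPolynomial (Fin s) ℂ) A :=
      (faithfulSMul_iff_algebraMap_injective _ _).2 hg
    have : Algebra.IsIntegral (MvPolynomial (Fin s) ℂ) A := ⟨hg_int⟩
    apply le_antisymm
    · rw [← hpoly]
      refine Order.krullDim_le_of_strictMono (PrimeSpectrum.comap (algebraMap _ A)) ?_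
      intro p q hpq
      have hle : p.asIdeal ≤ q.asIdeal := hpq.le
      obtain ⟨x, hxq, hxp⟩ := Set.exists_of_ssubset (show p.asIdeal < q.asIdeal from hpq)
      exact Ideal.comap_lt_comap_of_integral_mem_sdiff hle ⟨hxq, hxp⟩
        (Algebra.IsIntegral.isIntegral x)
    · rw [← hpoly]
      have hle : (s : WithBot ℕ∞) ≤ Order.krullDim (PrimeSpectrum (MvPolynomial (Fin s) ℂ)) :=
        hpoly.ge
      obtain ⟨c, hc⟩ := Order.le_krullDim_iff.1 hle
      obtain ⟨P, hP, hPc⟩ := Ideal.exists_ideal_over_prime_of_isIntegral_of_isDomain (S := A)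
        c.head.asIdeal (by
          rw [(RingHom.injective_iff_ker_eq_bot _).1 (show Function.Injective (algebraMap _ A) from hg)]
          exact bot_le)
      have : P.LiesOver c.head.asIdeal := ⟨hPc.symm⟩
      obtain ⟨L, hL, -⟩ := Ideal.exists_ltSeries_of_hasGoingUp (S := A) c P
      rw [hpoly, ← hc, ← hL]
      exact Order.LTSeries.length_le_krullDim L
  · have halg : AlgebraicIndependent ℂ (fun i => g (MvPolynomial.X i)) := by
      have := (MvPolynomial.algebraicIndependent_X (Fin s) ℂ).map' hg
      exact this
    have htb : IsTranscendenceBasis ℂ (fun i => g (MvPolynomial.X i)) := by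
      rw [halg.isTranscendenceBasis_iff_isAlgebraic]
      have hr : Algebra.adjoin ℂ (Set.range fun i => g (MvPolynomial.X i)) = g.range := by
        rw [← Algebra.map_top, ← MvPolynomial.adjoin_range_X, AlgHom.map_adjoin, ← Set.range_comp]
        rfl
      rw [hr]
      refine ⟨fun a => ?_⟩
      obtain ⟨p, hp, hpa⟩ := hg_int a
      have hg_int' : IsIntegral g.range a := by
        refine ⟨p.map (g.rangeRestrict : _ →+* g.range), hp.map _, ?_⟩
        rw [Polynomial.eval₂_map]
        exact hpa
      exact hg_int'.isAlgebraic
    have := htb.lift_cardinalMk_eq_trdeg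
    simpa using this.symm

theorem le_ringKrullDim_of_algebraicIndependent {A : Type} [CommRing A] [IsDomain A] [Algebra ℂ A]
    [Algebra.FiniteType ℂ A] {r : ℕ} (y : Fin r → A) (hy : AlgebraicIndependent ℂ y) :
    (r : WithBot ℕ∞) ≤ ringKrullDim A := by
  obtain ⟨s, h1, h2⟩ := exists_noether_krullDim A
  have := hy.lift_cardinalMk_le_trdeg
  rw [h2] at this
  rw [h1]
  have h3 : r ≤ s := by simpa using this
  exact_mod_cast h3

theorem ringKrullDim_le_of_injective {A B : Type} [CommRing A] [IsDomain A] [Algebra ℂ A]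
    [Algebra.FiniteType ℂ A] [CommRing B] [IsDomain B] [Algebra ℂ B] (f : A →ₐ[ℂ] B)
    (hf : Function.Injective f) {N : ℕ} (hN : Algebra.trdeg ℂ B ≤ N) :
    ringKrullDim A ≤ N := by
  obtain ⟨s, h1, h2⟩ := exists_noether_krullDim A
  have h3 : Algebra.trdeg ℂ A ≤ Algebra.trdeg ℂ B := by
    simpa using _root_.trdeg_le_of_injective f hf
  have h4 := (h2 ▸ h3).trans hN
  rw [h1]
  have h3 : s ≤ N := by exact_mod_cast h4
  exact_mod_cast h3

end KrullAffine

section ZariskiBasics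

open MvPolynomial

variable {ι X : Type}

/-- The Zariski topology on a type `X` with affine coordinates `c`. -/
abbrev coordTop (c : X → ι → ℂ) : TopologicalSpace X := TopologicalSpace.induced c (zarPi ι)

theorem isOpen_coordTop_iff (c : X → ι → ℂ) (U : Set X) :
    @IsOpen X (coordTop c) U ↔ ∀ x ∈ U, ∃ p : MvPolynomial ι ℂ, eval (c x) p ≠ 0 ∧
      ∀ y, eval (c y) p ≠ 0 → y ∈ U := by
  have h1 : coordTop c = TopologicalSpace.generateFrom
      {V | ∃ p : MvPolynomial ι ℂ, V = {y | eval (c y) p ≠ 0}} := by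
    rw [coordTop, zarPi, induced_generateFrom_eq]
    congr 1
    ext V
    constructor
    · rintro ⟨_, ⟨p, rfl⟩, rfl⟩
      exact ⟨p, rfl⟩
    · rintro ⟨p, rfl⟩
      exact ⟨_, ⟨p, rfl⟩, rfl⟩
  have hbasis : @TopologicalSpace.IsTopologicalBasis X (coordTop c)
      {V | ∃ p : MvPolynomial ι ℂ, V = {y | eval (c y) p ≠ 0}} := by
    let _ := coordTop c
    refine ⟨?_, ?_, h1⟩
    · rintro _ ⟨p, rfl⟩ _ ⟨q, rfl⟩ x ⟨hp, hq⟩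
      refine ⟨_, ⟨p * q, rfl⟩, ?_, ?_⟩
      · simpa using And.intro hp hq
      · intro y hy
        simpa using hy
    · rw [Set.sUnion_eq_univ_iff]
      intro x
      exact ⟨_, ⟨1, rfl⟩, by simp⟩
  let _ := coordTop c
  rw [hbasis.isOpen_iff]
  constructor
  · intro h x hx
    obtain ⟨_, ⟨p, rfl⟩, hp, hs⟩ := h x hx
    exact ⟨p, hp, fun y hy => hs hy⟩
  · intro h x hx
    obtain ⟨p, hp, hs⟩ := h x hx
    exact ⟨_, ⟨p, rfl⟩, hp, fun y hy => hs y hy⟩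

theorem mem_closure_coordTop_iff (c : X → ι → ℂ) (s : Set X) (x : X) :
    x ∈ @closure X (coordTop c) s ↔
      ∀ p : MvPolynomial ι ℂ, (∀ y ∈ s, eval (c y) p = 0) → eval (c x) p = 0 := by
  let _ := coordTop c
  rw [mem_closure_iff]
  constructor
  · intro h p hp
    by_contra hx
    obtain ⟨y, hy, hys⟩ := h {y | eval (c y) p ≠ 0}
      ((isOpen_coordTop_iff c _).2 fun y hy => ⟨p, hy, fun z hz => hz⟩) hx
    exact hy (hp y hys)
  · intro h U hU hx
    obtain ⟨p, hp, hs⟩ := (isOpen_coordTop_iff c U).1 hU x hx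
    by_contra hne
    refine hp (h p fun y hy => ?_)
    by_contra hy0
    exact hne ⟨y, hs y hy0, hy⟩

theorem isIrreducible_coordTop_iff (c : X → ι → ℂ) (s : Set X) :
    @IsIrreducible X (coordTop c) s ↔ s.Nonempty ∧ ∀ p q : MvPolynomial ι ℂ,
      (∀ x ∈ s, eval (c x) (p * q) = 0) → (∀ x ∈ s, eval (c x) p = 0) ∨ ∀ x ∈ s, eval (c x) q = 0 := by
  let _ := coordTop c
  rw [_root_.IsIrreducible]
  refine and_congr_right fun _ => ?_
  constructor
  · intro h p q hpq
    by_contra! hcon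
    obtain ⟨⟨x, hx, hxp⟩, y, hy, hyq⟩ := hcon
    obtain ⟨z, hz, hzp, hzq⟩ := h {y | eval (c y) p ≠ 0} {y | eval (c y) q ≠ 0}
      ((isOpen_coordTop_iff c _).2 fun y hy => ⟨p, hy, fun z hz => hz⟩)
      ((isOpen_coordTop_iff c _).2 fun y hy => ⟨q, hy, fun z hz => hz⟩) ⟨x, hx, hxp⟩ ⟨y, hy, hyq⟩
    have := hpq z hz
    rw [map_mul] at this
    exact (mul_ne_zero hzp hzq) this
  · rintro h U V hU hV ⟨x, hx, hxU⟩ ⟨y, hy, hyV⟩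
    obtain ⟨p, hp, hpU⟩ := (isOpen_coordTop_iff c U).1 hU x hxU
    obtain ⟨q, hq, hqV⟩ := (isOpen_coordTop_iff c V).1 hV y hyV
    by_contra hne
    have : ∀ z ∈ s, eval (c z) (p * q) = 0 := by
      intro z hz
      by_contra hz0
      rw [map_mul] at hz0
      exact hne ⟨z, hz, hpU z (left_ne_zero_of_mul hz0), hqV z (right_ne_zero_of_mul hz0)⟩
    rcases h p q this with h | h
    · exact hp (h x hx)
    · exact hq (h y hy)

/-- The ideal of polynomials vanishing on `s`. -/
def vanIdeal (c : X → ι → ℂ) (s : Set X) : Ideal (MvPolynomial ι ℂ) :=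
  vanishingIdeal ℂ (c '' s)

theorem mem_vanIdeal (c : X → ι → ℂ) (s : Set X) (p : MvPolynomial ι ℂ) :
    p ∈ vanIdeal c s ↔ ∀ x ∈ s, eval (c x) p = 0 := by
  simp [vanIdeal, mem_vanishingIdeal_iff, aeval_eq_eval]

theorem vanIdeal_isPrime (c : X → ι → ℂ) (s : Set X) (h : @IsIrreducible X (coordTop c) s) :
    (vanIdeal c s).IsPrime := by
  rw [isIrreducible_coordTop_iff] at h
  refine ⟨?_, ?_⟩
  · intro htop
    obtain ⟨x, hx⟩ := h.1
    have : (1 : MvPolynomial ι ℂ) ∈ vanIdeal c s := by rw [htop]; trivial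
    simpa using (mem_vanIdeal c s _).1 this x hx
  · intro p q hpq
    simp only [mem_vanIdeal] at hpq ⊢
    exact h.2 p q hpq

/-- The Krull dimension of the Zariski topology given by coordinates `c`. -/
abbrev coordDim (c : X → ι → ℂ) : WithBot ℕ∞ := @topologicalKrullDim X (coordTop c)

theorem coordDim_le_ringKrullDim (c : X → ι → ℂ) (I : Ideal (MvPolynomial ι ℂ))
    (hI : ∀ p ∈ I, ∀ x, eval (c x) p = 0) :
    coordDim c ≤ ringKrullDim (MvPolynomial ι ℂ ⧸ I) := by
  let _ := coordTop c
  have hmk : Function.Surjective (Ideal.Quotient.mk I) := Ideal.Quotient.mk_surjective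
  have hle (Z : TopologicalSpace.IrreducibleCloseds X) :
      RingHom.ker (Ideal.Quotient.mk I) ≤ vanIdeal c (Z : Set X) := by
    rw [Ideal.mk_ker]
    intro p hp
    rw [mem_vanIdeal]
    exact fun x _ => hI p hp x
  let F : (TopologicalSpace.IrreducibleCloseds X)ᵒᵈ → PrimeSpectrum (MvPolynomial ι ℂ ⧸ I) :=
    fun Z => ⟨(vanIdeal c (OrderDual.ofDual Z : TopologicalSpace.IrreducibleCloseds X)).map (Ideal.Quotient.mk I), by
      have := vanIdeal_isPrime c _ (OrderDual.ofDual Z).isIrreducible'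
      exact Ideal.map_isPrime_of_surjective hmk (hle _)⟩
  have hF (Z) : (F Z).asIdeal.comap (Ideal.Quotient.mk I) =
      vanIdeal c ((OrderDual.ofDual Z : TopologicalSpace.IrreducibleCloseds X) : Set X) := by
    rw [Ideal.comap_map_of_surjective _ hmk, sup_eq_left, ← RingHom.ker_eq_comap_bot]
    exact hle _
  rw [coordDim, topologicalKrullDim, ← Order.krullDim_orderDual]
  refine Order.krullDim_le_of_strictMono F (Monotone.strictMono_of_injective ?_ ?_)
  · intro Z W hZW
    refine Ideal.map_mono ?_
    intro p hp
    rw [mem_vanIdeal] at hp ⊢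
    exact fun x hx => hp x (hZW hx)
  · intro Z W hZW
    have h2 : vanIdeal c ((OrderDual.ofDual Z : TopologicalSpace.IrreducibleCloseds X) : Set X)
        = vanIdeal c ((OrderDual.ofDual W : TopologicalSpace.IrreducibleCloseds X) : Set X) := by
      rw [← hF, ← hF, hZW]
    apply OrderDual.ofDual.injective
    apply SetLike.coe_injective
    have key (T : TopologicalSpace.IrreducibleCloseds X) :
        (T : Set X) = {x | ∀ p ∈ vanIdeal c (T : Set X), eval (c x) p = 0} := by
      ext x
      conv_lhs => rw [show (T : Set X) = closure (T : Set X) from T.isClosed'.closure_eq.symm,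
        mem_closure_coordTop_iff]
      simp only [mem_vanIdeal, Set.mem_ofPred_eq]
    rw [key, key (OrderDual.ofDual W), h2]

theorem ringKrullDim_le_coordDim [Finite ι] (c : X → ι → ℂ) (I : Ideal (MvPolynomial ι ℂ))
    (hI : ∀ w : ι → ℂ, (∀ p ∈ I, eval w p = 0) → ∃ x, c x = w) :
    ringKrullDim (MvPolynomial ι ℂ ⧸ I) ≤ coordDim c := by
  let _ := coordTop c
  have hmk : Function.Surjective (Ideal.Quotient.mk I) := Ideal.Quotient.mk_surjective
  have hv (P : PrimeSpectrum (MvPolynomial ι ℂ ⧸ I)) :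
      vanIdeal c {x | ∀ p ∈ P.asIdeal.comap (Ideal.Quotient.mk I), eval (c x) p = 0} =
        P.asIdeal.comap (Ideal.Quotient.mk I) := by
    conv_rhs => rw [← MvPolynomial.IsPrime.vanishingIdeal_zeroLocus (K := ℂ)
      (P.asIdeal.comap (Ideal.Quotient.mk I))]
    rw [vanIdeal]
    congr 1
    ext w
    simp only [Set.mem_image, Set.mem_ofPred_eq, mem_zeroLocus_iff, aeval_eq_eval]
    constructor
    · rintro ⟨x, hx, rfl⟩
      exact hx
    · intro hw
      obtain ⟨x, rfl⟩ := hI w (fun p hp => hw p (by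
        rw [Ideal.mem_comap, Ideal.Quotient.eq_zero_iff_mem.2 hp]; exact zero_mem _))
      exact ⟨x, hw, rfl⟩
  let F : PrimeSpectrum (MvPolynomial ι ℂ ⧸ I) → (TopologicalSpace.IrreducibleCloseds X)ᵒᵈ :=
    fun P => OrderDual.toDual
      ⟨{x | ∀ p ∈ P.asIdeal.comap (Ideal.Quotient.mk I), eval (c x) p = 0}, by
        rw [isIrreducible_coordTop_iff]
        have hpr : (P.asIdeal.comap (Ideal.Quotient.mk I)).IsPrime := inferInstance
        constructor
        · by_contra hne
          rw [Set.not_nonempty_iff_eq_empty] at hne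
          apply hpr.ne_top
          rw [← hv P, hne, Ideal.eq_top_iff_one, mem_vanIdeal]
          simp
        · intro p q hpq
          rw [← mem_vanIdeal, hv P] at hpq
          simp only [← mem_vanIdeal]
          rw [hv P]
          exact hpr.mem_or_mem hpq, by
        rw [← closure_subset_iff_isClosed]
        intro x hx p hp
        exact (mem_closure_coordTop_iff c _ x).1 hx p (fun y hy => hy p hp)⟩
  rw [coordDim, topologicalKrullDim, ← Order.krullDim_orderDual]
  refine Order.krullDim_le_of_strictMono F (Monotone.strictMono_of_injective ?_ ?_)
  · intro P P' h x hx p hp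
    exact hx p (h hp)
  · intro P P' h
    have h1 : {x | ∀ p ∈ P.asIdeal.comap (Ideal.Quotient.mk I), eval (c x) p = 0} =
        {x | ∀ p ∈ P'.asIdeal.comap (Ideal.Quotient.mk I), eval (c x) p = 0} :=
      congrArg (fun Z => ((OrderDual.ofDual Z : TopologicalSpace.IrreducibleCloseds X) : Set X)) h
    have h2 := hv P
    rw [h1, hv P'] at h2
    ext1
    exact Ideal.comap_injective_of_surjective _ hmk h2.symm

theorem coordDim_le_of_rational [Finite ι] (c : X → ι → ℂ) {N : ℕ} (num : ι → MvPolynomial (Fin N) ℂ)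
    (den : MvPolynomial (Fin N) ℂ) (hden : den ≠ 0)
    (h : ∀ p : MvPolynomial ι ℂ, (∀ u : Fin N → ℂ, eval u den ≠ 0 →
      eval (fun i => eval u (num i) / eval u den) p = 0) → ∀ x, eval (c x) p = 0) :
    coordDim c ≤ N := by
  let K := FractionRing (MvPolynomial (Fin N) ℂ)
  let am := algebraMap (MvPolynomial (Fin N) ℂ) K
  let θ : MvPolynomial ι ℂ →ₐ[ℂ] K := aeval fun i => am (num i) / am den
  have hden' : am den ≠ 0 := by
    simpa [am] using hden
  have hclear (p : MvPolynomial ι ℂ) : ∃ (k : ℕ) (q : MvPolynomial (Fin N) ℂ),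
      θ p * am den ^ k = am q ∧ ∀ u : Fin N → ℂ, eval u den ≠ 0 →
        eval (fun i => eval u (num i) / eval u den) p * eval u den ^ k = eval u q := by
    induction p using MvPolynomial.induction_on with
    | C a =>
      refine ⟨0, C a, ?_, ?_⟩
      · simp only [θ, algHom_C, pow_zero, mul_one, am]
        rw [← MvPolynomial.algebraMap_eq, ← IsScalarTower.algebraMap_apply]
      · simp
    | add p q hp hq =>
      obtain ⟨k, P, h1, h2⟩ := hp
      obtain ⟨k', P', h1', h2'⟩ := hq
      refine ⟨k + k', P * den ^ k' + P' * den ^ k, ?_, ?_⟩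
      · simp only [map_add, map_mul, map_pow, ← h1, ← h1']
        ring
      · intro u hu
        simp only [map_add, map_mul, map_pow, ← h2 u hu, ← h2' u hu]
        ring
    | mul_X p i hp =>
      obtain ⟨k, P, h1, h2⟩ := hp
      refine ⟨k + 1, P * num i, ?_, ?_⟩
      · have : θ (MvPolynomial.X i) * am den = am (num i) := by
          simp only [θ, aeval_X]
          rw [div_mul_cancel₀ _ hden']
        rw [map_mul, map_mul, ← h1, ← this]
        ring
      · intro u hu
        have : eval u (num i) / eval u den * eval u den = eval u (num i) :=
          div_mul_cancel₀ _ hu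
        simp only [map_mul, ← h2 u hu, eval_X]
        linear_combination (eval (fun i => (eval u) (num i) / (eval u) den) p) * (eval u den) ^ k * this
  have hker : ∀ p ∈ RingHom.ker θ, ∀ x, eval (c x) p = 0 := by
    intro p hp
    refine h p fun u hu => ?_
    obtain ⟨k, q, h1, h2⟩ := hclear p
    rw [RingHom.mem_ker] at hp
    rw [hp, zero_mul] at h1
    have hq : q = 0 := by
      have : am q = am 0 := by rw [← h1, map_zero]
      exact IsFractionRing.injective (MvPolynomial (Fin N) ℂ) K this
    have := h2 u hu
    rw [hq, map_zero] at this
    exact (mul_eq_zero.1 this).resolve_right (pow_ne_zero _ hu)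
  have hprime : (RingHom.ker θ).IsPrime := RingHom.ker_isPrime _
  refine (coordDim_le_ringKrullDim c (RingHom.ker θ) hker).trans ?_
  refine ringKrullDim_le_of_injective (B := K) (Ideal.kerLiftAlg θ) (RingHom.kerLift_injective _) ?_
  have h5 : Algebra.trdeg ℂ (MvPolynomial (Fin N) ℂ) = Algebra.trdeg ℂ K := by
    have := _root_.trdeg_add_eq ℂ (MvPolynomial (Fin N) ℂ) (A := K)
    rwa [trdeg_eq_zero_iff (R := MvPolynomial (Fin N) ℂ) (A := K) |>.2 (IsLocalization.isAlgebraic _ (nonZeroDivisors (MvPolynomial (Fin N) ℂ))), add_zero] at this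
  rw [← h5, MvPolynomial.trdeg_of_isDomain]
  simp

theorem le_coordDim_of_dominant [Finite ι] (c : X → ι → ℂ) (s : Set (ι → ℂ))
    (hs : @IsIrreducible _ (coordTop (fun w : ι → ℂ => w)) s)
    (hc : ∀ w : ι → ℂ, (∀ p : MvPolynomial ι ℂ, (∀ v ∈ s, eval v p = 0) → eval w p = 0) → ∃ x, c x = w)
    {r : ℕ} (y : Fin r → MvPolynomial ι ℂ)
    (hy : ∀ p : MvPolynomial (Fin r) ℂ, (∀ w ∈ s, eval (fun i => eval w (y i)) p = 0) → p = 0) :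
    (r : WithBot ℕ∞) ≤ coordDim c := by
  set I := vanIdeal (fun w : ι → ℂ => w) s
  have : I.IsPrime := vanIdeal_isPrime _ _ hs
  refine le_trans ?_ (ringKrullDim_le_coordDim c I ?_)
  · apply le_ringKrullDim_of_algebraicIndependent (fun i => Ideal.Quotient.mkₐ ℂ I (y i))
    rw [algebraicIndependent_iff]
    intro p hp
    apply hy
    have h1 : Ideal.Quotient.mkₐ ℂ I (aeval y p) = 0 := by
      rw [← hp, ← comp_aeval_apply]
    have h2 : aeval y p ∈ I := by
      rw [← Ideal.Quotient.eq_zero_iff_mem]; exact h1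
    rw [mem_vanIdeal] at h2
    intro w hw
    rw [← h2 w hw, ← aeval_eq_eval, ← aeval_eq_eval, ← comp_aeval_apply]
  · intro w hw
    apply hc
    intro p hp
    exact hw p ((mem_vanIdeal _ _ _).2 hp)

end ZariskiBasics

section LinePoly

variable {E F : Type} [AddCommGroup E] [Module ℂ E] [AddCommGroup F] [Module ℂ F]

/-- A function which restricts to a polynomial on every affine line. -/
def LinePoly (f : E → ℂ) : Prop :=
  ∀ a b : E, ∃ p : Polynomial ℂ, ∀ t : ℂ, f (a + t • b) = p.eval t

namespace LinePoly

theorem const (z : ℂ) : LinePoly (fun _ : E => z) := fun _ _ => ⟨Polynomial.C z, by simp⟩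

theorem add {f g : E → ℂ} (hf : LinePoly f) (hg : LinePoly g) : LinePoly (fun e => f e + g e) := by
  intro a b
  obtain ⟨p, hp⟩ := hf a b
  obtain ⟨q, hq⟩ := hg a b
  exact ⟨p + q, fun t => by simp only [hp, hq, Polynomial.eval_add]⟩

theorem mul {f g : E → ℂ} (hf : LinePoly f) (hg : LinePoly g) : LinePoly (fun e => f e * g e) := by
  intro a b
  obtain ⟨p, hp⟩ := hf a b
  obtain ⟨q, hq⟩ := hg a b
  exact ⟨p * q, fun t => by simp only [hp, hq, Polynomial.eval_mul]⟩

theorem neg {f : E → ℂ} (hf : LinePoly f) : LinePoly (fun e => - f e) := by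
  simpa using (const (E := E) (-1)).mul hf

theorem sub {f g : E → ℂ} (hf : LinePoly f) (hg : LinePoly g) : LinePoly (fun e => f e - g e) := by
  simpa [sub_eq_add_neg] using hf.add hg.neg

theorem pow {f : E → ℂ} (hf : LinePoly f) (k : ℕ) : LinePoly (fun e => f e ^ k) := by
  induction k with
  | zero => simpa using const (E := E) 1
  | succ k ih => simpa [pow_succ] using ih.mul hf

theorem sum {κ : Type} (s : Finset κ) {f : κ → E → ℂ} (hf : ∀ i ∈ s, LinePoly (f i)) :
    LinePoly (fun e => ∑ i ∈ s, f i e) := by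
  classical
  induction s using Finset.induction_on with
  | empty => simpa using const (E := E) 0
  | insert i s hi ih =>
    simp only [Finset.sum_insert hi]
    exact (hf i (by simp)).add (ih fun j hj => hf j (by simp [hj]))

theorem prod {κ : Type} (s : Finset κ) {f : κ → E → ℂ} (hf : ∀ i ∈ s, LinePoly (f i)) :
    LinePoly (fun e => ∏ i ∈ s, f i e) := by
  classical
  induction s using Finset.induction_on with
  | empty => simpa using const (E := E) 1
  | insert i s hi ih =>
    simp only [Finset.prod_insert hi]
    exact (hf i (by simp)).mul (ih fun j hj => hf j (by simp [hj]))

theorem linear (f : E →ₗ[ℂ] ℂ) : LinePoly (fun e => f e) := by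
  intro a b
  exact ⟨Polynomial.C (f a) + Polynomial.X * Polynomial.C (f b), fun t => by simp; ring⟩

theorem coord {ι : Type} (i : ι) : LinePoly (fun w : ι → ℂ => w i) := by
  intro a b
  exact ⟨Polynomial.C (a i) + Polynomial.X * Polynomial.C (b i), fun t => by simp; ring⟩

theorem comp_affine {f : F → ℂ} (hf : LinePoly f) (u : E →ₗ[ℂ] F) (v : F) :
    LinePoly (fun e => f (v + u e)) := by
  intro a b
  obtain ⟨p, hp⟩ := hf (v + u a) (u b)
  exact ⟨p, fun t => by rw [← hp]; simp [add_assoc]⟩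

theorem comp_linear {f : F → ℂ} (hf : LinePoly f) (u : E →ₗ[ℂ] F) :
    LinePoly (fun e => f (u e)) := by
  simpa using hf.comp_affine u 0

theorem eval_mvPolynomial {ι : Type} {f : ι → E → ℂ} (hf : ∀ i, LinePoly (f i))
    (p : MvPolynomial ι ℂ) : LinePoly (fun e => MvPolynomial.eval (fun i => f i e) p) := by
  induction p using MvPolynomial.induction_on with
  | C a => simpa using const (E := E) a
  | add p q hp hq => simpa using hp.add hq
  | mul_X p i hp => simpa using hp.mul (hf i)

theorem det {κ : Type} [Fintype κ] [DecidableEq κ] {A : E → Matrix κ κ ℂ}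
    (hA : ∀ i j, LinePoly (fun e => A e i j)) : LinePoly (fun e => (A e).det) := by
  simp only [Matrix.det_apply']
  exact sum _ fun σ _ => (const _).mul (prod _ fun i _ => hA _ _)

theorem adjugate {κ : Type} [Fintype κ] [DecidableEq κ] {A : E → Matrix κ κ ℂ}
    (hA : ∀ i j, LinePoly (fun e => A e i j)) (i j : κ) :
    LinePoly (fun e => (A e).adjugate i j) := by
  simp only [Matrix.adjugate_apply]
  refine det fun i' j' => ?_
  by_cases h : i' = j
  · subst h
    simpa using const _
  · simpa [Matrix.updateRow_ne h] using hA i' j'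

theorem matrix_mul {m n k : Type} [Fintype n] {A : E → Matrix m n ℂ} {B : E → Matrix n k ℂ}
    (hA : ∀ i j, LinePoly (fun e => A e i j)) (hB : ∀ i j, LinePoly (fun e => B e i j)) (i : m) (j : k) :
    LinePoly (fun e => (A e * B e) i j) := by
  simp only [Matrix.mul_apply]
  exact sum _ fun l _ => (hA _ _).mul (hB _ _)

theorem exists_mul_ne_zero {f g : E → ℂ} (hf : LinePoly f) (hg : LinePoly g) {a b : E}
    (ha : f a ≠ 0) (hb : g b ≠ 0) : ∃ t : ℂ, f (a + t • (b - a)) ≠ 0 ∧ g (a + t • (b - a)) ≠ 0 := by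
  obtain ⟨p, hp⟩ := hf a (b - a)
  obtain ⟨q, hq⟩ := hg a (b - a)
  have hp0 : p ≠ 0 := by
    rintro rfl
    have := hp 0
    simp at this
    exact ha this
  have hq0 : q ≠ 0 := by
    rintro rfl
    have := hq 1
    simp at this
    exact hb this
  obtain ⟨t, ht⟩ : ∃ t, (p * q).eval t ≠ 0 := by
    by_contra! h
    exact mul_ne_zero hp0 hq0 (Polynomial.funext fun t => by simpa using h t)
  rw [Polynomial.eval_mul] at ht
  exact ⟨t, by rw [hp]; exact left_ne_zero_of_mul ht, by rw [hq]; exact right_ne_zero_of_mul ht⟩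

theorem eq_zero_of_mul {f g : E → ℂ} (hf : LinePoly f) (hg : LinePoly g) {a : E} (ha : f a ≠ 0)
    (h : ∀ e, f e ≠ 0 → g e = 0) (e : E) : g e = 0 := by
  by_contra hb
  obtain ⟨t, h1, h2⟩ := hf.exists_mul_ne_zero hg ha hb
  exact h2 (h _ h1)

theorem finite_zeros {f : ℂ → ℂ} (hf : LinePoly f) {a : ℂ} (ha : f a ≠ 0) : {t | f t = 0}.Finite := by
  obtain ⟨p, hp⟩ := hf 0 1
  have hp' : ∀ t, f t = p.eval t := fun t => by simpa using hp t
  have hp0 : p ≠ 0 := by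
    rintro rfl
    exact ha (by simp [hp'])
  refine (p.roots.toFinset.finite_toSet).subset fun t ht => ?_
  simp [hp0, ← hp', ht.out]

end LinePoly

open MvPolynomial in
theorem coordDim_le_card {ι X : Type} [Fintype ι] (c : X → ι → ℂ) : coordDim c ≤ Fintype.card ι := by
  refine (coordDim_le_ringKrullDim c ⊥ (by simp)).trans ?_
  rw [ringKrullDim_eq_of_ringEquiv (RingEquiv.quotientBot _),
    MvPolynomial.ringKrullDim_of_isNoetherianRing]
  simp

open MvPolynomial in
theorem card_le_coordDim {ι X : Type} [Fintype ι] (c : X → ι → ℂ) (d : (ι → ℂ) → ℂ) (hd : LinePoly d)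
    (hc : Set.range c = {w | d w ≠ 0}) (a : ι → ℂ) (ha : d a ≠ 0) :
    (Fintype.card ι : WithBot ℕ∞) ≤ coordDim c := by
  classical
  let _ := coordTop c
  set n := Fintype.card ι
  let e : ι ≃ Fin n := Fintype.equivFin ι
  let H : Fin (n + 1) → Set X := fun k => {x | ∀ i, (k : ℕ) ≤ e i → c x i = a i}
  have hirr (k) : @_root_.IsIrreducible X (coordTop c) (H k) := by
    rw [isIrreducible_coordTop_iff]
    obtain ⟨x0, hx0⟩ : a ∈ Set.range c := by rw [hc]; exact ha
    refine ⟨⟨x0, fun i _ => by rw [hx0]⟩, fun p q hpq => ?_⟩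
    by_contra! hcon
    obtain ⟨⟨x, hx, hxp⟩, y, hy, hyq⟩ := hcon
    have hX (i : ι) : LinePoly (fun w : ι → ℂ => w i) := LinePoly.coord i
    have hlp : LinePoly (fun w : ι → ℂ => MvPolynomial.eval w p * d w) :=
      (LinePoly.eval_mvPolynomial hX p).mul hd
    have hlq : LinePoly (fun w : ι → ℂ => MvPolynomial.eval w q) := LinePoly.eval_mvPolynomial hX q
    have hdx : d (c x) ≠ 0 := by
      have : c x ∈ Set.range c := ⟨x, rfl⟩
      rwa [hc] at this
    obtain ⟨t, h1, h2⟩ := hlp.exists_mul_ne_zero hlq (mul_ne_zero hxp hdx) hyq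
    obtain ⟨z, hz⟩ : c x + t • (c y - c x) ∈ Set.range c := by
      rw [hc]; exact right_ne_zero_of_mul h1
    have hzH : z ∈ H k := by
      intro i hi
      rw [hz]
      simp [hx i hi, hy i hi]
    have := hpq z hzH
    rw [map_mul, hz] at this
    exact mul_ne_zero (left_ne_zero_of_mul h1) h2 this
  have hclosed (k) : @IsClosed X (coordTop c) (H k) := by
    rw [← closure_subset_iff_isClosed]
    intro x hx i hi
    have := (mem_closure_coordTop_iff c _ x).1 hx (MvPolynomial.X i - MvPolynomial.C (a i)) (by
      intro y hy
      simp [hy i hi])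
    simpa [sub_eq_zero] using this
  let L : LTSeries (TopologicalSpace.IrreducibleCloseds X) :=
    { length := n
      toFun := fun k => ⟨H k, hirr k, hclosed k⟩
      step := by
        intro k
        constructor
        · intro x hx i hi
          exact hx i (by simp only [Fin.val_castSucc, Fin.val_succ] at hi ⊢; omega)
        · intro hle
          let i := e.symm k
          have h1 : LinePoly (fun t : ℂ => d (a + (LinearMap.toSpanSingleton ℂ (ι → ℂ) (Pi.single i 1)) t)) :=
            hd.comp_affine _ a
          have h2 : LinePoly (fun t : ℂ => t) := LinePoly.linear LinearMap.id
          obtain ⟨t, ht1, ht2⟩ := h1.exists_mul_ne_zero h2 (a := 0) (b := 1) (by simpa using ha) one_ne_zero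
          simp only [sub_zero, smul_eq_mul, mul_one, zero_add] at ht1 ht2
          obtain ⟨x, hx⟩ : (a + (LinearMap.toSpanSingleton ℂ (ι → ℂ) (Pi.single i 1)) t) ∈ Set.range c := by
            rw [hc]; exact ht1
          have hxH : x ∈ H k.succ := by
            intro j hj
            have hji : j ≠ i := by
              rintro rfl
              simp [i] at hj
            rw [hx]
            simp [hji]
          have := (show H k.succ ⊆ H k.castSucc from hle) hxH i (by simp [i])
          rw [hx] at this
          simp at this
          exact ht2 this }
  exact Order.LTSeries.length_le_krullDim L

theorem glDim_eq (α : Q.V → ℕ) : glDim Q α = ((∑ x, α x ^ 2 : ℕ) : WithBot ℕ∞) := by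
  have hcard : Fintype.card (Σ x : Q.V, Fin (α x) × Fin (α x)) = ∑ x, α x ^ 2 := by
    simp [sq]
  have htop : glDim Q α = coordDim (fun g : glSet Q α => glCoords g.1) := by
    rw [glDim, coordDim, glTop, coordTop, induced_compose]
  rw [htop, ← hcard]
  refine le_antisymm (coordDim_le_card _) ?_
  let mat (w : (Σ x : Q.V, Fin (α x) × Fin (α x)) → ℂ) (x : Q.V) : Matrix (Fin (α x)) (Fin (α x)) ℂ :=
    fun i j => w ⟨x, i, j⟩
  refine card_le_coordDim _ (fun w => ∏ x, (mat w x).det) ?_ ?_ (glCoords fun x => 1) ?_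
  · exact LinePoly.prod _ fun x _ => LinePoly.det fun i j =>
      LinePoly.coord (⟨x, i, j⟩ : Σ x : Q.V, Fin (α x) × Fin (α x))
  · ext w
    simp only [Set.mem_range, Set.mem_ofPred_eq, Finset.prod_ne_zero_iff, Finset.mem_univ, true_imp_iff]
    constructor
    · rintro ⟨g, rfl⟩ x
      have := g.2 x
      rw [Matrix.isUnit_iff_isUnit_det] at this
      exact this.ne_zero
    · intro h
      refine ⟨⟨fun x => mat w x, fun x => ?_⟩, rfl⟩
      rw [Matrix.isUnit_iff_isUnit_det]
      exact (h x).isUnit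
  · have : ∀ x, mat (glCoords fun x : Q.V => (1 : Matrix (Fin (α x)) (Fin (α x)) ℂ)) x = 1 := fun x => rfl
    simp [this]

end LinePoly

section GenericSolution

variable {E F X Y : Type} [AddCommGroup E] [Module ℂ E] [AddCommGroup F] [Module ℂ F]
  [AddCommGroup X] [Module ℂ X] [AddCommGroup Y] [Module ℂ Y]

/-- A vector-valued map all of whose linear coordinates are polynomial along lines. -/
def LinePolyV (f : E → X) : Prop := ∀ φ : X →ₗ[ℂ] ℂ, LinePoly (fun e => φ (f e))

namespace LinePolyV

theorem const (x : X) : LinePolyV (fun _ : E => x) := fun φ => LinePoly.const (φ x)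

theorem smul {f : E → ℂ} {g : E → X} (hf : LinePoly f) (hg : LinePolyV g) :
    LinePolyV (fun e => f e • g e) := by
  intro φ
  simpa using hf.mul (hg φ)

theorem sum {κ : Type} (s : Finset κ) {f : κ → E → X} (hf : ∀ i ∈ s, LinePolyV (f i)) :
    LinePolyV (fun e => ∑ i ∈ s, f i e) := by
  intro φ
  simpa using LinePoly.sum s fun i hi => hf i hi φ

theorem map {f : E → X} (hf : LinePolyV f) (u : X →ₗ[ℂ] Y) : LinePolyV (fun e => u (f e)) :=
  fun φ => hf (φ ∘ₗ u)

theorem prodMk {f : E → X} {g : E → Y} (hf : LinePolyV f) (hg : LinePolyV g) :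
    LinePolyV (fun e => (f e, g e)) := by
  intro φ
  have h : ∀ e, φ (f e, g e) = (φ ∘ₗ LinearMap.inl ℂ X Y) (f e) + (φ ∘ₗ LinearMap.inr ℂ X Y) (g e) := by
    intro e
    simp [← map_add]
  simp only [h]
  exact (hf _).add (hg _)

theorem of_pi {κ : Type} [Finite κ] {Z : κ → Type} [∀ i, AddCommGroup (Z i)] [∀ i, Module ℂ (Z i)]
    {f : E → ∀ i, Z i} (hf : ∀ i, LinePolyV (fun e => f e i)) : LinePolyV f := by
  classical
  have := Fintype.ofFinite κ
  have h : ∀ e, f e = ∑ i, LinearMap.single ℂ Z i (f e i) := by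
    intro e
    exact (Finset.univ_sum_single (f e)).symm
  rw [show f = fun e => ∑ i, LinearMap.single ℂ Z i (f e i) from funext h]
  exact sum _ fun i _ => (hf i).map _

theorem of_scalar {f : E → ℂ} (hf : LinePoly f) : LinePolyV f := by
  simpa using smul hf (const (1 : ℂ))

theorem of_matrix {m n : Type} [Finite m] [Finite n] {f : E → Matrix m n ℂ}
    (hf : ∀ i j, LinePoly (fun e => f e i j)) : LinePolyV f := by
  have : LinePolyV (X := m → n → ℂ) f := of_pi fun i => of_pi fun j => of_scalar (hf i j)
  exact this

theorem linear (u : E →ₗ[ℂ] X) : LinePolyV (fun e => u e) := fun φ => LinePoly.linear (φ ∘ₗ u)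

end LinePolyV

/-- If a polynomial family of linear maps is injective at one parameter, the solution of the
corresponding linear system is given generically by Cramer's rule. -/
theorem exists_generic_solution [FiniteDimensional ℂ X] [FiniteDimensional ℂ Y]
    (A : E → X →ₗ[ℂ] Y) (hA : ∀ x, LinePolyV (fun e => A e x)) (e0 : E)
    (h0 : Function.Injective (A e0)) (b : E → Y) (hb : LinePolyV b) (x0 : X) (hx0 : A e0 x0 = b e0) :
    ∃ (D : E → ℂ) (S : E → X), LinePoly D ∧ LinePolyV S ∧ D e0 ≠ 0 ∧ S e0 = D e0 • x0 ∧
      (∀ e, D e ≠ 0 → Function.Injective (A e)) ∧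
      ∀ e x, A e x = b e → S e = D e • x := by
  classical
  obtain ⟨B, hB⟩ := (A e0).exists_leftInverse_of_injective (LinearMap.ker_eq_bot.2 h0)
  let v := Module.finBasis ℂ X
  let T : E → Matrix _ _ ℂ := fun e => LinearMap.toMatrix v v (B ∘ₗ A e)
  have hT : ∀ i j, LinePoly (fun e => T e i j) := by
    intro i j
    simp only [T, LinearMap.toMatrix_apply]
    exact ((hA (v j)).map B) (v.coord i)
  have hT0 : T e0 = 1 := by
    simp only [T, hB, LinearMap.toMatrix_id]
  let s : E → (Fin (Module.finrank ℂ X) → ℂ) := fun e => (T e).adjugate *ᵥ (v.repr (B (b e)))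
  have hs : ∀ i, LinePoly (fun e => s e i) := by
    intro i
    simp only [s, Matrix.mulVec, dotProduct]
    exact LinePoly.sum _ fun j _ => (LinePoly.adjugate hT i j).mul ((hb.map B) (v.coord j))
  have key : ∀ e x, A e x = b e → ∑ i, s e i • v i = (T e).det • x := by
    intro e x hx
    have h1 : T e *ᵥ v.repr x = v.repr (B (b e)) := by
      rw [← hx]
      exact LinearMap.toMatrix_mulVec_repr v v (B ∘ₗ A e) x
    have h2 : s e = (T e).det • (v.repr x : Fin (Module.finrank ℂ X) → ℂ) := by
      simp only [s]
      rw [← h1, Matrix.mulVec_mulVec, Matrix.adjugate_mul, Matrix.smul_mulVec, Matrix.one_mulVec]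
    rw [h2]
    simp only [Pi.smul_apply, smul_eq_mul, mul_smul]
    rw [← Finset.smul_sum, v.sum_repr]
  refine ⟨fun e => (T e).det, fun e => ∑ i, s e i • v i, LinePoly.det hT, ?_, ?_, ?_, ?_, ?_⟩
  · exact LinePolyV.sum _ fun i _ => LinePolyV.smul (hs i) (LinePolyV.const _)
  · simp [hT0]
  · exact key e0 x0 hx0
  · intro e he
    rw [← LinearMap.ker_eq_bot, LinearMap.ker_eq_bot']
    intro x hx
    have h1 : T e *ᵥ v.repr x = 0 := by
      have := LinearMap.toMatrix_mulVec_repr v v (B ∘ₗ A e) x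
      rw [LinearMap.comp_apply, hx] at this
      simpa using this
    have h2 := Matrix.eq_zero_of_mulVec_eq_zero he h1
    apply v.repr.injective
    ext i
    simpa using congrFun h2 i
  · exact key

/-- Upper semicontinuity of the kernel dimension along a polynomial family. -/
theorem exists_generic_ker_le [FiniteDimensional ℂ X] [FiniteDimensional ℂ Y]
    (A : E → X →ₗ[ℂ] Y) (hA : ∀ x, LinePolyV (fun e => A e x)) (e0 : E) :
    ∃ D : E → ℂ, LinePoly D ∧ D e0 ≠ 0 ∧ ∀ e, D e ≠ 0 →
      Module.finrank ℂ (LinearMap.ker (A e)) ≤ Module.finrank ℂ (LinearMap.ker (A e0)) := by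
  obtain ⟨X0, hX0⟩ := (LinearMap.ker (A e0)).exists_isCompl
  obtain ⟨D, S, hD, -, hD0, -, hinj, -⟩ := exists_generic_solution (fun e => (A e) ∘ₗ X0.subtype)
    (fun x => hA x) e0 (by
      rw [injective_iff_map_eq_zero]
      intro x hx
      exact Subtype.ext ((Submodule.disjoint_def.mp hX0.disjoint) _ hx x.2)) (fun _ => 0) (LinePolyV.const 0) 0 (by simp)
  refine ⟨D, hD, hD0, fun e he => ?_⟩
  have h1 : Disjoint (LinearMap.ker (A e)) X0 := by
    rw [Submodule.disjoint_def]
    intro x hx hx0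
    have := hinj e he (a₁ := ⟨x, hx0⟩) (a₂ := 0) (by simpa using hx)
    simpa using congrArg Subtype.val this
  have h2 := Submodule.finrank_add_finrank_le_of_disjoint h1
  have h3 := Submodule.finrank_add_eq_of_isCompl hX0
  omega

end GenericSolution

section LineRat

variable {E : Type} [AddCommGroup E] [Module ℂ E]

/-- On the locus `D ≠ 0`, the function `f` is a quotient, by a power of `D`, of a function which
is polynomial along lines. -/
def LineRat (D f : E → ℂ) : Prop :=
  ∃ (k : ℕ) (F : E → ℂ), LinePoly F ∧ ∀ e, D e ≠ 0 → F e = D e ^ k * f e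

namespace LineRat

variable {D : E → ℂ}

theorem of_linePoly {f : E → ℂ} (hf : LinePoly f) : LineRat D f := ⟨0, f, hf, by simp⟩

theorem add (hD : LinePoly D) {f g : E → ℂ} (hf : LineRat D f) (hg : LineRat D g) :
    LineRat D (fun e => f e + g e) := by
  obtain ⟨k, F, hF, h⟩ := hf
  obtain ⟨k', G, hG, h'⟩ := hg
  refine ⟨k + k', fun e => D e ^ k' * F e + D e ^ k * G e,
    ((hD.pow k').mul hF).add ((hD.pow k).mul hG), fun e he => ?_⟩
  simp only [h e he, h' e he]
  ring

theorem mul {f g : E → ℂ} (hf : LineRat D f) (hg : LineRat D g) : LineRat D (fun e => f e * g e) := by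
  obtain ⟨k, F, hF, h⟩ := hf
  obtain ⟨k', G, hG, h'⟩ := hg
  refine ⟨k + k', fun e => F e * G e, hF.mul hG, fun e he => ?_⟩
  simp only [h e he, h' e he]
  ring

theorem sum (hD : LinePoly D) {κ : Type} (s : Finset κ) {f : κ → E → ℂ}
    (hf : ∀ i ∈ s, LineRat D (f i)) : LineRat D (fun e => ∑ i ∈ s, f i e) := by
  classical
  induction s using Finset.induction_on with
  | empty => simpa using of_linePoly (LinePoly.const 0)
  | insert a s ha ih =>
    simp only [Finset.sum_insert ha]
    exact add hD (hf a (Finset.mem_insert_self _ _)) (ih fun i hi => hf i (Finset.mem_insert_of_mem hi))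

theorem matrix_mul (hD : LinePoly D) {m n k : Type} [Fintype n] {A : E → Matrix m n ℂ}
    {B : E → Matrix n k ℂ} (hA : ∀ i j, LineRat D (fun e => A e i j))
    (hB : ∀ i j, LineRat D (fun e => B e i j)) (i : m) (j : k) :
    LineRat D (fun e => (A e * B e) i j) := by
  simp only [Matrix.mul_apply]
  exact sum hD _ fun l _ => (hA _ _).mul (hB _ _)

theorem eval_mvPolynomial (hD : LinePoly D) {ι : Type} {f : ι → E → ℂ} (hf : ∀ i, LineRat D (f i))
    (p : MvPolynomial ι ℂ) : LineRat D (fun e => MvPolynomial.eval (fun i => f i e) p) := by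
  induction p using MvPolynomial.induction_on with
  | C a => simpa using of_linePoly (LinePoly.const a)
  | add p q hp hq => simpa using add hD hp hq
  | mul_X p i hp => simpa using hp.mul (hf i)

theorem matrix_inv {κ : Type} [Fintype κ] [DecidableEq κ] {A : E → Matrix κ κ ℂ} {G : E → ℂ}
    (hA : ∀ i j, LinePoly (fun e => A e i j)) (hG : LinePoly G)
    (hDG : ∀ e, D e = G e * (A e).det) (i j : κ) : LineRat D (fun e => (A e)⁻¹ i j) := by
  refine ⟨1, fun e => G e * (A e).adjugate i j, hG.mul (LinePoly.adjugate hA i j), fun e he => ?_⟩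
  have h : (A e).det ≠ 0 := by
    rw [hDG] at he
    exact right_ne_zero_of_mul he
  have h2 : (A e)⁻¹ i j = (A e).det⁻¹ * (A e).adjugate i j := by
    rw [Matrix.inv_def, Ring.inverse_eq_inv', Matrix.smul_apply, smul_eq_mul]
  simp only [h2, hDG, pow_one]
  field_simp

/-- A rational function vanishing generically vanishes wherever it is defined. -/
theorem eq_zero (hD : LinePoly D) {f G : E → ℂ} (hf : LineRat D f) (hG : LinePoly G) {a : E}
    (ha : D a ≠ 0) (ha' : G a ≠ 0) (h : ∀ e, D e ≠ 0 → G e ≠ 0 → f e = 0) (e : E) (he : D e ≠ 0) :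
    f e = 0 := by
  obtain ⟨k, F, hF, hk⟩ := hf
  have h0 : F e = 0 := by
    refine LinePoly.eq_zero_of_mul (hD.mul hG) hF (mul_ne_zero ha ha') (fun e' he' => ?_) e
    rw [hk _ (left_ne_zero_of_mul he'), h _ (left_ne_zero_of_mul he') (right_ne_zero_of_mul he'),
      mul_zero]
  rw [hk e he] at h0
  exact (mul_eq_zero.1 h0).resolve_left (pow_ne_zero _ he)

end LineRat

end LineRat

section PolyFn

variable {ι : Type}

/-- A function on `ι → ℂ` given by a polynomial. -/
def PolyFn (f : (ι → ℂ) → ℂ) : Prop := ∃ p : MvPolynomial ι ℂ, ∀ u, f u = MvPolynomial.eval u p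

namespace PolyFn

theorem const (z : ℂ) : PolyFn (fun _ : ι → ℂ => z) := ⟨MvPolynomial.C z, by simp⟩

theorem coord (i : ι) : PolyFn (fun u : ι → ℂ => u i) := ⟨MvPolynomial.X i, by simp⟩

theorem add {f g : (ι → ℂ) → ℂ} (hf : PolyFn f) (hg : PolyFn g) : PolyFn (fun e => f e + g e) := by
  obtain ⟨p, hp⟩ := hf
  obtain ⟨q, hq⟩ := hg
  exact ⟨p + q, fun u => by simp [hp, hq]⟩

theorem mul {f g : (ι → ℂ) → ℂ} (hf : PolyFn f) (hg : PolyFn g) : PolyFn (fun e => f e * g e) := by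
  obtain ⟨p, hp⟩ := hf
  obtain ⟨q, hq⟩ := hg
  exact ⟨p * q, fun u => by simp [hp, hq]⟩

theorem sum {κ : Type} (s : Finset κ) {f : κ → (ι → ℂ) → ℂ} (hf : ∀ i ∈ s, PolyFn (f i)) :
    PolyFn (fun e => ∑ i ∈ s, f i e) := by
  classical
  induction s using Finset.induction_on with
  | empty => simpa using const 0
  | insert a s ha ih =>
    simp only [Finset.sum_insert ha]
    exact add (hf a (Finset.mem_insert_self _ _)) (ih fun i hi => hf i (Finset.mem_insert_of_mem hi))

theorem prod {κ : Type} (s : Finset κ) {f : κ → (ι → ℂ) → ℂ} (hf : ∀ i ∈ s, PolyFn (f i)) :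
    PolyFn (fun e => ∏ i ∈ s, f i e) := by
  classical
  induction s using Finset.induction_on with
  | empty => simpa using const 1
  | insert a s ha ih =>
    simp only [Finset.prod_insert ha]
    exact mul (hf a (Finset.mem_insert_self _ _)) (ih fun i hi => hf i (Finset.mem_insert_of_mem hi))

theorem linear [Finite ι] (φ : (ι → ℂ) →ₗ[ℂ] ℂ) : PolyFn (fun u => φ u) := by
  classical
  have := Fintype.ofFinite ι
  have h : ∀ u, φ u = ∑ i, u i * φ (Pi.single i 1) := by
    intro u
    conv_lhs => rw [← Finset.univ_sum_single u, map_sum]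
    refine Finset.sum_congr rfl fun i _ => ?_
    rw [← smul_eq_mul, ← map_smul, ← Pi.single_smul, smul_eq_mul, mul_one]
  rw [show (fun u => φ u) = fun u => ∑ i, u i * φ (Pi.single i 1) from funext h]
  exact sum _ fun i _ => (coord i).mul (const _)

theorem eval_mvPolynomial {κ : Type} {f : κ → (ι → ℂ) → ℂ} (hf : ∀ i, PolyFn (f i))
    (p : MvPolynomial κ ℂ) : PolyFn (fun e => MvPolynomial.eval (fun i => f i e) p) := by
  induction p using MvPolynomial.induction_on with
  | C a => simpa using const a
  | add p q hp hq => simpa using hp.add hq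
  | mul_X p i hp => simpa using hp.mul (hf i)

theorem comp {κ : Type} {f : (κ → ℂ) → ℂ} (hf : PolyFn f) {g : κ → (ι → ℂ) → ℂ}
    (hg : ∀ i, PolyFn (g i)) : PolyFn (fun u => f (fun i => g i u)) := by
  obtain ⟨p, hp⟩ := hf
  simp only [hp]
  exact eval_mvPolynomial hg p

theorem linePoly {f : (ι → ℂ) → ℂ} (hf : PolyFn f) : LinePoly f := by
  obtain ⟨p, hp⟩ := hf
  rw [show f = fun u => MvPolynomial.eval (fun i => u i) p from funext hp]
  exact LinePoly.eval_mvPolynomial (f := fun i (u : ι → ℂ) => u i) (fun i => LinePoly.coord i) p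

theorem det {κ : Type} [Fintype κ] [DecidableEq κ] {A : (ι → ℂ) → Matrix κ κ ℂ}
    (hA : ∀ i j, PolyFn (fun e => A e i j)) : PolyFn (fun e => (A e).det) := by
  simp only [Matrix.det_apply']
  exact sum _ fun σ _ => (const _).mul (prod _ fun i _ => hA _ _)

theorem adjugate {κ : Type} [Fintype κ] [DecidableEq κ] {A : (ι → ℂ) → Matrix κ κ ℂ}
    (hA : ∀ i j, PolyFn (fun e => A e i j)) (i j : κ) :
    PolyFn (fun e => (A e).adjugate i j) := by
  simp only [Matrix.adjugate_apply]
  refine det fun i' j' => ?_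
  by_cases h : i' = j
  · subst h
    simpa using const _
  · simpa [Matrix.updateRow_ne h] using hA i' j'

theorem matrix_mul {m n k : Type} [Fintype n] {A : (ι → ℂ) → Matrix m n ℂ}
    {B : (ι → ℂ) → Matrix n k ℂ} (hA : ∀ i j, PolyFn (fun e => A e i j))
    (hB : ∀ i j, PolyFn (fun e => B e i j)) (i : m) (j : k) :
    PolyFn (fun e => (A e * B e) i j) := by
  simp only [Matrix.mul_apply]
  exact sum _ fun l _ => (hA _ _).mul (hB _ _)

end PolyFn

end PolyFn

/-- A subspace of dimension `d` is mapped isomorphically to `ℂ^d` by a linear map defined on the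
whole space. -/
theorem exists_linear_section {X : Type} [AddCommGroup X] [Module ℂ X] [FiniteDimensional ℂ X]
    (K : Submodule ℂ X) : ∃ f : X →ₗ[ℂ] (Fin (Module.finrank ℂ K) → ℂ),
      (∀ x ∈ K, f x = 0 → x = 0) ∧ Function.Surjective f := by
  obtain ⟨K', hK⟩ := K.exists_isCompl
  let e := (Module.finBasis ℂ K).equivFun
  have h : ∀ x : K, (e.toLinearMap ∘ₗ K.projectionOnto K' hK) x = e x := by
    intro x
    simp [Submodule.projectionOnto_apply_left]
  refine ⟨e.toLinearMap ∘ₗ K.projectionOnto K' hK, fun x hx h0 => ?_, fun y => ?_⟩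
  · have := h ⟨x, hx⟩
    rw [show ((⟨x, hx⟩ : K) : X) = x from rfl, h0] at this
    have := e.injective (this.symm.trans (map_zero e).symm)
    simpa using congrArg Subtype.val this
  · exact ⟨e.symm y, by rw [h]; simp⟩

section Families

theorem prodMap_eq_iff {X Y Z : Type} [AddCommGroup X] [Module ℂ X] [AddCommGroup Y] [Module ℂ Y]
    [AddCommGroup Z] [Module ℂ Z] {f : X →ₗ[ℂ] Y} {g : X →ₗ[ℂ] Z} {x : X} {y : Y} {z : Z} :
    f.prod g x = (y, z) ↔ f x = y ∧ g x = z := Prod.mk.injEq _ _ _ _ ▸ Iff.rfl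

theorem prodMap_eq_zero_iff {X Y Z : Type} [AddCommGroup X] [Module ℂ X] [AddCommGroup Y]
    [Module ℂ Y] [AddCommGroup Z] [Module ℂ Z] {f : X →ₗ[ℂ] Y} {g : X →ₗ[ℂ] Z} {x : X} :
    f.prod g x = 0 ↔ f x = 0 ∧ g x = 0 := prodMap_eq_iff

/-- The space of families of matrices `V(x) → W(x)`. -/
abbrev C0sp (α γ : Q.V → ℕ) := ∀ x : Q.V, Matrix (Fin (γ x)) (Fin (α x)) ℂ

theorem one_mem_homS {α : Q.V → ℕ} (V : QRep Q α) : (1 : C0sp (Q := Q) α α) ∈ HomS V V :=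
  fun a => by simp

open MvPolynomial

theorem mem_zclosure_iff {β : Q.V → ℕ} {s : Set (QRep Q β)} {W : QRep Q β} :
    W ∈ zclosure s ↔ ∀ p : MvPolynomial (RepCoord (Q := Q) β) ℂ,
      (∀ w ∈ s, eval (repCoords w) p = 0) → eval (repCoords W) p = 0 :=
  mem_closure_coordTop_iff repCoords s W

theorem subset_zclosure {β : Q.V → ℕ} (s : Set (QRep Q β)) : s ⊆ zclosure s :=
  fun _ hw => mem_zclosure_iff.2 fun _ hp => hp _ hw

theorem zclosure_minimal' {β : Q.V → ℕ} {s t : Set (QRep Q β)} (h : s ⊆ zclosure t) :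
    zclosure s ⊆ zclosure t :=
  fun _ hw => mem_zclosure_iff.2 fun p hp =>
    mem_zclosure_iff.1 hw p fun _ hv => mem_zclosure_iff.1 (h hv) p hp

theorem zdim_eq_coordDim {β : Q.V → ℕ} (s : Set (QRep Q β)) :
    zdim s = coordDim (fun w : s => repCoords w.1) := by
  rw [zdim, zarTop, induced_compose]

instance {β : Q.V → ℕ} [Finite Q.A] : Finite (RepCoord (Q := Q) β) :=
  inferInstanceAs (Finite (Σ a : Q.A, Fin (β (Q.h a)) × Fin (β (Q.t a))))

/-- The action of a family of square matrices on representations (meaningful for invertible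
matrices). -/
def actM {α : Q.V → ℕ} (g : ∀ x, Matrix (Fin (α x)) (Fin (α x)) ℂ) (W : QRep Q α) : QRep Q α :=
  fun a => g (Q.h a) * W a * (g (Q.t a))⁻¹

theorem gAct_eq_actM {α : Q.V → ℕ} (g : GLb α) (W : QRep Q α) :
    gAct g W = actM (fun x => (g x).val) W := by
  funext a
  simp only [gAct, actM, Matrix.coe_units_inv]

theorem exists_gAct_eq_actM {α : Q.V → ℕ} {g : ∀ x, Matrix (Fin (α x)) (Fin (α x)) ℂ}
    (hg : ∀ x, (g x).det ≠ 0) : ∃ g' : GLb α, ∀ W : QRep Q α, gAct g' W = actM g W :=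
  ⟨fun x => Matrix.GeneralLinearGroup.mkOfDetNeZero (g x) (hg x), fun W => gAct_eq_actM _ W⟩

theorem actM_mul {α : Q.V → ℕ} (g e : ∀ x, Matrix (Fin (α x)) (Fin (α x)) ℂ) (W : QRep Q α) :
    actM (g * e) W = actM g (actM e W) := by
  funext a
  simp only [actM, Pi.mul_apply, Matrix.mul_inv_rev, Matrix.mul_assoc]

theorem actM_eq_of_mem {α : Q.V → ℕ} {V W : QRep Q α} {e : ∀ x, Matrix (Fin (α x)) (Fin (α x)) ℂ}
    (he : e ∈ HomS V W) (hd : ∀ x, (e x).det ≠ 0) : actM e V = W := by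
  funext a
  have h := he a
  simp only [actM]
  rw [h, Matrix.mul_assoc, Matrix.mul_nonsing_inv _ (isUnit_iff_ne_zero.2 (hd _)), Matrix.mul_one]

theorem d0map_eq_zero_iff {α γ : Q.V → ℕ} {V : QRep Q α} {W : QRep Q γ}
    {f : ∀ x : Q.V, Matrix (Fin (γ x)) (Fin (α x)) ℂ} : d0map V W f = 0 ↔ f ∈ HomS V W := by
  constructor
  · intro h a
    exact sub_eq_zero.1 (congrFun h a)
  · intro h
    funext a
    exact sub_eq_zero.2 (h a)

theorem ker_d0map {α γ : Q.V → ℕ} (V : QRep Q α) (W : QRep Q γ) :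
    LinearMap.ker (d0map V W) = HomS V W := by
  ext f
  exact d0map_eq_zero_iff

theorem dimHom_eq_finrank_ker {α γ : Q.V → ℕ} (V : QRep Q α) (W : QRep Q γ) :
    dimHom V W = Module.finrank ℂ (LinearMap.ker (d0map V W)) := by
  rw [ker_d0map, dimHom]

theorem linePolyV_d0map {E : Type} [AddCommGroup E] [Module ℂ E] [Finite Q.A] {α γ : Q.V → ℕ}
    {V : E → QRep Q α} {W : E → QRep Q γ}
    (hV : ∀ c, LinePoly (fun e => repCoords (V e) c)) (hW : ∀ c, LinePoly (fun e => repCoords (W e) c))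
    (f : ∀ x : Q.V, Matrix (Fin (γ x)) (Fin (α x)) ℂ) : LinePolyV (fun e => d0map (V e) (W e) f) := by
  refine LinePolyV.of_pi fun a => LinePolyV.of_matrix fun i j => ?_
  exact (LinePoly.matrix_mul (A := fun _ => f (Q.h a)) (B := fun e => V e a)
      (fun _ _ => LinePoly.const _) (fun k l => hV ⟨a, k, l⟩) i j).sub
    (LinePoly.matrix_mul (A := fun e => W e a) (B := fun _ => f (Q.t a))
      (fun k l => hW ⟨a, k, l⟩) (fun _ _ => LinePoly.const _) i j)

theorem exists_dimHom_le [Fintype Q.A] {E : Type} [AddCommGroup E] [Module ℂ E] {α γ : Q.V → ℕ}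
    {V : E → QRep Q α} {W : E → QRep Q γ}
    (hV : ∀ c, LinePoly (fun e => repCoords (V e) c)) (hW : ∀ c, LinePoly (fun e => repCoords (W e) c))
    (e0 : E) : ∃ D : E → ℂ, LinePoly D ∧ D e0 ≠ 0 ∧ ∀ e, D e ≠ 0 →
      dimHom (V e) (W e) ≤ dimHom (V e0) (W e0) := by
  simp only [dimHom_eq_finrank_ker]
  exact exists_generic_ker_le (fun e => d0map (V e) (W e)) (linePolyV_d0map hV hW) e0

theorem finrank_glS (α : Q.V → ℕ) :
    Module.finrank ℂ (∀ x : Q.V, Matrix (Fin (α x)) (Fin (α x)) ℂ) = ∑ x, α x ^ 2 := by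
  rw [Module.finrank_pi_fintype]
  refine Finset.sum_congr rfl fun x _ => ?_
  rw [Module.finrank_matrix]
  simp [pow_two]

/-- A family of representations which is polynomial in one parameter and contains only finitely
many members isomorphic to `M λ₀` satisfies `hom(M λ, M λ₀) < hom(M λ₀, M λ₀)` for almost all
`λ`. -/
theorem finite_dimHom_le [Fintype Q.A] {α : Q.V → ℕ} (M : ℂ → QRep Q α)
    (hM : ∀ c, LinePoly (fun z => repCoords (M z) c)) (z0 : ℂ)
    (hfin : {z | ∃ g : GLb α, gAct g (M z) = M z0}.Finite) :
    {z | dimHom (M z0) (M z0) ≤ dimHom (M z) (M z0)}.Finite := by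
  obtain ⟨f, hf, hfs⟩ := exists_linear_section (HomS (M z0) (M z0))
  obtain ⟨D, S, hD, hS, hD0, hS0, hinj, hsol⟩ := exists_generic_solution
    (fun z => (d0map (M z) (M z0)).prod f)
    (fun x => (linePolyV_d0map hM (fun _ => LinePoly.const _) x).prodMk (LinePolyV.const _)) z0
    (by
      rw [injective_iff_map_eq_zero]
      intro e he
      simp only [prodMap_eq_zero_iff, d0map_eq_zero_iff] at he
      exact hf e he.1 he.2)
    (fun _ => (0, f 1)) (LinePolyV.const _) 1
    (by
      simp only [prodMap_eq_iff, d0map_eq_zero_iff, and_true]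
      exact one_mem_homS _)
  have hdet : ∀ x, LinePoly (fun z => (S z x).det) := fun x =>
    LinePoly.det fun i j => hS ((Matrix.entryLinearMap ℂ ℂ i j) ∘ₗ LinearMap.proj x)
  have hP : LinePoly (fun z => D z * ∏ x, (S z x).det) :=
    hD.mul (LinePoly.prod _ fun x _ => hdet x)
  have hP0 : D z0 * ∏ x, (S z0 x).det ≠ 0 := by
    refine mul_ne_zero hD0 (Finset.prod_ne_zero_iff.2 fun x _ => ?_)
    rw [hS0]
    simp [hD0]
  refine (hfin.union (hP.finite_zeros hP0)).subset fun z hz => ?_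
  by_cases h : D z * ∏ x, (S z x).det = 0
  · exact Or.inr h
  left
  have hDz := left_ne_zero_of_mul h
  have hdz := Finset.prod_ne_zero_iff.1 (right_ne_zero_of_mul h)
  let u : HomS (M z) (M z0) →ₗ[ℂ] (Fin (Module.finrank ℂ (HomS (M z0) (M z0))) → ℂ) :=
    f ∘ₗ (HomS (M z) (M z0)).subtype
  have hu : Function.Injective u := by
    rw [injective_iff_map_eq_zero]
    intro e he
    have : (e : C0sp (Q := Q) α α) = 0 := by
      refine (injective_iff_map_eq_zero _).1 (hinj z hDz) _ ?_
      simp only [prodMap_eq_zero_iff, d0map_eq_zero_iff]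
      exact ⟨e.2, he⟩
    exact Subtype.ext this
  have hus : Function.Surjective u := by
    have h1 : Module.finrank ℂ (HomS (M z) (M z0)) =
        Module.finrank ℂ (Fin (Module.finrank ℂ (HomS (M z0) (M z0))) → ℂ) := by
      refine le_antisymm (LinearMap.finrank_le_finrank_of_injective hu) ?_
      simpa [dimHom] using hz
    exact (LinearMap.injective_iff_surjective_of_finrank_eq_finrank h1).1 hu
  obtain ⟨e, he⟩ := hus (f 1)
  have h2 : S z = D z • (e : C0sp (Q := Q) α α) := by
    refine hsol z _ ?_
    simp only [prodMap_eq_iff, d0map_eq_zero_iff]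
    exact ⟨e.2, he⟩
  have h3 : ∀ x, ((e : C0sp (Q := Q) α α) x).det ≠ 0 := by
    intro x
    have := hdz x (Finset.mem_univ x)
    rw [h2, Pi.smul_apply, Matrix.det_smul] at this
    exact right_ne_zero_of_mul this
  obtain ⟨g, hg⟩ := exists_gAct_eq_actM (Q := Q) h3
  exact ⟨g, by rw [hg, actM_eq_of_mem e.2 h3]⟩

/-- Parameter count: a polynomial family with `r` parameters whose members have endomorphism
algebras of dimension at least `m` sweeps out, under `GL(α)`, a set of dimension at most
`dim GL(α) + r - m`. -/
theorem zdim_le_of_family [Fintype Q.A] {α : Q.V → ℕ} {r m : ℕ} (M : (Fin r → ℂ) → QRep Q α)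
    (hM : ∀ c, PolyFn (fun z => repCoords (M z) c)) (hm : ∀ z, m ≤ dimHom (M z) (M z))
    (C : Set (QRep Q α)) (hC : C ⊆ zclosure {W | ∃ (g : GLb α) (z : Fin r → ℂ), gAct g (M z) = W}) :
    ∃ N : ℕ, zdim C ≤ N ∧ N + m ≤ ∑ x, α x ^ 2 + r := by
  obtain ⟨z0, hz0⟩ : ∃ z0, ∀ z, dimHom (M z0) (M z0) ≤ dimHom (M z) (M z) := by
    obtain ⟨-, ⟨z0, rfl⟩, h⟩ := WellFounded.has_min (wellFounded_lt (α := ℕ))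
      (Set.range fun z => dimHom (M z) (M z)) ⟨_, 0, rfl⟩
    exact ⟨z0, fun z => not_lt.1 (h _ ⟨z, rfl⟩)⟩
  obtain ⟨f, hf, hfs⟩ := exists_linear_section (HomS (M z0) (M z0))
  have hK : Module.finrank ℂ (LinearMap.ker f) + dimHom (M z0) (M z0) = ∑ x, α x ^ 2 := by
    rw [← finrank_glS, ← LinearMap.finrank_range_add_finrank_ker f, LinearMap.range_eq_top.2 hfs,
      finrank_top, Module.finrank_fin_fun, add_comm, dimHom]
  let K := LinearMap.ker f
  have hK : Module.finrank ℂ K + dimHom (M z0) (M z0) = ∑ x, α x ^ 2 := hK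
  let N := Module.finrank ℂ (K × (Fin r → ℂ))
  have hN : N = Module.finrank ℂ K + r := by
    simp [N, Module.finrank_prod]
  refine ⟨N, ?_, by have := hm z0; omega⟩
  let bas : (Fin N → ℂ) ≃ₗ[ℂ] K × (Fin r → ℂ) := (Module.finBasis ℂ (K × (Fin r → ℂ))).equivFun.symm
  let G : (Fin N → ℂ) → C0sp (Q := Q) α α := fun u => 1 + ((bas u).1 : C0sp (Q := Q) α α)
  let Mu : (Fin N → ℂ) → QRep Q α := fun u => M (bas u).2
  have hG : ∀ x i j, PolyFn (fun u => G u x i j) := fun x i j =>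
    (PolyFn.const ((1 : C0sp (Q := Q) α α) x i j)).add
      (PolyFn.linear ((Matrix.entryLinearMap ℂ ℂ i j) ∘ₗ
        (LinearMap.proj x : C0sp (Q := Q) α α →ₗ[ℂ] _) ∘ₗ K.subtype ∘ₗ
          LinearMap.fst ℂ K (Fin r → ℂ) ∘ₗ bas.toLinearMap))
  have hMu : ∀ c, PolyFn (fun u => repCoords (Mu u) c) := fun c =>
    (hM c).comp fun i => PolyFn.linear (LinearMap.proj i ∘ₗ LinearMap.snd ℂ K (Fin r → ℂ) ∘ₗ
      bas.toLinearMap)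
  have hden : PolyFn (fun u => ∏ x, (G u x).det) := PolyFn.prod _ fun x _ => PolyFn.det (hG x)
  have hnum : ∀ c : RepCoord (Q := Q) α, PolyFn (fun u => (∏ x ∈ Finset.univ.erase (Q.t c.1), (G u x).det) *
      (G u (Q.h c.1) * Mu u c.1 * (G u (Q.t c.1)).adjugate) c.2.1 c.2.2) := fun c =>
    (PolyFn.prod _ fun x _ => PolyFn.det (hG x)).mul
      (PolyFn.matrix_mul (PolyFn.matrix_mul (hG _) fun k l => hMu ⟨c.1, k, l⟩)
        (PolyFn.adjugate (hG _)) _ _)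
  obtain ⟨den, hden⟩ := hden
  choose num hnum using hnum
  have hden : ∀ u, (∏ x, (G u x).det) = eval u den := hden
  have hquot : ∀ u, eval u den ≠ 0 → ∀ c, eval u (num c) / eval u den = repCoords (actM (G u) (Mu u)) c := by
    intro u hu c
    rw [← hden] at hu ⊢
    rw [← hnum, div_eq_iff hu]
    beta_reduce
    have h1 : (∏ x, (G u x).det) = (∏ x ∈ Finset.univ.erase (Q.t c.1), (G u x).det) * (G u (Q.t c.1)).det :=
      (Finset.prod_erase_mul _ _ (Finset.mem_univ _)).symm
    rw [h1] at hu ⊢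
    have h2 := right_ne_zero_of_mul hu
    simp only [repCoords, actM, Matrix.inv_def, Ring.inverse_eq_inv', Matrix.mul_smul,
      Matrix.smul_apply, smul_eq_mul]
    field_simp
  rw [zdim_eq_coordDim]
  refine coordDim_le_of_rational _ num den ?_ ?_
  · rintro rfl
    have := hden (bas.symm (0, z0))
    simp [G] at this
  intro p hp x
  have hp' : ∀ u, (∀ x, (G u x).det ≠ 0) → eval (repCoords (actM (G u) (Mu u))) p = 0 := by
    intro u hu
    have h1 : eval u den ≠ 0 := by
      rw [← hden]
      exact Finset.prod_ne_zero_iff.2 fun x _ => hu x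
    rw [← hp u h1]
    congr 1
    exact congrArg _ (funext fun c => (hquot u h1 c).symm)
  refine mem_zclosure_iff.1 (hC x.2) p ?_
  rintro - ⟨g, z, rfl⟩
  let E := C0sp (Q := Q) α α × (Fin r → ℂ)
  have hM1 : ∀ c, LinePoly (fun e : E => repCoords (M e.2) c) := fun c =>
    (hM c).linePoly.comp_linear (LinearMap.snd ℂ (C0sp (Q := Q) α α) (Fin r → ℂ))
  have hgl : ∀ x i j, LinePoly (fun e : E => e.1 x i j) := fun x i j =>
    LinePoly.linear ((Matrix.entryLinearMap ℂ ℂ i j) ∘ₗ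
      (LinearMap.proj x : C0sp (Q := Q) α α →ₗ[ℂ] _) ∘ₗ
        LinearMap.fst ℂ (C0sp (Q := Q) α α) (Fin r → ℂ))
  obtain ⟨D, S, hD, hS, hD0, hS0, hinj, hsol⟩ := exists_generic_solution
    (fun e : E => (d0map (M e.2) (M e.2)).prod (f ∘ₗ LinearMap.mulLeft ℂ e.1))
    (fun x => (linePolyV_d0map hM1 hM1 x).prodMk
      (LinePolyV.linear (f ∘ₗ LinearMap.mulRight ℂ x ∘ₗ LinearMap.fst ℂ _ (Fin r → ℂ)))) (1, z0)
    (by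
      rw [injective_iff_map_eq_zero]
      intro e he
      simp only [prodMap_eq_zero_iff, d0map_eq_zero_iff] at he
      exact hf e he.1 (by simpa using he.2))
    (fun _ => (0, f 1)) (LinePolyV.const _) 1
    (by
      simp only [prodMap_eq_iff, d0map_eq_zero_iff]
      exact ⟨one_mem_homS _, by simp⟩)
  let Dg : E → ℂ := fun e => ∏ x, (e.1 x).det
  have hDg : LinePoly Dg := LinePoly.prod _ fun x _ => LinePoly.det (hgl x)
  have hdet : ∀ x, LinePoly (fun e => (S e x).det) := fun x =>
    LinePoly.det fun i j => hS ((Matrix.entryLinearMap ℂ ℂ i j) ∘ₗ LinearMap.proj x)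
  have hP : LinePoly (fun e => D e * ∏ x, (S e x).det) :=
    hD.mul (LinePoly.prod _ fun x _ => hdet x)
  have hinvrat : ∀ x i j, LineRat Dg (fun e : E => (e.1 x)⁻¹ i j) := fun x i j =>
    LineRat.matrix_inv (G := fun e : E => ∏ y ∈ Finset.univ.erase x, (e.1 y).det) (hgl x)
      (LinePoly.prod _ fun y _ => LinePoly.det (hgl y))
      (fun e => (Finset.prod_erase_mul _ _ (Finset.mem_univ _)).symm) i j
  have hrat : LineRat Dg (fun e : E => eval (repCoords (actM e.1 (M e.2))) p) := by
    refine LineRat.eval_mvPolynomial hDg (f := fun c (e : E) => repCoords (actM e.1 (M e.2)) c)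
      (fun c => ?_) p
    exact LineRat.matrix_mul hDg (fun i j => LineRat.of_linePoly
      (LinePoly.matrix_mul (A := fun e : E => e.1 (Q.h c.1)) (B := fun e => M e.2 c.1) (hgl _)
        (fun k l => hM1 ⟨c.1, k, l⟩) i j)) (hinvrat _) _ _
  rw [gAct_eq_actM]
  refine LineRat.eq_zero hDg hrat hP (a := (1, z0)) (by simp [Dg]) ?_ ?_ (fun x => (g x).val, z) ?_
  · refine mul_ne_zero hD0 (Finset.prod_ne_zero_iff.2 fun x _ => ?_)
    rw [hS0]
    simp [hD0]
  · rintro ⟨g, z⟩ hg hz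
    have hDz := left_ne_zero_of_mul hz
    have hSz := Finset.prod_ne_zero_iff.1 (right_ne_zero_of_mul hz)
    have hg' := Finset.prod_ne_zero_iff.1 hg
    let u : HomS (M z) (M z) →ₗ[ℂ] (Fin (Module.finrank ℂ (HomS (M z0) (M z0))) → ℂ) :=
      f ∘ₗ LinearMap.mulLeft ℂ g ∘ₗ (HomS (M z) (M z)).subtype
    have hu : Function.Injective u := by
      rw [injective_iff_map_eq_zero]
      intro e he
      have : (e : C0sp (Q := Q) α α) = 0 := by
        refine (injective_iff_map_eq_zero _).1 (hinj (g, z) hDz) _ ?_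
        simp only [prodMap_eq_zero_iff, d0map_eq_zero_iff]
        exact ⟨e.2, he⟩
      exact Subtype.ext this
    have hus : Function.Surjective u := by
      have h1 : Module.finrank ℂ (HomS (M z) (M z)) =
          Module.finrank ℂ (Fin (Module.finrank ℂ (HomS (M z0) (M z0))) → ℂ) := by
        refine le_antisymm (LinearMap.finrank_le_finrank_of_injective hu) ?_
        simpa [dimHom] using hz0 z
      exact (LinearMap.injective_iff_surjective_of_finrank_eq_finrank h1).1 hu
    obtain ⟨e, he⟩ := hus (f 1)
    have h2 : S (g, z) = D (g, z) • (e : C0sp (Q := Q) α α) := by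
      refine hsol (g, z) _ ?_
      simp only [prodMap_eq_iff, d0map_eq_zero_iff]
      exact ⟨e.2, he⟩
    have h3 : ∀ x, ((e : C0sp (Q := Q) α α) x).det ≠ 0 := by
      intro x
      have := hSz x (Finset.mem_univ x)
      rw [h2, Pi.smul_apply, Matrix.det_smul] at this
      exact right_ne_zero_of_mul this
    have h4 : g * (e : C0sp (Q := Q) α α) - 1 ∈ K := by
      rw [LinearMap.mem_ker, map_sub, sub_eq_zero]
      exact he
    have h5 : G (bas.symm (⟨_, h4⟩, z)) = g * (e : C0sp (Q := Q) α α) := by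
      simp [G]
    have h6 : Mu (bas.symm (⟨_, h4⟩, z)) = M z := by
      simp [Mu]
    have h7 := hp' (bas.symm (⟨_, h4⟩, z)) (by
      intro x
      rw [h5, Pi.mul_apply, Matrix.det_mul]
      exact mul_ne_zero (hg' x (Finset.mem_univ x)) (h3 x))
    rw [h5, h6, actM_mul, actM_eq_of_mem e.2 h3] at h7
    exact h7
  · refine Finset.prod_ne_zero_iff.2 fun x _ => ?_
    exact ((Matrix.isUnit_iff_isUnit_det _).1 (g x).isUnit).ne_zero

end Families

section ModuleLayer

/-- The free algebra on the vertices and arrows of `Q`; modules over it that satisfy `Good` are the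
modules over the bound quiver algebra. -/
abbrev Aq (Q : Quiv) := FreeAlgebra ℂ (Q.V ⊕ Q.A)

/-- The generator attached to a vertex. -/
def vtx (x : Q.V) : Aq Q := FreeAlgebra.ι ℂ (Sum.inl x)

/-- The generator attached to an arrow. -/
def arr (a : Q.A) : Aq Q := FreeAlgebra.ι ℂ (Sum.inr a)

/-- The element attached to a path. -/
def pathElt {x : Q.V} : ∀ {y : Q.V}, Quiver.Path x y → Aq Q
  | _, Quiver.Path.nil => vtx x
  | _, Quiver.Path.cons p e => arr e.1 * pathElt p

/-- The element attached to a formal combination of paths. -/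
def relElt {x y : Q.V} (c : Quiver.Path x y →₀ ℂ) : Aq Q := c.sum fun p k => k • pathElt p

/-- The elements annihilating all modules over the bound quiver algebra. -/
def relJ (R : Set (FormalRel Q)) : Set (Aq Q) :=
  {z | (∃ x : Q.V, z = vtx x * vtx x - vtx x) ∨ (∃ x y : Q.V, x ≠ y ∧ z = vtx x * vtx y) ∨
    (z = ∑ x : Q.V, vtx x - 1) ∨ (∃ a : Q.A, z = vtx (Q.h a) * arr a - arr a) ∨
    (∃ a : Q.A, z = arr a * vtx (Q.t a) - arr a) ∨ ∃ r ∈ R, z = relElt r.2.2}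

/-- A linear map commuting with the generators is linear over the free algebra. -/
def mkAq {M N : Type} [AddCommGroup M] [Module ℂ M] [Module (Aq Q) M] [IsScalarTower ℂ (Aq Q) M]
    [AddCommGroup N] [Module ℂ N] [Module (Aq Q) N] [IsScalarTower ℂ (Aq Q) N] (f : M →ₗ[ℂ] N)
    (hv : ∀ (x : Q.V) m, f ((vtx x : Aq Q) • m) = (vtx x : Aq Q) • f m)
    (ha : ∀ (a : Q.A) m, f ((arr a : Aq Q) • m) = (arr a : Aq Q) • f m) : M →ₗ[Aq Q] N where
  toFun := f
  map_add' := map_add f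
  map_smul' := by
    intro z
    induction z using FreeAlgebra.induction with
    | grade0 r =>
      intro m
      simp only [algebraMap_smul, map_smul, RingHom.id_apply]
    | grade1 x =>
      rcases x with x | a
      · exact hv x
      · exact ha a
    | mul z w hz hw =>
      intro m
      simp only [mul_smul, RingHom.id_apply] at hz hw ⊢
      rw [hz, hw]
    | add z w hz hw =>
      intro m
      simp only [add_smul, map_add, RingHom.id_apply] at hz hw ⊢
      rw [hz, hw]

@[simp]
theorem mkAq_apply {M N : Type} [AddCommGroup M] [Module ℂ M] [Module (Aq Q) M]
    [IsScalarTower ℂ (Aq Q) M]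
    [AddCommGroup N] [Module ℂ N] [Module (Aq Q) N] [IsScalarTower ℂ (Aq Q) N] (f : M →ₗ[ℂ] N)
    (hv : ∀ (x : Q.V) m, f ((vtx x : Aq Q) • m) = (vtx x : Aq Q) • f m)
    (ha : ∀ (a : Q.A) m, f ((arr a : Aq Q) • m) = (arr a : Aq Q) • f m) (m : M) :
    mkAq f hv ha m = f m := rfl

/-- The module attached to a representation. -/
def RMod {α : Q.V → ℕ} (_ : QRep Q α) : Type := ∀ x : Q.V, Fin (α x) → ℂ

variable {α γ : Q.V → ℕ}

instance (V : QRep Q α) : AddCommGroup (RMod V) :=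
  inferInstanceAs (AddCommGroup (∀ x : Q.V, Fin (α x) → ℂ))

instance (V : QRep Q α) : Module ℂ (RMod V) :=
  inferInstanceAs (Module ℂ (∀ x : Q.V, Fin (α x) → ℂ))

instance (V : QRep Q α) : FiniteDimensional ℂ (RMod V) :=
  inferInstanceAs (FiniteDimensional ℂ (∀ x : Q.V, Fin (α x) → ℂ))

/-- The projection to the space at a vertex. -/
def rproj (V : QRep Q α) (x : Q.V) : RMod V →ₗ[ℂ] (Fin (α x) → ℂ) where
  toFun v := v x
  map_add' _ _ := rfl
  map_smul' _ _ := rfl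

/-- The inclusion of the space at a vertex. -/
def rsingle (V : QRep Q α) (x : Q.V) : (Fin (α x) → ℂ) →ₗ[ℂ] RMod V :=
  LinearMap.single ℂ (fun x : Q.V => Fin (α x) → ℂ) x

@[simp]
theorem rproj_rsingle_same (V : QRep Q α) (x : Q.V) (v) : rproj V x (rsingle V x v) = v :=
  Pi.single_eq_same (M := fun x : Q.V => Fin (α x) → ℂ) x v

theorem rproj_rsingle_ne (V : QRep Q α) {x y : Q.V} (h : y ≠ x) (v) :
    rproj V y (rsingle V x v) = 0 :=
  Pi.single_eq_of_ne (M := fun x : Q.V => Fin (α x) → ℂ) h v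

theorem sum_rsingle (V : QRep Q α) (v : RMod V) : ∑ x, rsingle V x (rproj V x v) = v :=
  Finset.univ_sum_single (M := fun x : Q.V => Fin (α x) → ℂ) v

theorem rmod_ext (V : QRep Q α) {v w : RMod V} (h : ∀ x, rproj V x v = rproj V x w) : v = w :=
  funext h

/-- The action of the free algebra on the module attached to a representation. -/
def repAct (V : QRep Q α) : Aq Q →ₐ[ℂ] Module.End ℂ (RMod V) :=
  FreeAlgebra.lift ℂ (Sum.elim (fun x => rsingle V x ∘ₗ rproj V x)
    (fun a => rsingle V (Q.h a) ∘ₗ (V a).mulVecLin ∘ₗ rproj V (Q.t a)))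

instance (V : QRep Q α) : Module (Aq Q) (RMod V) := Module.compHom _ (repAct V).toRingHom

theorem aq_smul_def (V : QRep Q α) (z : Aq Q) (v : RMod V) : z • v = repAct V z v := rfl

instance (V : QRep Q α) : IsScalarTower ℂ (Aq Q) (RMod V) :=
  ⟨fun c z v => by simp only [aq_smul_def, map_smul, LinearMap.smul_apply]⟩

theorem vtx_smul (V : QRep Q α) (x : Q.V) (v : RMod V) :
    (vtx x : Aq Q) • v = rsingle V x (rproj V x v) := by
  rw [aq_smul_def, repAct, vtx, FreeAlgebra.lift_ι_apply]
  rfl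

theorem arr_smul (V : QRep Q α) (a : Q.A) (v : RMod V) :
    (arr a : Aq Q) • v = rsingle V (Q.h a) (V a *ᵥ rproj V (Q.t a) v) := by
  rw [aq_smul_def, repAct, arr, FreeAlgebra.lift_ι_apply]
  rfl

theorem castM_mulVec {V : QRep Q α} (a : Q.A) {x y : Q.V} (hx : Q.t a = x) (hy : Q.h a = y)
    (v : RMod V) : rsingle V y (castM (congrArg α hy) (congrArg α hx) (V a) *ᵥ rproj V x v) =
      rsingle V (Q.h a) (V a *ᵥ rproj V (Q.t a) v) := by
  subst hx hy
  rfl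

theorem pathElt_smul (V : QRep Q α) {x y : Q.V} (p : Quiver.Path x y) (v : RMod V) :
    (pathElt p : Aq Q) • v = rsingle V y (evalPath V p *ᵥ rproj V x v) := by
  induction p with
  | nil => rw [pathElt, evalPath, Matrix.one_mulVec, vtx_smul]
  | cons p e ih =>
    rw [pathElt, evalPath, mul_smul, ih, arr_smul, ← castM_mulVec e.1 e.2.1 e.2.2,
      rproj_rsingle_same, Matrix.mulVec_mulVec]

theorem relElt_smul (V : QRep Q α) {x y : Q.V} (c : Quiver.Path x y →₀ ℂ) (v : RMod V) :
    (relElt c : Aq Q) • v = rsingle V y (evalLin V c *ᵥ rproj V x v) := by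
  simp only [relElt, evalLin, Finsupp.sum, Finset.sum_smul, Matrix.sum_mulVec, map_sum,
    smul_assoc, pathElt_smul, Matrix.smul_mulVec, map_smul]

end ModuleLayer

section Good

set_option linter.unusedSectionVars false

/-- `M` is a finite dimensional module over the bound quiver algebra with relations `R`. -/
class Good (R : Set (FormalRel Q)) (M : Type) [AddCommGroup M] [Module ℂ M] [Module (Aq Q) M] :
    Prop where
  finDim : FiniteDimensional ℂ M
  ann : ∀ z ∈ relJ R, ∀ m : M, z • m = 0

theorem Good.fin (R : Set (FormalRel Q)) (M : Type) [AddCommGroup M] [Module ℂ M] [Module (Aq Q) M]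
    [h : Good R M] : FiniteDimensional ℂ M := h.finDim

variable {R : Set (FormalRel Q)}
variable {M N P : Type} [AddCommGroup M] [Module ℂ M] [Module (Aq Q) M] [IsScalarTower ℂ (Aq Q) M]
  [AddCommGroup N] [Module ℂ N] [Module (Aq Q) N] [IsScalarTower ℂ (Aq Q) N]
  [AddCommGroup P] [Module ℂ P] [Module (Aq Q) P] [IsScalarTower ℂ (Aq Q) P]

theorem Good.of_injective [Good R N] (f : M →ₗ[Aq Q] N) (hf : Function.Injective f) : Good R M := by
  have := Good.fin R N
  exact ⟨Module.Finite.of_injective (f.restrictScalars ℂ) hf,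
    fun z hz m => hf (by rw [map_smul, Good.ann z hz, map_zero])⟩

theorem Good.of_surjective [Good R M] (f : M →ₗ[Aq Q] N) (hf : Function.Surjective f) : Good R N := by
  have := Good.fin R M
  refine ⟨Module.Finite.of_surjective (f.restrictScalars ℂ) hf, fun z hz m => ?_⟩
  obtain ⟨m, rfl⟩ := hf m
  rw [← map_smul, Good.ann z hz, map_zero]

instance [Good R M] (K : Submodule (Aq Q) M) : Good R K := Good.of_injective K.subtype K.injective_subtype

instance [Good R M] (K : Submodule (Aq Q) M) : Good R (M ⧸ K) :=
  Good.of_surjective K.mkQ K.mkQ_surjective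

instance {ι : Type} [Finite ι] {M : ι → Type} [∀ i, AddCommGroup (M i)] [∀ i, Module ℂ (M i)]
    [∀ i, Module (Aq Q) (M i)] [∀ i, Good R (M i)] : Good R (∀ i, M i) := by
  have := fun i => Good.fin R (M i)
  exact ⟨inferInstance, fun z hz m => funext fun i => Good.ann z hz (m i)⟩

theorem good_rmod {α : Q.V → ℕ} {V : QRep Q α} (hV : V ∈ modSet R α) : Good R (RMod V) := by
  refine ⟨inferInstance, ?_⟩
  rintro z (⟨x, rfl⟩ | ⟨x, y, hxy, rfl⟩ | rfl | ⟨a, rfl⟩ | ⟨a, rfl⟩ | ⟨r, hr, rfl⟩) m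
  · simp [sub_smul, mul_smul, vtx_smul]
  · simp [mul_smul, vtx_smul, rproj_rsingle_ne _ hxy]
  · simp [sub_smul, Finset.sum_smul, vtx_smul, sum_rsingle]
  · simp [sub_smul, mul_smul, vtx_smul, arr_smul]
  · simp [sub_smul, mul_smul, vtx_smul, arr_smul]
  · rw [relElt_smul, hV r hr, Matrix.zero_mulVec, map_zero]

theorem mem_modSet_of_good {α : Q.V → ℕ} {V : QRep Q α} [Good R (RMod V)] : V ∈ modSet R α := by
  intro r hr
  refine Matrix.ext_of_mulVec_single fun i => ?_
  have h := Good.ann (M := RMod V) (relElt r.2.2) (Or.inr (Or.inr (Or.inr (Or.inr (Or.inr ⟨r, hr, rfl⟩)))))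
    (rsingle V r.1 (Pi.single i 1))
  rw [relElt_smul, rproj_rsingle_same] at h
  have h2 := congrArg (rproj V r.2.1) h
  rw [rproj_rsingle_same, map_zero] at h2
  rw [h2, Matrix.zero_mulVec]

/-- The dimension vector of a module. -/
def dimV (M : Type) [AddCommGroup M] [Module ℂ M] [Module (Aq Q) M] [IsScalarTower ℂ (Aq Q) M]
    (x : Q.V) : ℕ := Module.finrank ℂ (LinearMap.range (Algebra.lsmul ℂ ℂ M (vtx x : Aq Q)))

/-- The space at a vertex of a module. -/
abbrev vsp (M : Type) [AddCommGroup M] [Module ℂ M] [Module (Aq Q) M] [IsScalarTower ℂ (Aq Q) M]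
    (x : Q.V) : Submodule ℂ M := LinearMap.range (Algebra.lsmul ℂ ℂ M (vtx x : Aq Q))

variable (R) in
theorem Good.vtx_vtx [Good R M] (x : Q.V) (m : M) : (vtx x : Aq Q) • (vtx x : Aq Q) • m = (vtx x : Aq Q) • m := by
  have := Good.ann (R := R) (vtx x * vtx x - vtx x : Aq Q) (Or.inl ⟨x, rfl⟩) m
  rwa [sub_smul, mul_smul, sub_eq_zero] at this

variable (R) in
theorem Good.vtx_vtx_ne [Good R M] {x y : Q.V} (h : x ≠ y) (m : M) :
    (vtx x : Aq Q) • (vtx y : Aq Q) • m = 0 := by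
  have := Good.ann (R := R) (vtx x * vtx y : Aq Q) (Or.inr (Or.inl ⟨x, y, h, rfl⟩)) m
  rwa [mul_smul] at this

variable (R) in
theorem Good.sum_vtx [Good R M] (m : M) : ∑ x : Q.V, (vtx x : Aq Q) • m = m := by
  have := Good.ann (R := R) (∑ x, vtx x - 1 : Aq Q) (Or.inr (Or.inr (Or.inl rfl))) m
  rwa [sub_smul, Finset.sum_smul, one_smul, sub_eq_zero] at this

variable (R) in
theorem Good.vtx_arr [Good R M] (a : Q.A) (m : M) :
    (vtx (Q.h a) : Aq Q) • (arr a : Aq Q) • m = (arr a : Aq Q) • m := by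
  have := Good.ann (R := R) (vtx (Q.h a) * arr a - arr a : Aq Q) (Or.inr (Or.inr (Or.inr (Or.inl ⟨a, rfl⟩)))) m
  rwa [sub_smul, mul_smul, sub_eq_zero] at this

variable (R) in
theorem Good.arr_vtx [Good R M] (a : Q.A) (m : M) :
    (arr a : Aq Q) • (vtx (Q.t a) : Aq Q) • m = (arr a : Aq Q) • m := by
  have := Good.ann (R := R) (arr a * vtx (Q.t a) - arr a : Aq Q)
    (Or.inr (Or.inr (Or.inr (Or.inr (Or.inl ⟨a, rfl⟩))))) m
  rwa [sub_smul, mul_smul, sub_eq_zero] at this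

variable (R) in
theorem Good.mem_vsp_iff [Good R M] {x : Q.V} {m : M} : m ∈ vsp M x ↔ (vtx x : Aq Q) • m = m := by
  constructor
  · rintro ⟨n, rfl⟩
    exact Good.vtx_vtx R x n
  · intro h
    exact ⟨m, h⟩

variable (R M) in
/-- Every module is isomorphic to one given by matrices. -/
theorem Good.exists_rep [Good R M] : ∃ V : QRep Q (dimV M), V ∈ modSet R (dimV M) ∧
    Nonempty (RMod V ≃ₗ[Aq Q] M) := by
  have := Good.fin R M
  let b : ∀ x : Q.V, vsp M x ≃ₗ[ℂ] (Fin (dimV M x) → ℂ) := fun x => (Module.finBasis ℂ (vsp M x)).equivFun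
  let A : ∀ a : Q.A, vsp M (Q.t a) →ₗ[ℂ] vsp M (Q.h a) := fun a =>
    LinearMap.codRestrict _ ((Algebra.lsmul ℂ ℂ M (arr a : Aq Q)) ∘ₗ (vsp M (Q.t a)).subtype)
      fun m => ⟨arr a • m.1, Good.vtx_arr R a m.1⟩
  let V : QRep Q (dimV M) := fun a =>
    LinearMap.toMatrix' ((b (Q.h a)).toLinearMap ∘ₗ A a ∘ₗ (b (Q.t a)).symm.toLinearMap)
  have hV : ∀ a v, V a *ᵥ v = b (Q.h a) (A a ((b (Q.t a)).symm v)) := by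
    intro a v
    rw [← Matrix.toLin'_apply]
    simp [V]
  let F : RMod V →ₗ[ℂ] M := ∑ x, (vsp M x).subtype ∘ₗ (b x).symm.toLinearMap ∘ₗ rproj V x
  have hF : ∀ v, F v = ∑ x, ((b x).symm (rproj V x v)).1 := by
    intro v
    simp [F]
  have hFs : ∀ x v, F (rsingle V x v) = ((b x).symm v).1 := by
    intro x v
    rw [hF, Finset.sum_eq_single x]
    · simp
    · intro y _ hy
      rw [rproj_rsingle_ne V hy]
      simp
    · simp
  have hvF : ∀ x v, (vtx x : Aq Q) • F v = ((b x).symm (rproj V x v)).1 := by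
    intro x v
    rw [hF, Finset.smul_sum, Finset.sum_eq_single x]
    · exact (Good.mem_vsp_iff R).1 ((b x).symm (rproj V x v)).2
    · intro y _ hy
      rw [← (Good.mem_vsp_iff R).1 ((b y).symm (rproj V y v)).2, Good.vtx_vtx_ne R hy.symm]
    · simp
  let F' : RMod V →ₗ[Aq Q] M := mkAq F
    (by
      intro x v
      rw [vtx_smul, hFs, hvF])
    (by
      intro a v
      rw [arr_smul, hFs, hV, LinearEquiv.symm_apply_apply, ← Good.arr_vtx R a (F v), hvF]
      rfl)
  have hinj : Function.Injective F' := by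
    rw [injective_iff_map_eq_zero]
    intro v hv
    refine rmod_ext V fun x => ?_
    have h := hvF x v
    rw [show F v = 0 from hv, smul_zero] at h
    have h2 : (b x).symm (rproj V x v) = 0 := Subtype.ext h.symm
    rw [map_zero]
    exact (LinearEquiv.map_eq_zero_iff _).1 h2
  have hsurj : Function.Surjective F' := by
    intro m
    refine ⟨∑ x, rsingle V x (b x ⟨vtx x • m, ⟨m, rfl⟩⟩), ?_⟩
    rw [map_sum]
    simp only [F', mkAq_apply, hFs, LinearEquiv.symm_apply_apply]
    exact Good.sum_vtx R m
  let e := LinearEquiv.ofBijective F' ⟨hinj, hsurj⟩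
  have : Good R (RMod V) := Good.of_injective F' hinj
  exact ⟨V, mem_modSet_of_good, ⟨e⟩⟩

theorem dimV_eq_of_equiv (e : M ≃ₗ[Aq Q] N) : dimV (Q := Q) M = dimV N := by
  funext x
  refine LinearEquiv.finrank_eq ((e.restrictScalars ℂ).submoduleMap _ ≪≫ₗ LinearEquiv.ofEq _ _ ?_)
  ext n
  simp only [Submodule.mem_map, LinearMap.mem_range]
  constructor
  · rintro ⟨-, ⟨m, rfl⟩, rfl⟩
    exact ⟨e m, (map_smul e _ m).symm⟩
  · rintro ⟨m, rfl⟩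
    exact ⟨_, ⟨e.symm m, rfl⟩, by simp [← map_smul]⟩

theorem dimV_rmod {α : Q.V → ℕ} (V : QRep Q α) : dimV (RMod V) = α := by
  funext x
  have h : vsp (RMod V) x = LinearMap.range (rsingle V x) := by
    ext v
    simp only [LinearMap.mem_range, Algebra.lsmul_coe, vtx_smul]
    constructor
    · rintro ⟨w, rfl⟩
      exact ⟨_, rfl⟩
    · rintro ⟨w, rfl⟩
      exact ⟨rsingle V x w, by simp⟩
  have hinj : Function.Injective (rsingle V x) := fun v w hvw => by
    simpa using congrArg (rproj V x) hvw
  have h2 := LinearMap.finrank_range_of_inj hinj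
  rw [dimV]
  change Module.finrank ℂ (vsp (RMod V) x) = _
  rw [h, h2, Module.finrank_fin_fun]

end Good

section HomTranslation

variable {α γ δ : Q.V → ℕ} {V : QRep Q α} {W : QRep Q γ} {U : QRep Q δ}

/-- The element of the module attached to a representation with given components. -/
def rmk (V : QRep Q α) (v : ∀ x, Fin (α x) → ℂ) : RMod V := v

@[simp] theorem rproj_rmk (v : ∀ x, Fin (α x) → ℂ) (x : Q.V) : rproj V x (rmk V v) = v x := rfl

/-- The linear map attached to a family of matrices. -/
def rmodMap (V : QRep Q α) (W : QRep Q γ) (φ : C0sp (Q := Q) α γ) : RMod V →ₗ[ℂ] RMod W where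
  toFun v := rmk W fun x => φ x *ᵥ rproj V x v
  map_add' v w := rmod_ext W fun x => by
    rw [map_add, rproj_rmk, map_add, Matrix.mulVec_add]
    rfl
  map_smul' c v := rmod_ext W fun x => by
    rw [map_smul, rproj_rmk, map_smul, Matrix.mulVec_smul]
    rfl

@[simp]
theorem rproj_rmodMap (φ : C0sp (Q := Q) α γ) (v : RMod V) (x : Q.V) :
    rproj W x (rmodMap V W φ v) = φ x *ᵥ rproj V x v := rfl

/-- The module homomorphism attached to a morphism of representations. -/
def toHom (φ : HomS V W) : RMod V →ₗ[Aq Q] RMod W :=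
  mkAq (rmodMap V W φ.1)
    (by
      intro x v
      refine rmod_ext W fun y => ?_
      rw [vtx_smul, vtx_smul, rproj_rmodMap]
      by_cases hy : y = x
      · subst hy
        simp only [rproj_rsingle_same, rproj_rmodMap]
      · simp only [rproj_rsingle_ne _ hy, Matrix.mulVec_zero])
    (by
      intro a v
      refine rmod_ext W fun y => ?_
      rw [arr_smul, arr_smul, rproj_rmodMap]
      by_cases hy : y = Q.h a
      · subst hy
        simp only [rproj_rsingle_same, rproj_rmodMap]
        rw [Matrix.mulVec_mulVec, φ.2 a, ← Matrix.mulVec_mulVec]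
      · simp only [rproj_rsingle_ne _ hy, Matrix.mulVec_zero])

@[simp]
theorem rproj_toHom (φ : HomS V W) (v : RMod V) (x : Q.V) :
    rproj W x (toHom φ v) = φ.1 x *ᵥ rproj V x v := rfl

theorem hom_rsingle (F : RMod V →ₗ[Aq Q] RMod W) (x : Q.V) (v) :
    F (rsingle V x v) = rsingle W x (rproj W x (F (rsingle V x v))) := by
  rw [← vtx_smul, ← map_smul, vtx_smul, rproj_rsingle_same]

/-- The morphism of representations attached to a module homomorphism. -/
def ofHom (F : RMod V →ₗ[Aq Q] RMod W) : HomS V W :=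
  ⟨fun x => LinearMap.toMatrix' (rproj W x ∘ₗ F.restrictScalars ℂ ∘ₗ rsingle V x), by
    intro a
    refine Matrix.ext_of_mulVec_single fun i => ?_
    rw [← Matrix.mulVec_mulVec, ← Matrix.mulVec_mulVec]
    simp only [← Matrix.toLin'_apply, Matrix.toLin'_toMatrix', LinearMap.comp_apply,
      LinearMap.restrictScalars_apply]
    simp only [Matrix.toLin'_apply]
    have h := map_smul F (arr a) (rsingle V (Q.t a) (Pi.single i 1))
    rw [arr_smul, arr_smul, rproj_rsingle_same] at h
    rw [h, rproj_rsingle_same]⟩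

theorem ofHom_mulVec (F : RMod V →ₗ[Aq Q] RMod W) (x : Q.V) (v) :
    (ofHom F).1 x *ᵥ v = rproj W x (F (rsingle V x v)) := by
  simp only [ofHom]
  rw [← Matrix.toLin'_apply, Matrix.toLin'_toMatrix']
  rfl

theorem toHom_ofHom (F : RMod V →ₗ[Aq Q] RMod W) : toHom (ofHom F) = F := by
  refine LinearMap.ext fun v => rmod_ext W fun x => ?_
  rw [rproj_toHom, ofHom_mulVec]
  have h := congrArg (rproj W x) (map_smul F (vtx x) v)
  rwa [vtx_smul, vtx_smul, rproj_rsingle_same] at h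

theorem ofHom_toHom (φ : HomS V W) : ofHom (toHom φ) = φ := by
  refine Subtype.ext (funext fun x => Matrix.ext_of_mulVec_single fun i => ?_)
  rw [ofHom_mulVec, rproj_toHom, rproj_rsingle_same]

variable (V W) in
/-- Morphisms of representations are the homomorphisms of the attached modules. -/
def homEquiv : HomS V W ≃ₗ[ℂ] (RMod V →ₗ[Aq Q] RMod W) where
  toFun := toHom
  invFun := ofHom
  left_inv := ofHom_toHom
  right_inv := toHom_ofHom
  map_add' φ ψ := LinearMap.ext fun v => rmod_ext W fun x => by
    rw [LinearMap.add_apply, map_add]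
    simp only [rproj_toHom]
    exact Matrix.add_mulVec _ _ _
  map_smul' c φ := LinearMap.ext fun v => rmod_ext W fun x => by
    rw [LinearMap.smul_apply, map_smul]
    simp only [rproj_toHom]
    exact Matrix.smul_mulVec c (φ.1 x) (rproj V x v)

theorem toHom_comp (φ : HomS V W) (ψ : HomS W U) (χ : HomS V U) (h : ∀ x, ψ.1 x * φ.1 x = χ.1 x) :
    toHom ψ ∘ₗ toHom φ = toHom χ := by
  refine LinearMap.ext fun v => rmod_ext U fun x => ?_
  simp only [LinearMap.comp_apply, rproj_toHom, Matrix.mulVec_mulVec, h]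

theorem ofHom_comp (F : RMod V →ₗ[Aq Q] RMod W) (G : RMod W →ₗ[Aq Q] RMod U) (x : Q.V) :
    (ofHom (G ∘ₗ F)).1 x = (ofHom G).1 x * (ofHom F).1 x := by
  refine Matrix.ext_of_mulVec_single fun i => ?_
  rw [← Matrix.mulVec_mulVec, ofHom_mulVec, ofHom_mulVec, ofHom_mulVec, ← hom_rsingle]
  rfl

theorem injective_toHom_iff (φ : HomS V W) : Function.Injective (toHom φ) ↔ MorInj φ.1 := by
  constructor
  · intro h x v w hvw
    rw [Matrix.mulVecLin_apply, Matrix.mulVecLin_apply] at hvw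
    have : rsingle V x v = rsingle V x w := by
      apply h
      rw [hom_rsingle, hom_rsingle _ _ w, rproj_toHom, rproj_toHom, rproj_rsingle_same,
        rproj_rsingle_same, hvw]
    simpa using congrArg (rproj V x) this
  · intro h v w hvw
    refine rmod_ext V fun x => h x ?_
    rw [Matrix.mulVecLin_apply, Matrix.mulVecLin_apply]
    rw [← rproj_toHom, hvw, rproj_toHom]

theorem surjective_toHom_iff (φ : HomS V W) : Function.Surjective (toHom φ) ↔ MorSurj φ.1 := by
  constructor
  · intro h x v
    obtain ⟨w, hw⟩ := h (rsingle W x v)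
    refine ⟨rproj V x w, ?_⟩
    rw [Matrix.mulVecLin_apply, ← rproj_toHom, hw, rproj_rsingle_same]
  · intro h v
    choose w hw using fun x => h x (rproj W x v)
    refine ⟨rmk V w, rmod_ext W fun x => ?_⟩
    rw [rproj_toHom, ← hw]
    rfl

theorem exact_toHom_iff (φ : HomS V W) (ψ : HomS W U) :
    Function.Exact (toHom φ) (toHom ψ) ↔
      ∀ x, LinearMap.range (φ.1 x).mulVecLin = LinearMap.ker (ψ.1 x).mulVecLin := by
  constructor
  · intro h x
    ext v
    simp only [LinearMap.mem_range, LinearMap.mem_ker, Matrix.mulVecLin_apply]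
    have hv := h (rsingle W x v)
    rw [hom_rsingle, rproj_toHom, rproj_rsingle_same] at hv
    constructor
    · rintro ⟨w, rfl⟩
      have h2 := hv.2 ⟨rsingle V x w, by rw [hom_rsingle, rproj_toHom, rproj_rsingle_same]⟩
      simpa using congrArg (rproj U x) h2
    · intro h3
      obtain ⟨w, hw⟩ := hv.1 (by rw [h3, map_zero])
      refine ⟨rproj V x w, ?_⟩
      rw [← rproj_toHom, hw, rproj_rsingle_same]
  · intro h v
    have h2 : ∀ x w, ψ.1 x *ᵥ w = 0 ↔ ∃ u, φ.1 x *ᵥ u = w := fun x w => by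
      have := SetLike.ext_iff.1 (h x) w
      simpa using this.symm
    constructor
    · intro hv
      choose u hu using fun x => (h2 x (rproj W x v)).1 (by rw [← rproj_toHom, hv, map_zero])
      refine ⟨rmk V u, rmod_ext W fun x => ?_⟩
      rw [rproj_toHom, ← hu]
      rfl
    · rintro ⟨u, rfl⟩
      refine rmod_ext U fun x => ?_
      rw [rproj_toHom, rproj_toHom, (h2 _ _).2 ⟨_, rfl⟩, map_zero]

end HomTranslation

section Homd

set_option linter.unusedSectionVars false

variable {R : Set (FormalRel Q)}
variable {M N P : Type} [AddCommGroup M] [Module ℂ M] [Module (Aq Q) M] [IsScalarTower ℂ (Aq Q) M]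
  [AddCommGroup N] [Module ℂ N] [Module (Aq Q) N] [IsScalarTower ℂ (Aq Q) N]
  [AddCommGroup P] [Module ℂ P] [Module (Aq Q) P] [IsScalarTower ℂ (Aq Q) P]

/-- The dimension of the space of homomorphisms. -/
def homd (Q : Quiv) (M N : Type) [AddCommGroup M] [Module ℂ M] [Module (Aq Q) M] [IsScalarTower ℂ (Aq Q) M]
    [AddCommGroup N] [Module ℂ N] [Module (Aq Q) N] [IsScalarTower ℂ (Aq Q) N] : ℕ :=
  Module.finrank ℂ (M →ₗ[Aq Q] N)

instance finiteDimensional_hom [FiniteDimensional ℂ M] [FiniteDimensional ℂ N] :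
    FiniteDimensional ℂ (M →ₗ[Aq Q] N) :=
  Module.Finite.of_injective (LinearMap.restrictScalarsₗ ℂ (Aq Q) M N ℂ)
    (LinearMap.restrictScalars_injective ℂ)

theorem homd_rmod {α γ : Q.V → ℕ} (V : QRep Q α) (W : QRep Q γ) :
    homd Q (RMod V) (RMod W) = dimHom V W := (LinearEquiv.finrank_eq (homEquiv V W)).symm

/-- Composition with a fixed homomorphism, on the left. -/
def postcomp (M : Type) [AddCommGroup M] [Module ℂ M] [Module (Aq Q) M] [IsScalarTower ℂ (Aq Q) M]
    (g : N →ₗ[Aq Q] P) : (M →ₗ[Aq Q] N) →ₗ[ℂ] (M →ₗ[Aq Q] P) where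
  toFun f := g ∘ₗ f
  map_add' _ _ := LinearMap.comp_add _ _ _
  map_smul' c f := LinearMap.ext fun m => by simp

/-- Composition with a fixed homomorphism, on the right. -/
def precomp (P : Type) [AddCommGroup P] [Module ℂ P] [Module (Aq Q) P] [IsScalarTower ℂ (Aq Q) P]
    (g : M →ₗ[Aq Q] N) : (N →ₗ[Aq Q] P) →ₗ[ℂ] (M →ₗ[Aq Q] P) where
  toFun f := f ∘ₗ g
  map_add' _ _ := LinearMap.add_comp _ _ _
  map_smul' _ _ := rfl

@[simp] theorem postcomp_apply (g : N →ₗ[Aq Q] P) (f : M →ₗ[Aq Q] N) : postcomp M g f = g ∘ₗ f := rfl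

@[simp] theorem precomp_apply (g : M →ₗ[Aq Q] N) (f : N →ₗ[Aq Q] P) : precomp P g f = f ∘ₗ g := rfl

theorem homd_congr_left (e : M ≃ₗ[Aq Q] N) : homd Q M P = homd Q N P :=
  LinearEquiv.finrank_eq
    { precomp P e.symm.toLinearMap with
      invFun := precomp P e.toLinearMap
      left_inv := fun f => LinearMap.ext fun x => by simp
      right_inv := fun f => LinearMap.ext fun x => by simp }

theorem homd_congr_right (e : M ≃ₗ[Aq Q] N) : homd Q P M = homd Q P N :=
  LinearEquiv.finrank_eq
    { postcomp P e.toLinearMap with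
      invFun := postcomp P e.symm.toLinearMap
      left_inv := fun f => LinearMap.ext fun x => by simp
      right_inv := fun f => LinearMap.ext fun x => by simp }

theorem homd_pi_right {ι : Type} [Fintype ι] {N : ι → Type} [∀ i, AddCommGroup (N i)]
    [∀ i, Module ℂ (N i)] [∀ i, Module (Aq Q) (N i)] [∀ i, IsScalarTower ℂ (Aq Q) (N i)]
    [FiniteDimensional ℂ M] [∀ i, FiniteDimensional ℂ (N i)] :
    homd Q M (∀ i, N i) = ∑ i, homd Q M (N i) := by
  have e : ((i : ι) → (M →ₗ[Aq Q] N i)) ≃ₗ[ℂ] (M →ₗ[Aq Q] ∀ i, N i) :=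
    { toFun := LinearMap.pi
      invFun := fun f i => LinearMap.proj i ∘ₗ f
      map_add' := fun _ _ => rfl
      map_smul' := fun _ _ => rfl
      left_inv := fun _ => rfl
      right_inv := fun _ => rfl }
  rw [homd, ← e.finrank_eq, Module.finrank_pi_fintype]
  rfl

theorem homd_pi_left {ι : Type} [Fintype ι] [DecidableEq ι] {N : ι → Type}
    [∀ i, AddCommGroup (N i)]
    [∀ i, Module ℂ (N i)] [∀ i, Module (Aq Q) (N i)] [∀ i, IsScalarTower ℂ (Aq Q) (N i)]
    [FiniteDimensional ℂ M] [∀ i, FiniteDimensional ℂ (N i)] :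
    homd Q (∀ i, N i) M = ∑ i, homd Q (N i) M := by
  have e : ((i : ι) → (N i →ₗ[Aq Q] M)) ≃ₗ[ℂ] ((∀ i, N i) →ₗ[Aq Q] M) := LinearMap.lsum (Aq Q) N ℂ
  rw [homd, ← e.finrank_eq, Module.finrank_pi_fintype]
  rfl

end Homd

section Lifting

set_option linter.unusedSectionVars false

variable {R : Set (FormalRel Q)}

/-- The lifting property against surjections of modules over the bound quiver algebra. -/
def ProjLift (R : Set (FormalRel Q)) (P : Type) [AddCommGroup P] [Module ℂ P] [Module (Aq Q) P]
    [IsScalarTower ℂ (Aq Q) P] : Prop :=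
  ∀ (M N : Type) [AddCommGroup M] [Module ℂ M] [Module (Aq Q) M] [IsScalarTower ℂ (Aq Q) M]
    [AddCommGroup N] [Module ℂ N] [Module (Aq Q) N] [IsScalarTower ℂ (Aq Q) N]
    [Good R M] [Good R N] (g : M →ₗ[Aq Q] N), Function.Surjective g →
    ∀ f : P →ₗ[Aq Q] N, ∃ h : P →ₗ[Aq Q] M, g ∘ₗ h = f

theorem isProjRep_iff {γ : Q.V → ℕ} {P : QRep Q γ} : IsProjRep R P ↔ ProjLift R (RMod P) := by
  constructor
  · intro h M N _ _ _ _ _ _ _ _ _ _ g hg f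
    obtain ⟨V, hV, ⟨e⟩⟩ := Good.exists_rep R M
    obtain ⟨W, hW, ⟨e'⟩⟩ := Good.exists_rep R N
    let g' : RMod V →ₗ[Aq Q] RMod W := e'.symm.toLinearMap ∘ₗ g ∘ₗ e.toLinearMap
    let f' : RMod P →ₗ[Aq Q] RMod W := e'.symm.toLinearMap ∘ₗ f
    have hg' : Function.Surjective g' := e'.symm.surjective.comp (hg.comp e.surjective)
    obtain ⟨k, hk, hk2⟩ := h _ _ V W hV hW (ofHom g').1 (ofHom g').2
      ((surjective_toHom_iff _).1 (by rwa [toHom_ofHom])) (ofHom f').1 (ofHom f').2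
    have hc := toHom_comp ⟨k, hk⟩ (ofHom g') (ofHom f') hk2
    rw [toHom_ofHom, toHom_ofHom] at hc
    refine ⟨e.toLinearMap ∘ₗ toHom ⟨k, hk⟩, LinearMap.ext fun v => ?_⟩
    have := congrArg e' (LinearMap.congr_fun hc v)
    simpa [g', f'] using this
  · intro h δ ε M N hM hN g hg hgs f hf
    have := good_rmod hM
    have := good_rmod hN
    obtain ⟨k, hk⟩ := h (RMod M) (RMod N) (toHom ⟨g, hg⟩) ((surjective_toHom_iff _).2 hgs) (toHom ⟨f, hf⟩)
    refine ⟨(ofHom k).1, (ofHom k).2, fun x => ?_⟩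
    have h2 := ofHom_comp k (toHom ⟨g, hg⟩) x
    rw [hk, ofHom_toHom, ofHom_toHom] at h2
    exact h2.symm

variable {M N P K E : Type}
  [AddCommGroup M] [Module ℂ M] [Module (Aq Q) M] [IsScalarTower ℂ (Aq Q) M]
  [AddCommGroup N] [Module ℂ N] [Module (Aq Q) N] [IsScalarTower ℂ (Aq Q) N]
  [AddCommGroup P] [Module ℂ P] [Module (Aq Q) P] [IsScalarTower ℂ (Aq Q) P]
  [AddCommGroup K] [Module ℂ K] [Module (Aq Q) K] [IsScalarTower ℂ (Aq Q) K]
  [AddCommGroup E] [Module ℂ E] [Module (Aq Q) E] [IsScalarTower ℂ (Aq Q) E]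

theorem ProjLift.of_equiv (h : ProjLift R P) (e : P ≃ₗ[Aq Q] N) : ProjLift R N := by
  intro A B _ _ _ _ _ _ _ _ _ _ g hg f
  obtain ⟨k, hk⟩ := h A B g hg (f ∘ₗ e.toLinearMap)
  refine ⟨k ∘ₗ e.symm.toLinearMap, LinearMap.ext fun v => ?_⟩
  simpa using LinearMap.congr_fun hk (e.symm v)

theorem ProjLift.pi {ι : Type} [Fintype ι] [DecidableEq ι] {P : ι → Type} [∀ i, AddCommGroup (P i)]
    [∀ i, Module ℂ (P i)] [∀ i, Module (Aq Q) (P i)] [∀ i, IsScalarTower ℂ (Aq Q) (P i)]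
    (h : ∀ i, ProjLift R (P i)) : ProjLift R (∀ i, P i) := by
  intro A B _ _ _ _ _ _ _ _ _ _ g hg f
  choose k hk using fun i => h i A B g hg (f ∘ₗ LinearMap.single _ _ i)
  refine ⟨LinearMap.lsum (Aq Q) P ℕ k, LinearMap.pi_ext' fun i => ?_⟩
  rw [← hk i]
  ext v
  simp only [LinearMap.lsum_apply, LinearMap.comp_apply, LinearMap.sum_apply, LinearMap.proj_apply,
    LinearMap.single_apply, map_sum]
  rw [Finset.sum_eq_single i]
  · simp
  · intro j _ hj
    rw [Pi.single_eq_of_ne hj, map_zero, map_zero]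
  · simp

theorem dimV_of_exact [Good R K] [Good R E] [Good R N] {i : K →ₗ[Aq Q] E} {q : E →ₗ[Aq Q] N}
    (hi : Function.Injective i) (hq : Function.Surjective q) (h : Function.Exact i q) (x : Q.V) :
    dimV E x = dimV K x + dimV N x := by
  have := Good.fin R E
  let qx : vsp E x →ₗ[ℂ] vsp N x := (q.restrictScalars ℂ).restrict (by
    rintro - ⟨m, rfl⟩
    exact ⟨q m, (map_smul q _ m).symm⟩)
  let ix : vsp K x →ₗ[ℂ] vsp E x := (i.restrictScalars ℂ).restrict (by
    rintro - ⟨m, rfl⟩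
    exact ⟨i m, (map_smul i _ m).symm⟩)
  have hix : Function.Injective ix := fun v w hvw => Subtype.ext (hi (congrArg Subtype.val hvw))
  have hqx : Function.Surjective qx := by
    rintro ⟨-, ⟨n, rfl⟩⟩
    obtain ⟨m, rfl⟩ := hq n
    exact ⟨⟨_, ⟨m, rfl⟩⟩, Subtype.ext (map_smul q _ m)⟩
  have hex : LinearMap.range ix = LinearMap.ker qx := by
    ext ⟨m, hm⟩
    simp only [LinearMap.mem_range, LinearMap.mem_ker, Subtype.ext_iff]
    change (∃ k : vsp K x, i k = m) ↔ q m = 0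
    rw [h m]
    constructor
    · rintro ⟨k, hk⟩
      exact ⟨k, hk⟩
    · rintro ⟨k, rfl⟩
      refine ⟨⟨(vtx x : Aq Q) • k, ⟨k, rfl⟩⟩, ?_⟩
      rw [map_smul]
      exact (Good.mem_vsp_iff R).1 hm
  have h1 := LinearMap.finrank_range_add_finrank_ker qx
  rw [← hex, LinearMap.finrank_range_of_inj hix, LinearMap.range_eq_top.2 hqx, finrank_top] at h1
  rw [dimV, dimV, dimV, ← h1, add_comm]

theorem exists_lift_of_exact {i : K →ₗ[Aq Q] E} {q : E →ₗ[Aq Q] N} (hi : Function.Injective i)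
    (h : Function.Exact i q) (f : M →ₗ[Aq Q] E) (hf : q ∘ₗ f = 0) : ∃ g : M →ₗ[Aq Q] K, i ∘ₗ g = f := by
  let e := LinearEquiv.ofInjective i hi
  have hr : ∀ m, f m ∈ LinearMap.range i := fun m => (h (f m)).1 (LinearMap.congr_fun hf m)
  refine ⟨e.symm.toLinearMap ∘ₗ f.codRestrict _ hr, LinearMap.ext fun m => ?_⟩
  exact congrArg Subtype.val (e.apply_symm_apply ⟨f m, hr m⟩)

theorem exists_desc_of_exact {i : K →ₗ[Aq Q] E} {q : E →ₗ[Aq Q] N} (hq : Function.Surjective q)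
    (h : Function.Exact i q) (f : E →ₗ[Aq Q] M) (hf : f ∘ₗ i = 0) : ∃ g : N →ₗ[Aq Q] M, g ∘ₗ q = f := by
  let e := q.quotKerEquivOfSurjective hq
  have hk : LinearMap.ker q ≤ LinearMap.ker f := by
    intro m hm
    obtain ⟨k, rfl⟩ := (h m).1 hm
    exact LinearMap.congr_fun hf k
  refine ⟨(LinearMap.ker q).liftQ f hk ∘ₗ e.symm.toLinearMap, LinearMap.ext fun m => ?_⟩
  have : e.symm (q m) = (LinearMap.ker q).mkQ m := by
    rw [LinearEquiv.symm_apply_eq]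
    rfl
  simp [this]

theorem ProjLift.homd_of_exact (hP : ProjLift R P) [FiniteDimensional ℂ P] [Good R K] [Good R E] [Good R N]
    {i : K →ₗ[Aq Q] E} {q : E →ₗ[Aq Q] N}
    (hi : Function.Injective i) (hq : Function.Surjective q) (h : Function.Exact i q) :
    homd Q P E = homd Q P K + homd Q P N := by
  have := Good.fin R E
  have := Good.fin R K
  have h1 := LinearMap.finrank_range_add_finrank_ker (postcomp P q)
  have hs : LinearMap.range (postcomp P q) = ⊤ := by
    rw [LinearMap.range_eq_top]
    intro f
    exact hP E N q hq f
  have hinj : Function.Injective (postcomp P i) := fun f g hfg =>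
    LinearMap.ext fun m => hi (LinearMap.congr_fun hfg m)
  have hk : LinearMap.range (postcomp P i) = LinearMap.ker (postcomp P q) := by
    ext f
    simp only [LinearMap.mem_range, LinearMap.mem_ker, postcomp_apply]
    constructor
    · rintro ⟨g, rfl⟩
      rw [← LinearMap.comp_assoc, h.linearMap_comp_eq_zero, LinearMap.zero_comp]
    · exact exists_lift_of_exact hi h f
  rw [← hk, hs, finrank_top, LinearMap.finrank_range_of_inj hinj] at h1
  rw [homd, homd, homd, ← h1, add_comm]

end Lifting

section SimpleModules

variable {R : Set (FormalRel Q)}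

theorem evalPath_zero {β : Q.V → ℕ} {V : QRep Q β} (hV : ∀ a, V a = 0) {x y : Q.V}
    (p : Quiver.Path x y) (hp : p.length ≠ 0) : evalPath V p = 0 := by
  cases p with
  | nil => simp at hp
  | cons p e =>
    rw [evalPath, hV]
    exact Matrix.zero_mul _

/-- The simple representation at a vertex. -/
def simpleRep (x : Q.V) : QRep Q (Pi.single x 1) := fun _ => 0

theorem simpleRep_mem (hR : AdmissibleRels R) (x : Q.V) : simpleRep x ∈ modSet R (Pi.single x 1) := by
  intro r hr
  rw [evalLin]
  refine Finset.sum_eq_zero fun p hp => ?_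
  have := hR r hr p hp
  beta_reduce
  rw [show evalPath (simpleRep x) p = 0 from evalPath_zero (fun _ => rfl) p (by lia), smul_zero]

theorem exists_socle_element (hQ : QAcyclic Q) {N : Type} [AddCommGroup N] [Module ℂ N] [Module (Aq Q) N]
    [IsScalarTower ℂ (Aq Q) N] [Good R N] [Nontrivial N] :
    ∃ (x : Q.V) (n : N), n ≠ 0 ∧ (vtx x : Aq Q) • n = n ∧ ∀ a : Q.A, (arr a : Aq Q) • n = 0 := by
  let r : Q.V → Q.V → Prop := fun y x => ∃ p : Quiver.Path x y, 0 < p.length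
  have hrt : IsTrans Q.V r := ⟨by
    rintro z y x ⟨p, hp⟩ ⟨q, hq⟩
    exact ⟨q.comp p, by rw [Quiver.Path.length_comp]; lia⟩⟩
  have hri : Std.Irrefl r := ⟨by
    rintro x ⟨p, hp⟩
    rw [hQ x p] at hp
    simp at hp⟩
  have hwf : WellFounded r := Finite.wellFounded_of_trans_of_irrefl r
  have key : ∀ x : Q.V, ∀ n : N, n ≠ 0 → (vtx x : Aq Q) • n = n →
      ∃ (x : Q.V) (n : N), n ≠ 0 ∧ (vtx x : Aq Q) • n = n ∧ ∀ a : Q.A, (arr a : Aq Q) • n = 0 := by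
    intro x
    induction x using hwf.induction with
    | _ x ih =>
      intro n hn hx
      by_cases h : ∀ a : Q.A, (arr a : Aq Q) • n = 0
      · exact ⟨x, n, hn, hx, h⟩
      · push Not at h
        obtain ⟨a, ha⟩ := h
        have hta : Q.t a = x := by
          by_contra hne
          apply ha
          rw [← Good.arr_vtx R a n, ← hx, Good.vtx_vtx_ne R hne, smul_zero]
        refine ih (Q.h a) ⟨(Quiver.Path.nil.cons (⟨a, hta, rfl⟩ : x ⟶ Q.h a)), ?_⟩ _ ha
          (Good.vtx_arr R a n)
        simp
  obtain ⟨n, hn⟩ := exists_ne (0 : N)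
  have : ∃ x : Q.V, (vtx x : Aq Q) • n ≠ 0 := by
    by_contra! h
    apply hn
    rw [← Good.sum_vtx R n]
    exact Finset.sum_eq_zero fun x _ => h x
  obtain ⟨x, hx⟩ := this
  exact key x _ hx (Good.vtx_vtx R x n)

/-- For a projective module, the dimension of the space of homomorphisms is a linear function of the
dimension vector. -/
theorem ProjLift.homd_eq (hQ : QAcyclic Q) (hR : AdmissibleRels R) {P : Type} [AddCommGroup P] [Module ℂ P]
    [Module (Aq Q) P] [IsScalarTower ℂ (Aq Q) P] [FiniteDimensional ℂ P] (hP : ProjLift R P)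
    (N : Type) [AddCommGroup N] [Module ℂ N] [Module (Aq Q) N] [IsScalarTower ℂ (Aq Q) N] [Good R N] :
    homd Q P N = ∑ x : Q.V, dimV N x * homd Q P (RMod (simpleRep x)) := by
  have := Good.fin R N
  obtain ⟨d, hd⟩ : ∃ d, Module.finrank ℂ N = d := ⟨_, rfl⟩
  induction d using Nat.strong_induction_on generalizing N with
  | _ d ih =>
    subst hd
    rcases subsingleton_or_nontrivial N with hN | hN
    · have h0 : ∀ x, dimV (Q := Q) N x = 0 := fun x => Module.finrank_zero_of_subsingleton
      have h1 : homd Q P N = 0 := Module.finrank_zero_of_subsingleton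
      rw [h1]
      exact (Finset.sum_eq_zero fun x _ => by rw [h0, zero_mul]).symm
    · obtain ⟨x, n, hn, hx, ha⟩ := exists_socle_element (R := R) hQ (N := N)
      have h1 : Fin ((Pi.single x 1 : Q.V → ℕ) x) := ⟨0, by simp⟩
      have hs : Subsingleton (Fin ((Pi.single x 1 : Q.V → ℕ) x)) := by
        rw [Pi.single_eq_same]
        infer_instance
      let f0 : RMod (simpleRep x) →ₗ[ℂ] N :=
        (LinearMap.toSpanSingleton ℂ N n) ∘ₗ LinearMap.proj h1 ∘ₗ rproj (simpleRep x) x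
      have hf0 : ∀ v, f0 v = (rproj (simpleRep x) x v h1) • n := fun v => rfl
      let f : RMod (simpleRep x) →ₗ[Aq Q] N := mkAq f0
        (by
          intro y v
          rw [vtx_smul, hf0, hf0, smul_comm]
          by_cases hy : y = x
          · subst hy
            rw [hx, rproj_rsingle_same]
          · rw [← hx, Good.vtx_vtx_ne R hy, rproj_rsingle_ne _ (Ne.symm hy)]
            simp)
        (by
          intro a v
          rw [arr_smul, hf0, hf0, smul_comm, ha, smul_zero]
          simp [simpleRep])
      have hf : ∀ v, f v = (rproj (simpleRep x) x v h1) • n := hf0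
      have hinj : Function.Injective f := by
        rw [injective_iff_map_eq_zero]
        intro v hv
        rw [hf, smul_eq_zero] at hv
        refine rmod_ext _ fun y => funext fun i => ?_
        by_cases hy : y = x
        · subst hy
          rw [Subsingleton.elim i h1]
          simpa [hn] using hv
        · rw [Pi.single_eq_of_ne hy] at i
          exact i.elim0
      let K := LinearMap.range f
      have hS := good_rmod (simpleRep_mem hR x)
      have hex : Function.Exact f K.mkQ := by
        rw [LinearMap.exact_iff, Submodule.ker_mkQ]
      have hlt : Module.finrank ℂ (N ⧸ K) < Module.finrank ℂ N := by
        have h2 := (K.mkQ.restrictScalars ℂ).finrank_range_add_finrank_ker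
        have hr : LinearMap.range (K.mkQ.restrictScalars ℂ) = ⊤ := LinearMap.range_eq_top.2 K.mkQ_surjective
        rw [hr, finrank_top] at h2
        have h3 : 0 < Module.finrank ℂ (LinearMap.ker (K.mkQ.restrictScalars ℂ)) := by
          have : Nontrivial (LinearMap.ker (K.mkQ.restrictScalars ℂ)) := by
            refine ⟨⟨⟨n, ?_⟩, 0, fun h => hn (congrArg Subtype.val h)⟩⟩
            have : n ∈ K := ⟨rsingle _ x fun _ => 1, by rw [hf, rproj_rsingle_same, one_smul]⟩
            simpa using this
          exact Module.finrank_pos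
        lia
      have h4 := ih _ hlt (N ⧸ K) (Good.fin R _) rfl
      rw [hP.homd_of_exact (R := R) hinj K.mkQ_surjective hex, h4]
      simp_rw [dimV_of_exact (R := R) hinj K.mkQ_surjective hex, add_mul, Finset.sum_add_distrib, dimV_rmod]
      simp [Pi.single_apply]

end SimpleModules

section Resolutions

set_option linter.unusedSectionVars false

variable {R : Set (FormalRel Q)}

/-- The linear form with coefficients `c`. -/
def eul (c : Q.V → ℤ) (β : Q.V → ℕ) : ℤ := ∑ x, c x * β x

theorem eul_add_right (c : Q.V → ℤ) (β γ : Q.V → ℕ) : eul c (β + γ) = eul c β + eul c γ := by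
  simp [eul, mul_add, Finset.sum_add_distrib]

theorem eul_sum_left {ι : Type} [Fintype ι] (c : ι → Q.V → ℤ) (β : Q.V → ℕ) :
    eul (fun x => ∑ i, c i x) β = ∑ i, eul (c i) β := by
  simp only [eul, Finset.sum_mul]
  exact Finset.sum_comm

theorem eul_sum_right {ι : Type} [Fintype ι] (c : Q.V → ℤ) (β : ι → Q.V → ℕ) :
    eul c (fun x => ∑ i, β i x) = ∑ i, eul c (β i) := by
  simp only [eul, Nat.cast_sum, Finset.mul_sum]
  exact Finset.sum_comm

/-- `M` has a projective resolution of length one whose Euler form is given by `c`. -/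
def HasRes (R : Set (FormalRel Q)) (M : Type) [AddCommGroup M] [Module ℂ M] [Module (Aq Q) M]
    [IsScalarTower ℂ (Aq Q) M] (c : Q.V → ℤ) : Prop :=
  ∃ (γ₀ γ₁ : Q.V → ℕ) (P₀ : QRep Q γ₀) (P₁ : QRep Q γ₁), P₀ ∈ modSet R γ₀ ∧ P₁ ∈ modSet R γ₁ ∧
    ProjLift R (RMod P₀) ∧ ProjLift R (RMod P₁) ∧
    ∃ (f : RMod P₁ →ₗ[Aq Q] RMod P₀) (p : RMod P₀ →ₗ[Aq Q] M),
      Function.Injective f ∧ Function.Surjective p ∧ Function.Exact f p ∧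
      ∀ x, c x = homd Q (RMod P₀) (RMod (simpleRep x)) - homd Q (RMod P₁) (RMod (simpleRep x))

variable {M N P K E : Type}
  [AddCommGroup M] [Module ℂ M] [Module (Aq Q) M] [IsScalarTower ℂ (Aq Q) M]
  [AddCommGroup N] [Module ℂ N] [Module (Aq Q) N] [IsScalarTower ℂ (Aq Q) N]
  [AddCommGroup P] [Module ℂ P] [Module (Aq Q) P] [IsScalarTower ℂ (Aq Q) P]
  [AddCommGroup K] [Module ℂ K] [Module (Aq Q) K] [IsScalarTower ℂ (Aq Q) K]
  [AddCommGroup E] [Module ℂ E] [Module (Aq Q) E] [IsScalarTower ℂ (Aq Q) E]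

theorem HasRes.of_modules [Good R P] [Good R K] (hP : ProjLift R P) (hK : ProjLift R K) {f : K →ₗ[Aq Q] P}
    {p : P →ₗ[Aq Q] M} (hf : Function.Injective f) (hp : Function.Surjective p)
    (hfp : Function.Exact f p) {c : Q.V → ℤ}
    (hc : ∀ x, c x = homd Q P (RMod (simpleRep x)) - homd Q K (RMod (simpleRep x))) :
    HasRes R M c := by
  obtain ⟨V, hV, ⟨e⟩⟩ := Good.exists_rep R P
  obtain ⟨W, hW, ⟨e'⟩⟩ := Good.exists_rep R K
  refine ⟨_, _, V, W, hV, hW, hP.of_equiv e.symm, hK.of_equiv e'.symm,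
    e.symm.toLinearMap ∘ₗ f ∘ₗ e'.toLinearMap, p ∘ₗ e.toLinearMap,
    e.symm.injective.comp (hf.comp e'.injective), hp.comp e.surjective, ?_, ?_⟩
  · intro v
    have h := hfp (e v)
    simp only [LinearMap.comp_apply, LinearEquiv.coe_coe, h, Set.mem_range]
    constructor
    · rintro ⟨w, hw⟩
      exact ⟨e'.symm w, by simp [hw]⟩
    · rintro ⟨w, rfl⟩
      exact ⟨e' w, by simp⟩
  · intro x
    rw [homd_congr_left e, homd_congr_left e', hc]

theorem HasRes.of_equiv {c : Q.V → ℤ} (h : HasRes R M c) (e : M ≃ₗ[Aq Q] N) : HasRes R N c := by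
  obtain ⟨γ₀, γ₁, P₀, P₁, h0, h1, hp0, hp1, f, p, hf, hp, hfp, hc⟩ := h
  refine ⟨γ₀, γ₁, P₀, P₁, h0, h1, hp0, hp1, f, e.toLinearMap ∘ₗ p, hf, e.surjective.comp hp, ?_, hc⟩
  intro v
  rw [← hfp v]
  simp

theorem HasRes.pi {ι : Type} [Fintype ι] [DecidableEq ι] {M : ι → Type} [∀ i, AddCommGroup (M i)]
    [∀ i, Module ℂ (M i)] [∀ i, Module (Aq Q) (M i)] [∀ i, IsScalarTower ℂ (Aq Q) (M i)]
    {c : ι → Q.V → ℤ} (h : ∀ i, HasRes R (M i) (c i)) : HasRes R (∀ i, M i) (fun x => ∑ i, c i x) := by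
  choose γ₀ γ₁ P₀ P₁ h0 h1 hp0 hp1 f p hf hp hfp hc using h
  have := fun i => good_rmod (h0 i)
  have := fun i => good_rmod (h1 i)
  refine HasRes.of_modules (P := ∀ i, RMod (P₀ i)) (K := ∀ i, RMod (P₁ i)) (ProjLift.pi hp0)
    (ProjLift.pi hp1)
    (f := LinearMap.pi fun i => f i ∘ₗ LinearMap.proj i)
    (p := LinearMap.pi fun i => p i ∘ₗ LinearMap.proj i) ?_ ?_ ?_ ?_
  · intro v w hvw
    exact funext fun i => hf i (congrFun hvw i)
  · intro v
    choose w hw using fun i => hp i (v i)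
    exact ⟨w, funext hw⟩
  · intro v
    constructor
    · intro hv
      choose w hw using fun i => (hfp i (v i)).1 (congrFun hv i)
      exact ⟨w, funext hw⟩
    · rintro ⟨w, rfl⟩
      exact funext fun i => (hfp i _).2 ⟨_, rfl⟩
  · intro x
    rw [homd_pi_left, homd_pi_left, ← Finset.sum_congr rfl fun i _ => (hc i x).symm]
    push_cast
    rw [Finset.sum_sub_distrib]

theorem exists_hasRes_of_mem_PAset {α : Q.V → ℕ} {V : QRep Q α} (hV : V ∈ PAset R α) :
    ∃ c, HasRes R (RMod V) c := by
  obtain ⟨-, γ₀, γ₁, P₀, P₁, h0, h1, hp0, hp1, i, hi, p, hp, hii, hps, hex⟩ := hV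
  exact ⟨_, γ₀, γ₁, P₀, P₁, h0, h1, isProjRep_iff.1 hp0, isProjRep_iff.1 hp1, toHom ⟨i, hi⟩,
    toHom ⟨p, hp⟩, (injective_toHom_iff _).2 hii, (surjective_toHom_iff _).2 hps,
    (exact_toHom_iff _ _).2 hex, fun x => rfl⟩

theorem HasRes.mem_PAset {α : Q.V → ℕ} {V : QRep Q α} {c : Q.V → ℤ} (h : HasRes R (RMod V) c) :
    V ∈ PAset R α := by
  obtain ⟨γ₀, γ₁, P₀, P₁, h0, h1, hp0, hp1, f, p, hf, hp, hfp, hc⟩ := h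
  have := good_rmod h0
  have : Good R (RMod V) := Good.of_surjective p hp
  rw [← toHom_ofHom f] at hf hfp
  rw [← toHom_ofHom p] at hp hfp
  exact ⟨mem_modSet_of_good, γ₀, γ₁, P₀, P₁, h0, h1, isProjRep_iff.2 hp0, isProjRep_iff.2 hp1,
    (ofHom f).1, (ofHom f).2, (ofHom p).1, (ofHom p).2, (injective_toHom_iff _).1 hf,
    (surjective_toHom_iff _).1 hp, (exact_toHom_iff _ _).1 hfp⟩

theorem HasRes.good {c : Q.V → ℤ} (h : HasRes R M c) : Good R M := by
  obtain ⟨γ₀, γ₁, P₀, P₁, h0, h1, hp0, hp1, f, p, hf, hp, hfp, hc⟩ := h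
  have := good_rmod h0
  exact Good.of_surjective p hp

/-- The long exact sequence of homomorphisms attached to a resolution of length one. -/
theorem HasRes.exists_data (hQ : QAcyclic Q) (hR : AdmissibleRels R) {c : Q.V → ℤ} (h : HasRes R M c) :
    ∃ (γ₀ γ₁ : Q.V → ℕ) (P₀ : QRep Q γ₀) (P₁ : QRep Q γ₁), ProjLift R (RMod P₀) ∧ ProjLift R (RMod P₁) ∧
    ∃ (f : RMod P₁ →ₗ[Aq Q] RMod P₀) (p : RMod P₀ →ₗ[Aq Q] M), Function.Surjective p ∧
      Function.Exact f p ∧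
      ∀ (N : Type) [AddCommGroup N] [Module ℂ N] [Module (Aq Q) N] [IsScalarTower ℂ (Aq Q) N] [Good R N],
      eul c (dimV N) ≤ homd Q M N ∧
        ((homd Q M N : ℤ) = eul c (dimV N) ↔ ∀ g : RMod P₁ →ₗ[Aq Q] N, ∃ k, k ∘ₗ f = g) := by
  have hM := h.good
  have := Good.fin R M
  obtain ⟨γ₀, γ₁, P₀, P₁, h0, h1, hp0, hp1, f, p, hf, hp, hfp, hc⟩ := h
  have := good_rmod h0
  have := good_rmod h1
  refine ⟨γ₀, γ₁, P₀, P₁, hp0, hp1, f, p, hp, hfp, fun N _ _ _ _ _ => ?_⟩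
  have := Good.fin R N
  have hk : LinearMap.range (precomp N p) = LinearMap.ker (precomp N f) := by
    ext g
    simp only [LinearMap.mem_range, LinearMap.mem_ker, precomp_apply]
    constructor
    · rintro ⟨g, rfl⟩
      rw [LinearMap.comp_assoc, hfp.linearMap_comp_eq_zero, LinearMap.comp_zero]
    · exact exists_desc_of_exact hp hfp g
  have hinj : Function.Injective (precomp N p) := by
    intro g g' hg
    refine LinearMap.ext fun m => ?_
    obtain ⟨m, rfl⟩ := hp m
    exact LinearMap.congr_fun hg m
  have hrk := LinearMap.finrank_range_add_finrank_ker (precomp N f)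
  rw [← hk, LinearMap.finrank_range_of_inj hinj] at hrk
  have he : eul c (dimV N) = homd Q (RMod P₀) N - homd Q (RMod P₁) N := by
    rw [hp0.homd_eq hQ hR N, hp1.homd_eq hQ hR N, eul]
    push_cast
    rw [← Finset.sum_sub_distrib]
    refine Finset.sum_congr rfl fun x _ => ?_
    rw [hc]
    ring
  have hle := Submodule.finrank_le (LinearMap.range (precomp N f))
  change _ + homd Q M N = homd Q (RMod P₀) N at hrk
  change _ ≤ homd Q (RMod P₁) N at hle
  refine ⟨by lia, ?_⟩
  have hs : (∀ g : RMod P₁ →ₗ[Aq Q] N, ∃ k, k ∘ₗ f = g) ↔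
      Module.finrank ℂ (LinearMap.range (precomp N f)) = homd Q (RMod P₁) N := by
    constructor
    · intro h
      rw [LinearMap.range_eq_top.2 (show Function.Surjective (precomp N f) from h), finrank_top]
      rfl
    · intro h
      exact LinearMap.range_eq_top.1 (Submodule.eq_top_of_finrank_eq h)
  rw [hs]
  lia

theorem HasRes.eul_le (hQ : QAcyclic Q) (hR : AdmissibleRels R)
    {c : Q.V → ℤ} (h : HasRes R M c) (N : Type) [AddCommGroup N] [Module ℂ N]
    [Module (Aq Q) N] [IsScalarTower ℂ (Aq Q) N] [Good R N] : eul c (dimV N) ≤ homd Q M N := by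
  obtain ⟨γ₀, γ₁, P₀, P₁, hp0, hp1, f, p, hp, hfp, h⟩ := h.exists_data hQ hR
  exact (h N).1

theorem HasRes.ext_right (hQ : QAcyclic Q) (hR : AdmissibleRels R)
    [Good R N] [Good R P] {c : Q.V → ℤ} (h : HasRes R M c)
    {q : N →ₗ[Aq Q] P} (hq : Function.Surjective q) (hN : (homd Q M N : ℤ) = eul c (dimV N)) :
    (homd Q M P : ℤ) = eul c (dimV P) := by
  obtain ⟨γ₀, γ₁, P₀, P₁, hp0, hp1, f, p, hp, hfp, h⟩ := h.exists_data hQ hR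
  refine (h P).2.2 fun g => ?_
  obtain ⟨g', rfl⟩ := hp1 N P q hq g
  obtain ⟨k, rfl⟩ := (h N).2.1 hN g'
  exact ⟨q ∘ₗ k, rfl⟩

theorem HasRes.exists_lift (hQ : QAcyclic Q) (hR : AdmissibleRels R)
    [Good R N] [Good R K] [Good R E] {c : Q.V → ℤ} (h : HasRes R M c)
    {i : K →ₗ[Aq Q] E} {q : E →ₗ[Aq Q] N} (hi : Function.Injective i) (hq : Function.Surjective q)
    (hiq : Function.Exact i q) (hK : (homd Q M K : ℤ) = eul c (dimV K)) (g : M →ₗ[Aq Q] N) :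
    ∃ g' : M →ₗ[Aq Q] E, q ∘ₗ g' = g := by
  obtain ⟨γ₀, γ₁, P₀, P₁, hp0, hp1, f, p, hp, hfp, h⟩ := h.exists_data hQ hR
  obtain ⟨k, hk⟩ := hp0 E N q hq (g ∘ₗ p)
  obtain ⟨u, hu⟩ := exists_lift_of_exact hi hiq (k ∘ₗ f) (by
    rw [← LinearMap.comp_assoc, hk, LinearMap.comp_assoc, hfp.linearMap_comp_eq_zero, LinearMap.comp_zero])
  obtain ⟨w, rfl⟩ := (h K).2.1 hK u
  obtain ⟨g', hg'⟩ := exists_desc_of_exact hp hfp (k - i ∘ₗ w) (by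
    rw [LinearMap.sub_comp, LinearMap.comp_assoc, hu, sub_self])
  refine ⟨g', ?_⟩
  refine LinearMap.ext fun m => ?_
  obtain ⟨m, rfl⟩ := hp m
  have h1 := congrArg q (LinearMap.congr_fun hg' m)
  have h2 := LinearMap.congr_fun hk m
  have h3 : q (i (w m)) = 0 := (hiq _).2 ⟨_, rfl⟩
  simp only [LinearMap.comp_apply, LinearMap.sub_apply, map_sub] at h1 h2 ⊢
  rw [h1, h2, h3, sub_zero]

end Resolutions

section ResolutionMatrices

set_option linter.unusedSectionVars false

theorem exists_split_matrices {k m n : ℕ} (f : Matrix (Fin m) (Fin k) ℂ) (p : Matrix (Fin n) (Fin m) ℂ)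
    (hf : Function.Injective f.mulVecLin) (hp : Function.Surjective p.mulVecLin)
    (hfp : LinearMap.range f.mulVecLin = LinearMap.ker p.mulVecLin) :
    ∃ (s : Matrix (Fin m) (Fin n) ℂ) (r : Matrix (Fin k) (Fin m) ℂ),
      p * s = 1 ∧ r * f = 1 ∧ r * s = 0 ∧ f * r + s * p = 1 ∧ p * f = 0 := by
  obtain ⟨s', hs⟩ := LinearMap.exists_rightInverse_of_surjective p.mulVecLin (LinearMap.range_eq_top.2 hp)
  obtain ⟨r', hr⟩ := LinearMap.exists_leftInverse_of_injective f.mulVecLin (LinearMap.ker_eq_bot.2 hf)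
  set s := LinearMap.toMatrix' s'
  set r := LinearMap.toMatrix' r'
  have h1 : p * s = 1 := by
    have h := congrArg LinearMap.toMatrix' hs
    rwa [← Matrix.toLin'_apply', LinearMap.toMatrix'_comp, LinearMap.toMatrix'_toLin',
      LinearMap.toMatrix'_id] at h
  have h2 : r * f = 1 := by
    have h := congrArg LinearMap.toMatrix' hr
    rwa [← Matrix.toLin'_apply', LinearMap.toMatrix'_comp, LinearMap.toMatrix'_toLin',
      LinearMap.toMatrix'_id] at h
  have h3 : p * f = 0 := by
    refine Matrix.ext_of_mulVec_single fun j => ?_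
    have h : f *ᵥ Pi.single j 1 ∈ LinearMap.ker p.mulVecLin := hfp ▸ ⟨_, rfl⟩
    rw [LinearMap.mem_ker, Matrix.mulVecLin_apply, Matrix.mulVec_mulVec] at h
    rw [h, Matrix.zero_mulVec]
  have h4 : f * r * (1 - s * p) = 1 - s * p := by
    refine Matrix.ext_of_mulVec_single fun j => ?_
    have h : (1 - s * p) *ᵥ Pi.single j 1 ∈ LinearMap.range f.mulVecLin := by
      rw [hfp, LinearMap.mem_ker, Matrix.mulVecLin_apply, Matrix.mulVec_mulVec, Matrix.mul_sub, ← Matrix.mul_assoc, h1,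
        Matrix.mul_one, Matrix.one_mul, sub_self, Matrix.zero_mulVec]
    obtain ⟨u, hu⟩ := h
    rw [← Matrix.mulVec_mulVec, ← hu, Matrix.mulVecLin_apply, Matrix.mulVec_mulVec, Matrix.mul_assoc, h2, Matrix.mul_one]
  refine ⟨s, r * (1 - s * p), h1, ?_, ?_, ?_, h3⟩
  · rw [Matrix.mul_assoc, Matrix.sub_mul, Matrix.mul_assoc s, h3, Matrix.one_mul, Matrix.mul_zero, sub_zero, h2]
  · rw [Matrix.mul_assoc, Matrix.sub_mul, Matrix.mul_assoc s, h1, Matrix.one_mul, Matrix.mul_one, sub_self,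
      Matrix.mul_zero]
  · rw [← Matrix.mul_assoc, h4, sub_add_cancel]

variable {R : Set (FormalRel Q)} {α γ₀ γ₁ δ : Q.V → ℕ} {V : QRep Q α} {P₀ : QRep Q γ₀} {P₁ : QRep Q γ₁}

/-- A short exact sequence of representations together with a splitting at each vertex. -/
structure SplitSeq (P₁ : QRep Q γ₁) (P₀ : QRep Q γ₀) (V : QRep Q α) where
  f : C0sp (Q := Q) γ₁ γ₀
  p : C0sp (Q := Q) γ₀ α
  s : C0sp (Q := Q) α γ₀
  r : C0sp (Q := Q) γ₀ γ₁
  hf : ∀ a, f (Q.h a) * P₁ a = P₀ a * f (Q.t a)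
  hp : ∀ a, p (Q.h a) * P₀ a = V a * p (Q.t a)
  ps : ∀ x, p x * s x = 1
  rf : ∀ x, r x * f x = 1
  rs : ∀ x, r x * s x = 0
  pf : ∀ x, p x * f x = 0
  fr : ∀ x, f x * r x = 1 - s x * p x

theorem HasRes.exists_splitSeq {c : Q.V → ℤ} (h : HasRes R (RMod V) c) :
    ∃ (γ₀ γ₁ : Q.V → ℕ) (P₀ : QRep Q γ₀) (P₁ : QRep Q γ₁), P₀ ∈ modSet R γ₀ ∧ P₁ ∈ modSet R γ₁ ∧
    ProjLift R (RMod P₀) ∧ ProjLift R (RMod P₁) ∧ Nonempty (SplitSeq P₁ P₀ V) ∧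
      ∀ x, c x = homd Q (RMod P₀) (RMod (simpleRep x)) - homd Q (RMod P₁) (RMod (simpleRep x)) := by
  obtain ⟨γ₀, γ₁, P₀, P₁, h0, h1, hp0, hp1, f, p, hf, hp, hfp, hc⟩ := h
  rw [← toHom_ofHom f] at hf hfp
  rw [← toHom_ofHom p] at hp hfp
  rw [injective_toHom_iff] at hf
  rw [surjective_toHom_iff] at hp
  rw [exact_toHom_iff] at hfp
  choose s r h1' h2 h3 h4 h5 using fun x => exists_split_matrices _ _ (hf x) (hp x) (hfp x)
  exact ⟨γ₀, γ₁, P₀, P₁, h0, h1, hp0, hp1, ⟨⟨(ofHom f).1, (ofHom p).1, s, r, (ofHom f).2, (ofHom p).2,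
    h1', h2, h3, h5, fun x => eq_sub_of_add_eq (h4 x)⟩⟩, hc⟩

theorem SplitSeq.injective_f (S : SplitSeq P₁ P₀ V) : MorInj S.f := fun x u w h => by
  have h' := congrArg (S.r x).mulVecLin h
  simpa [Matrix.mulVec_mulVec, S.rf] using h'

theorem SplitSeq.surjective_p (S : SplitSeq P₁ P₀ V) : MorSurj S.p := fun x u =>
  ⟨S.s x *ᵥ u, by simp [Matrix.mulVec_mulVec, S.ps]⟩

theorem SplitSeq.range_eq_ker (S : SplitSeq P₁ P₀ V) (x : Q.V) :
    LinearMap.range (S.f x).mulVecLin = LinearMap.ker (S.p x).mulVecLin := by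
  ext u
  simp only [LinearMap.mem_range, LinearMap.mem_ker, Matrix.mulVecLin_apply]
  constructor
  · rintro ⟨w, rfl⟩
    simp [Matrix.mulVec_mulVec, S.pf]
  · intro h
    refine ⟨S.r x *ᵥ u, ?_⟩
    rw [Matrix.mulVec_mulVec, S.fr, Matrix.sub_mulVec, ← Matrix.mulVec_mulVec, h]
    simp

theorem SplitSeq.hasRes (S : SplitSeq P₁ P₀ V) (h0 : P₀ ∈ modSet R γ₀) (h1 : P₁ ∈ modSet R γ₁)
    (hp0 : ProjLift R (RMod P₀)) (hp1 : ProjLift R (RMod P₁)) : ∃ c, HasRes R (RMod V) c :=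
  ⟨_, γ₀, γ₁, P₀, P₁, h0, h1, hp0, hp1, toHom ⟨S.f, S.hf⟩, toHom ⟨S.p, S.hp⟩,
    (injective_toHom_iff _).2 S.injective_f, (surjective_toHom_iff _).2 S.surjective_p,
    (exact_toHom_iff _ _).2 S.range_eq_ker, fun _ => rfl⟩

/-- The differential whose cokernel computes the extensions of `V` by `W`. -/
def SplitSeq.diff (S : SplitSeq P₁ P₀ V) (W : QRep Q δ) :
    (HomS P₁ W × C0sp (Q := Q) α δ) →ₗ[ℂ] C1sp (Q := Q) α δ where
  toFun z a := W a * z.2 (Q.t a) - z.2 (Q.h a) * V a -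
    z.1.1 (Q.h a) * (S.r (Q.h a) * P₀ a * S.s (Q.t a))
  map_add' z w := by
    funext a
    simp only [Prod.fst_add, Prod.snd_add, Pi.add_apply, Submodule.coe_add, Matrix.mul_add, Matrix.add_mul]
    abel
  map_smul' k z := by
    funext a
    simp only [Prod.smul_fst, Prod.smul_snd, Pi.smul_apply, Submodule.coe_smul, Matrix.mul_smul,
      Matrix.smul_mul, smul_sub, RingHom.id_apply]

theorem SplitSeq.comp_diff (S : SplitSeq P₁ P₀ V) (W : QRep Q δ) (ψ : HomS P₁ W)
    (b : C0sp (Q := Q) α δ) (a : Q.A) :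
    (b (Q.h a) * S.p (Q.h a) + ψ.1 (Q.h a) * S.r (Q.h a)) * P₀ a =
      W a * (b (Q.t a) * S.p (Q.t a) + ψ.1 (Q.t a) * S.r (Q.t a)) - S.diff W (ψ, b) a * S.p (Q.t a) := by
  have hψ : ψ.1 (Q.h a) * P₁ a = W a * ψ.1 (Q.t a) := ψ.2 a
  have e1 : S.r (Q.h a) * P₀ a = P₁ a * S.r (Q.t a) +
      S.r (Q.h a) * P₀ a * S.s (Q.t a) * S.p (Q.t a) := by
    have h : S.r (Q.h a) * (S.f (Q.h a) * P₁ a) * S.r (Q.t a) =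
        S.r (Q.h a) * (P₀ a * S.f (Q.t a)) * S.r (Q.t a) := by rw [S.hf]
    rw [← Matrix.mul_assoc, S.rf, Matrix.one_mul, ← Matrix.mul_assoc, Matrix.mul_assoc _ (S.f _), S.fr,
      Matrix.mul_sub, Matrix.mul_one] at h
    rw [h, Matrix.mul_assoc _ (S.s _), sub_add_cancel]
  have e2 : ψ.1 (Q.h a) * S.r (Q.h a) * P₀ a = W a * ψ.1 (Q.t a) * S.r (Q.t a) +
      ψ.1 (Q.h a) * (S.r (Q.h a) * P₀ a * S.s (Q.t a) * S.p (Q.t a)) := by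
    rw [Matrix.mul_assoc, e1, Matrix.mul_add, ← Matrix.mul_assoc, hψ]
    rw [← e1]
  have e3 : b (Q.h a) * S.p (Q.h a) * P₀ a = b (Q.h a) * V a * S.p (Q.t a) := by
    rw [Matrix.mul_assoc, S.hp, Matrix.mul_assoc]
  have e4 : S.diff W (ψ, b) a = W a * b (Q.t a) - b (Q.h a) * V a -
      ψ.1 (Q.h a) * (S.r (Q.h a) * P₀ a * S.s (Q.t a)) := rfl
  rw [Matrix.add_mul, e2, e3, e4, Matrix.sub_mul, Matrix.sub_mul, Matrix.mul_add]
  simp only [Matrix.mul_assoc]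
  abel

theorem finrank_C0sp (α δ : Q.V → ℕ) :
    Module.finrank ℂ (C0sp (Q := Q) α δ) = ∑ x, δ x * α x := by
  simp [Module.finrank_pi_fintype, Module.finrank_matrix]

theorem SplitSeq.le_finrank_range_diff (S : SplitSeq P₁ P₀ V) (W : QRep Q δ) :
    homd Q (RMod P₁) (RMod W) + ∑ x, δ x * α x ≤
      Module.finrank ℂ (LinearMap.range (S.diff W)) + homd Q (RMod P₀) (RMod W) := by
  have h := LinearMap.finrank_range_add_finrank_ker (S.diff W)
  have hfr : Module.finrank ℂ (HomS P₁ W × C0sp (Q := Q) α δ) =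
      homd Q (RMod P₁) (RMod W) + ∑ x, δ x * α x := by
    rw [Module.finrank_prod, finrank_C0sp, homd_rmod]
    rfl
  rw [hfr] at h
  rw [← h]
  refine Nat.add_le_add_left ?_ _
  rw [homd_rmod]
  let F : LinearMap.ker (S.diff W) →ₗ[ℂ] HomS P₀ W :=
    { toFun := fun z => ⟨fun x => z.1.2 x * S.p x + z.1.1.1 x * S.r x, fun a => by
        have hz : S.diff W z.1 = 0 := z.2
        rw [S.comp_diff W z.1.1 z.1.2, hz, Pi.zero_apply, Matrix.zero_mul, sub_zero]⟩
      map_add' := fun z w => by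
        refine Subtype.ext (funext fun x => ?_)
        simp only [Submodule.coe_add, Prod.fst_add, Prod.snd_add, Pi.add_apply, Matrix.add_mul]
        abel
      map_smul' := fun k z => by
        refine Subtype.ext (funext fun x => ?_)
        simp [Matrix.smul_mul] }
  have hF : ∀ z x, (F z).1 x = z.1.2 x * S.p x + z.1.1.1 x * S.r x := fun _ _ => rfl
  refine LinearMap.finrank_le_finrank_of_injective (f := F) fun z w hzw => ?_
  have hz' : ∀ x, z.1.2 x * S.p x + z.1.1.1 x * S.r x = w.1.2 x * S.p x + w.1.1.1 x * S.r x := fun x => by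
    rw [← hF, hzw, hF]
  refine Subtype.ext (Prod.ext (Subtype.ext (funext fun x => ?_)) (funext fun x => ?_))
  · have h := congrArg (· * S.f x) (hz' x)
    simpa [Matrix.add_mul, Matrix.mul_assoc, S.pf, S.rf] using h
  · have h := congrArg (· * S.s x) (hz' x)
    simpa [Matrix.add_mul, Matrix.mul_assoc, S.ps, S.rs] using h

theorem homd_sub_homd_eq_eul (hQ : QAcyclic Q) (hR : AdmissibleRels R) (h0 : P₀ ∈ modSet R γ₀)
    (h1 : P₁ ∈ modSet R γ₁) (hp0 : ProjLift R (RMod P₀)) (hp1 : ProjLift R (RMod P₁)) {c : Q.V → ℤ}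
    (hc : ∀ x, c x = homd Q (RMod P₀) (RMod (simpleRep x)) - homd Q (RMod P₁) (RMod (simpleRep x)))
    {W : QRep Q δ} (hW : W ∈ modSet R δ) :
    (homd Q (RMod P₀) (RMod W) : ℤ) - homd Q (RMod P₁) (RMod W) = eul c δ := by
  have := good_rmod h0
  have := good_rmod h1
  have := good_rmod hW
  rw [hp0.homd_eq hQ hR (RMod W), hp1.homd_eq hQ hR (RMod W), dimV_rmod]
  push_cast
  rw [← Finset.sum_sub_distrib]
  refine Finset.sum_congr rfl fun x _ => ?_
  rw [hc]
  ring

theorem HasRes.exists_bound [Fintype Q.A] (hQ : QAcyclic Q) (hR : AdmissibleRels R) (α : Q.V → ℕ) :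
    ∃ B : ℤ, ∀ (V : QRep Q α) (c : Q.V → ℤ), HasRes R (RMod V) c → ∀ x, -B ≤ c x ∧ c x ≤ B := by
  refine ⟨∑ x, (α x : ℤ) + ∑ x, (Module.finrank ℂ (C1sp (Q := Q) α (Pi.single x 1)) : ℤ),
    fun V c h x => ?_⟩
  have hx1 : (α x : ℤ) ≤ ∑ x, (α x : ℤ) :=
    Finset.single_le_sum (fun y _ => Int.natCast_nonneg (α y)) (Finset.mem_univ x)
  have hx2 : (Module.finrank ℂ (C1sp (Q := Q) α (Pi.single x 1)) : ℤ) ≤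
      ∑ x, (Module.finrank ℂ (C1sp (Q := Q) α (Pi.single x 1)) : ℤ) :=
    Finset.single_le_sum (f := fun x => (Module.finrank ℂ (C1sp (Q := Q) α (Pi.single x 1)) : ℤ))
      (fun y _ => Int.natCast_nonneg _) (Finset.mem_univ x)
  have hcx : eul c (Pi.single x 1) = c x := by
    simp [eul, Pi.single_apply]
  have hS := simpleRep_mem hR x
  constructor
  · obtain ⟨γ₀, γ₁, P₀, P₁, h0, h1, hp0, hp1, ⟨S⟩, hc⟩ := h.exists_splitSeq
    have h2 := S.le_finrank_range_diff (simpleRep x)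
    have h3 := Submodule.finrank_le (LinearMap.range (S.diff (simpleRep x)))
    have h4 := homd_sub_homd_eq_eul hQ hR h0 h1 hp0 hp1 hc hS
    rw [hcx] at h4
    omega
  · have := good_rmod hS
    have h5 := h.eul_le hQ hR (RMod (simpleRep x))
    rw [dimV_rmod, hcx, homd_rmod] at h5
    have h6 : dimHom V (simpleRep x) ≤ Module.finrank ℂ (C0sp (Q := Q) α (Pi.single x 1)) :=
      Submodule.finrank_le _
    rw [finrank_C0sp] at h6
    simp [Pi.single_apply] at h6
    omega

end ResolutionMatrices

section LowerBound

set_option linter.unusedSectionVars false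

theorem eval_smul_of_isHomogeneous {σ : Type} [Fintype σ] {p : MvPolynomial σ ℂ} {k : ℕ}
    (hp : p.IsHomogeneous k) (t : ℂ) (w : σ → ℂ) :
    MvPolynomial.eval (t • w) p = t ^ k * MvPolynomial.eval w p := by
  rw [MvPolynomial.eval_eq', MvPolynomial.eval_eq', Finset.mul_sum]
  refine Finset.sum_congr rfl fun d hd => ?_
  have h : d.degree = k := by
    rw [Finsupp.degree_eq_weight_one]
    exact hp (MvPolynomial.mem_support_iff.1 hd)
  rw [Finsupp.degree_eq_sum] at h
  simp only [Pi.smul_apply, smul_eq_mul, mul_pow, Finset.prod_mul_distrib, Finset.prod_pow_eq_pow_sum, ← h]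
  ring

open Topology in
theorem mvPolynomial_eq_zero_of_curves {r : ℕ} {Z : Type} {T : Z → Fin r → ℂ} (hT : Function.Surjective T)
    (p : MvPolynomial (Fin r) ℂ)
    (h : ∀ z, ∃ w : ℂ → Fin r → ℂ, ContinuousAt w 0 ∧ w 0 = T z ∧
      ∀ᶠ t in 𝓝[≠] (0 : ℂ), MvPolynomial.eval (t • w t) p = 0) : p = 0 := by
  classical
  by_contra hp
  have hex : ∃ k, MvPolynomial.homogeneousComponent k p ≠ 0 := by
    by_contra! h0
    exact hp (by rw [← MvPolynomial.sum_homogeneousComponent p]; simp [h0])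
  set k := Nat.find hex
  have hk : MvPolynomial.homogeneousComponent k p ≠ 0 := Nat.find_spec hex
  have hlt : ∀ j < k, MvPolynomial.homogeneousComponent j p = 0 := fun j hj => by
    simpa using Nat.find_min hex hj
  refine hk (MvPolynomial.funext fun u => ?_)
  obtain ⟨z, rfl⟩ := hT u
  obtain ⟨w, hw, hwz, hev⟩ := h z
  rw [map_zero]
  set g : ℂ → ℂ := fun t => ∑ j ∈ Finset.range (p.totalDegree + 1),
    (if j < k then 0 else t ^ (j - k)) * MvPolynomial.eval (w t) (MvPolynomial.homogeneousComponent j p)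
  have hg : ContinuousAt g 0 := by
    refine tendsto_finsetSum _ fun j _ => ?_
    refine ContinuousAt.mul ?_ ?_
    · split_ifs
      · exact continuousAt_const
      · exact continuousAt_id.pow _
    · exact (MvPolynomial.continuous_eval _).continuousAt.comp hw
  have hg0 : ∀ᶠ t in 𝓝[≠] (0 : ℂ), g t = 0 := by
    filter_upwards [hev, self_mem_nhdsWithin] with t ht ht0
    have ht0' : t ≠ 0 := ht0
    have h1 : t ^ k * g t = MvPolynomial.eval (t • w t) p := by
      conv_rhs => rw [← MvPolynomial.sum_homogeneousComponent p]
      rw [map_sum, Finset.mul_sum]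
      refine Finset.sum_congr rfl fun j _ => ?_
      rw [eval_smul_of_isHomogeneous (MvPolynomial.homogeneousComponent_isHomogeneous j p)]
      split_ifs with hj
      · simp [hlt j hj]
      · rw [← mul_assoc, ← pow_add, Nat.add_sub_cancel' (not_lt.1 hj)]
    rw [ht] at h1
    exact (mul_eq_zero.1 h1).resolve_left (pow_ne_zero _ ht0')
  have h2 : g 0 = 0 := by
    have h3 : Filter.Tendsto g (𝓝[≠] 0) (𝓝 (g 0)) := hg.tendsto.mono_left nhdsWithin_le_nhds
    exact tendsto_nhds_unique h3 (tendsto_const_nhds.congr' (hg0.mono fun t ht => ht.symm))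
  have hmem : k ∈ Finset.range (p.totalDegree + 1) := by
    rw [Finset.mem_range]
    by_contra hcon
    exact hk (MvPolynomial.homogeneousComponent_eq_zero _ _ (by omega))
  rw [← h2, ← hwz]
  simp only [g]
  rw [Finset.sum_eq_single_of_mem k hmem]
  · simp
  · intro j _ hj
    rcases lt_or_gt_of_ne hj with hj | hj
    · simp [hj]
    · rw [if_neg (by omega), zero_pow (by omega), zero_mul]

variable {R : Set (FormalRel Q)} {α γ₀ γ₁ : Q.V → ℕ} {V : QRep Q α} {P₀ : QRep Q γ₀} {P₁ : QRep Q γ₁}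

namespace SplitSeq

/-- The endomorphism of the middle term attached to a perturbation of the inclusion. -/
def pert (S : SplitSeq P₁ P₀ V) : (HomS P₁ P₀ × C0sp (Q := Q) α α) →ₗ[ℂ] C0sp (Q := Q) γ₀ γ₀ where
  toFun z x := z.1.1 x * S.r x + S.s x * z.2 x * S.p x
  map_add' z w := by
    funext x
    simp only [Prod.fst_add, Prod.snd_add, Pi.add_apply, Submodule.coe_add, Matrix.mul_add, Matrix.add_mul]
    abel
  map_smul' k z := by
    funext x
    simp only [Prod.smul_fst, Prod.smul_snd, Pi.smul_apply, Submodule.coe_smul, Matrix.mul_smul,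
      Matrix.smul_mul, smul_add, RingHom.id_apply]

/-- The cokernel of the perturbed inclusion. -/
def defm (S : SplitSeq P₁ P₀ V) (v : C0sp (Q := Q) γ₀ γ₀) : QRep Q α := fun a =>
  S.p (Q.h a) * (v (Q.h a))⁻¹ * P₀ a * v (Q.t a) * S.s (Q.t a)

theorem pert_mul_f (S : SplitSeq P₁ P₀ V) (z : HomS P₁ P₀ × C0sp (Q := Q) α α) (x : Q.V) :
    S.pert z x * S.f x = z.1.1 x := by
  change (z.1.1 x * S.r x + S.s x * z.2 x * S.p x) * S.f x = _
  rw [Matrix.add_mul, Matrix.mul_assoc, S.rf, Matrix.mul_assoc _ _ (S.f x), S.pf, Matrix.mul_zero,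
    Matrix.mul_one, add_zero]

theorem p_mul_pert_mul_s (S : SplitSeq P₁ P₀ V) (z : HomS P₁ P₀ × C0sp (Q := Q) α α) (x : Q.V) :
    S.p x * S.pert z x * S.s x = z.2 x := by
  change S.p x * (z.1.1 x * S.r x + S.s x * z.2 x * S.p x) * S.s x = _
  rw [Matrix.mul_assoc, Matrix.add_mul, Matrix.mul_assoc, S.rs, Matrix.mul_zero, zero_add,
    Matrix.mul_assoc _ _ (S.s x), S.ps, Matrix.mul_one, ← Matrix.mul_assoc, S.ps, Matrix.one_mul]

theorem p_mul_pert (S : SplitSeq P₁ P₀ V) (z : HomS P₁ P₀ × C0sp (Q := Q) α α) (x : Q.V) :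
    S.p x * S.pert z x = S.p x * z.1.1 x * S.r x + z.2 x * S.p x := by
  change S.p x * (z.1.1 x * S.r x + S.s x * z.2 x * S.p x) = _
  rw [Matrix.mul_add, ← Matrix.mul_assoc, ← Matrix.mul_assoc, ← Matrix.mul_assoc, S.ps, Matrix.one_mul]

theorem one_add_pert_mul_f (S : SplitSeq P₁ P₀ V) (z : HomS P₁ P₀ × C0sp (Q := Q) α α) (x : Q.V) :
    (1 + S.pert z x) * S.f x = S.f x + z.1.1 x := by
  rw [Matrix.add_mul, pert_mul_f, Matrix.one_mul]

theorem one_add_pert_comm (S : SplitSeq P₁ P₀ V) (z : HomS P₁ P₀ × C0sp (Q := Q) α α) (a : Q.A) :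
    (1 + S.pert z (Q.h a)) * S.f (Q.h a) * P₁ a = P₀ a * ((1 + S.pert z (Q.t a)) * S.f (Q.t a)) := by
  have h : z.1.1 (Q.h a) * P₁ a = P₀ a * z.1.1 (Q.t a) := z.1.2 a
  rw [one_add_pert_mul_f S z (Q.h a), one_add_pert_mul_f S z (Q.t a), Matrix.add_mul, Matrix.mul_add, S.hf, h]

/-- The perturbed exact sequence. -/
def deform (S : SplitSeq P₁ P₀ V) (z : HomS P₁ P₀ × C0sp (Q := Q) α α)
    (hz : ∀ x, IsUnit (1 + S.pert z x).det) :
    SplitSeq P₁ P₀ (S.defm fun x => 1 + S.pert z x) where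
  f x := (1 + S.pert z x) * S.f x
  p x := S.p x * (1 + S.pert z x)⁻¹
  s x := (1 + S.pert z x) * S.s x
  r x := S.r x * (1 + S.pert z x)⁻¹
  hf a := S.one_add_pert_comm z a
  hp a := by
    have h1 := (S.one_add_pert_comm z a).symm
    have h2 : S.s (Q.t a) * S.p (Q.t a) = 1 - S.f (Q.t a) * S.r (Q.t a) := by rw [S.fr]; abel
    have h3 : S.p (Q.h a) * (1 + S.pert z (Q.h a))⁻¹ * P₀ a * (1 + S.pert z (Q.t a)) * S.f (Q.t a) = 0 := by
      rw [Matrix.mul_assoc, Matrix.mul_assoc, h1, Matrix.mul_assoc, ← Matrix.mul_assoc _ _ (P₁ a),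
        ← Matrix.mul_assoc _ _ (S.f _), Matrix.nonsing_inv_mul _ (hz _), Matrix.one_mul, ← Matrix.mul_assoc,
        S.pf, Matrix.zero_mul]
    rw [defm, ← Matrix.mul_assoc, Matrix.mul_assoc _ (S.s _), h2, Matrix.mul_sub, ← Matrix.mul_assoc _ (S.f _),
      h3, Matrix.zero_mul, sub_zero, Matrix.mul_one, Matrix.mul_assoc _ (1 + S.pert z (Q.t a)),
      Matrix.mul_nonsing_inv _ (hz _), Matrix.mul_one]
  ps x := by
    rw [Matrix.mul_assoc, ← Matrix.mul_assoc _ _ (S.s x), Matrix.nonsing_inv_mul _ (hz _), Matrix.one_mul, S.ps]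
  rf x := by
    rw [Matrix.mul_assoc, ← Matrix.mul_assoc _ _ (S.f x), Matrix.nonsing_inv_mul _ (hz _), Matrix.one_mul, S.rf]
  rs x := by
    rw [Matrix.mul_assoc, ← Matrix.mul_assoc _ _ (S.s x), Matrix.nonsing_inv_mul _ (hz _), Matrix.one_mul, S.rs]
  pf x := by
    rw [Matrix.mul_assoc, ← Matrix.mul_assoc _ _ (S.f x), Matrix.nonsing_inv_mul _ (hz _), Matrix.one_mul, S.pf]
  fr x := by
    rw [Matrix.mul_assoc, ← Matrix.mul_assoc (S.f x), S.fr, Matrix.sub_mul, Matrix.mul_sub, Matrix.one_mul,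
      Matrix.mul_nonsing_inv _ (hz _)]
    simp only [Matrix.mul_assoc]

/-- The difference quotient of the perturbed cokernel. -/
def slope (S : SplitSeq P₁ P₀ V) (y : C0sp (Q := Q) γ₀ γ₀) (t : ℂ) : C1sp (Q := Q) α α := fun a =>
  S.p (Q.h a) * (1 + t • y (Q.h a))⁻¹ * (P₀ a * y (Q.t a) - y (Q.h a) * P₀ a) * S.s (Q.t a)

theorem defm_eq_add_slope (S : SplitSeq P₁ P₀ V) (y : C0sp (Q := Q) γ₀ γ₀) (t : ℂ)
    (h : ∀ x, IsUnit (1 + t • y x).det) (a : Q.A) :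
    S.defm (fun x => 1 + t • y x) a = V a + t • S.slope y t a := by
  have hV : V a = S.p (Q.h a) * (1 + t • y (Q.h a))⁻¹ * ((1 + t • y (Q.h a)) * P₀ a) * S.s (Q.t a) := by
    rw [← Matrix.mul_assoc, Matrix.mul_assoc (S.p _), Matrix.nonsing_inv_mul _ (h _), Matrix.mul_one, S.hp,
      Matrix.mul_assoc, S.ps, Matrix.mul_one]
  rw [hV, slope, ← Matrix.smul_mul, ← Matrix.mul_smul, ← Matrix.add_mul, ← Matrix.mul_add, defm,
    Matrix.mul_assoc _ (P₀ a)]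
  congr 2
  rw [Matrix.mul_add, Matrix.add_mul, Matrix.mul_one, Matrix.one_mul, Matrix.mul_smul, Matrix.smul_mul,
    smul_sub]
  abel

/-- Composition with the projection. -/
def projHom (S : SplitSeq P₁ P₀ V) (ψ : HomS P₁ P₀) : HomS P₁ V :=
  ⟨fun x => S.p x * ψ.1 x, fun a => by
    have h : ψ.1 (Q.h a) * P₁ a = P₀ a * ψ.1 (Q.t a) := ψ.2 a
    rw [Matrix.mul_assoc, h, ← Matrix.mul_assoc, S.hp, Matrix.mul_assoc]⟩

theorem slope_zero (S : SplitSeq P₁ P₀ V) (z : HomS P₁ P₀ × C0sp (Q := Q) α α) :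
    S.slope (S.pert z) 0 = S.diff V (S.projHom z.1, z.2) := by
  funext a
  change S.p (Q.h a) * (1 + (0 : ℂ) • S.pert z (Q.h a))⁻¹ *
    (P₀ a * S.pert z (Q.t a) - S.pert z (Q.h a) * P₀ a) * S.s (Q.t a) =
    V a * z.2 (Q.t a) - z.2 (Q.h a) * V a - S.p (Q.h a) * z.1.1 (Q.h a) * (S.r (Q.h a) * P₀ a * S.s (Q.t a))
  rw [zero_smul, add_zero, inv_one, Matrix.mul_one, Matrix.mul_sub, ← Matrix.mul_assoc, S.hp,
    ← Matrix.mul_assoc, p_mul_pert, Matrix.sub_mul, Matrix.mul_assoc (V a), Matrix.mul_assoc (V a),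
    p_mul_pert_mul_s, Matrix.add_mul, Matrix.add_mul, Matrix.mul_assoc _ (S.p _), S.hp]
  have h : z.2 (Q.h a) * (V a * S.p (Q.t a)) * S.s (Q.t a) = z.2 (Q.h a) * V a := by
    rw [Matrix.mul_assoc, Matrix.mul_assoc, S.ps, Matrix.mul_one]
  rw [h]
  simp only [Matrix.mul_assoc]
  abel

theorem surjective_projHom (S : SplitSeq P₁ P₀ V) (h0 : P₀ ∈ modSet R γ₀) (hV : V ∈ modSet R α)
    (hp1 : ProjLift R (RMod P₁)) : Function.Surjective S.projHom := by
  intro ψ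
  have := good_rmod h0
  have := good_rmod hV
  obtain ⟨k, hk⟩ := hp1 _ _ (toHom ⟨S.p, S.hp⟩) ((surjective_toHom_iff _).2 S.surjective_p) (toHom ψ)
  refine ⟨ofHom k, Subtype.ext (funext fun x => ?_)⟩
  have h := ofHom_comp k (toHom ⟨S.p, S.hp⟩) x
  rw [hk, ofHom_toHom, ofHom_toHom] at h
  exact h.symm

theorem continuousAt_slope (S : SplitSeq P₁ P₀ V) (y : C0sp (Q := Q) γ₀ γ₀) (a : Q.A) (i j) :
    ContinuousAt (fun t => S.slope y t a i j) 0 := by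
  have h1 : Continuous fun t : ℂ => 1 + t • y (Q.h a) := by fun_prop
  have h2 : ContinuousAt (fun t : ℂ => (1 + t • y (Q.h a))⁻¹) 0 := by
    simp only [Matrix.inv_def, Ring.inverse_eq_inv']
    refine ContinuousAt.smul (ContinuousAt.inv₀ h1.matrix_det.continuousAt (by simp)) ?_
    exact h1.matrix_adjugate.continuousAt
  have h3 : Continuous fun X : Matrix (Fin (γ₀ (Q.h a))) (Fin (γ₀ (Q.h a))) ℂ =>
      (S.p (Q.h a) * X * (P₀ a * y (Q.t a) - y (Q.h a) * P₀ a) * S.s (Q.t a)) i j := by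
    refine Continuous.matrix_elem ?_ i j
    exact ((continuous_const.matrix_mul continuous_id).matrix_mul continuous_const).matrix_mul
      continuous_const
  exact h3.continuousAt.comp h2

end SplitSeq

theorem HasRes.le_zdim_Cset [Fintype Q.A] (hQ : QAcyclic Q) (hR : AdmissibleRels R) {c : Q.V → ℤ}
    (h : HasRes R (RMod V) c) :
    ∃ N : ℕ, (N : WithBot ℕ∞) ≤ zdim (Cset R α) ∧ ((∑ x, α x ^ 2 : ℕ) : ℤ) - eul c α ≤ N := by
  have := h.good
  have hV : V ∈ modSet R α := mem_modSet_of_good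
  obtain ⟨γ₀, γ₁, P₀, P₁, h0, h1, hp0, hp1, ⟨S⟩, hc⟩ := h.exists_splitSeq
  have hfr := S.le_finrank_range_diff V
  have heul := homd_sub_homd_eq_eul hQ hR h0 h1 hp0 hp1 hc hV
  refine ⟨Module.finrank ℂ (LinearMap.range (S.diff V)), ?_, ?_⟩
  swap
  · simp only [sq]
    omega
  obtain ⟨l, hl, -⟩ := exists_linear_section (LinearMap.range (S.diff V))
  have hls : Function.Surjective fun z : HomS P₁ P₀ × C0sp (Q := Q) α α =>
      l (S.diff V (S.projHom z.1, z.2)) := by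
    have hinj : Function.Injective (l.domRestrict (LinearMap.range (S.diff V))) := by
      intro u w huw
      have h3 : l (u.1 - w.1) = 0 := by
        rw [map_sub, sub_eq_zero]
        exact huw
      exact Subtype.ext (sub_eq_zero.1 (hl _ (Submodule.sub_mem _ u.2 w.2) h3))
    have hsurj := (LinearMap.injective_iff_surjective_of_finrank_eq_finrank
      (f := l.domRestrict (LinearMap.range (S.diff V))) (by simp)).1 hinj
    intro u
    obtain ⟨⟨_, ⟨ψ, b⟩, rfl⟩, hu⟩ := hsurj u
    obtain ⟨ψ, rfl⟩ := S.surjective_projHom h0 hV hp1 ψ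
    exact ⟨(ψ, b), hu⟩
  set D : HomS P₁ P₀ × C0sp (Q := Q) α α → ℂ := fun z => ∏ x, (1 + S.pert z x).det
  have hunit : ∀ z, D z ≠ 0 → ∀ x, IsUnit (1 + S.pert z x).det := fun z hz x =>
    isUnit_iff_ne_zero.2 (Finset.prod_ne_zero_iff.1 hz x (Finset.mem_univ x))
  have hA : ∀ x i j, LinePoly fun z => (1 + S.pert z x) i j := fun x i j =>
    (LinePoly.const ((1 : Matrix (Fin (γ₀ x)) (Fin (γ₀ x)) ℂ) i j)).add
      (LinePoly.linear ((Matrix.entryLinearMap ℂ ℂ i j) ∘ₗ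
        (LinearMap.proj x : C0sp (Q := Q) γ₀ γ₀ →ₗ[ℂ] _) ∘ₗ S.pert))
  have hD : LinePoly D := LinePoly.prod _ fun x _ => LinePoly.det (hA x)
  have hD0 : D 0 ≠ 0 := by simp [D]
  set F : HomS P₁ P₀ × C0sp (Q := Q) α α → QRep Q α := fun z => S.defm fun x => 1 + S.pert z x
  have hF : ∀ k : RepCoord (Q := Q) α, LineRat D fun z => repCoords (F z) k := by
    rintro ⟨a, i, j⟩
    have hc : ∀ {m n : ℕ} (X : Matrix (Fin m) (Fin n) ℂ) i j, LineRat D fun _ => X i j :=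
      fun X i j => LineRat.of_linePoly (LinePoly.const _)
    refine LineRat.matrix_mul hD (LineRat.matrix_mul hD (LineRat.matrix_mul hD (LineRat.matrix_mul hD (hc _)
      ?_) (hc _)) fun i j => LineRat.of_linePoly (hA _ i j)) (hc _) i j
    refine fun i j => LineRat.matrix_inv (G := fun z => ∏ x ∈ Finset.univ.erase (Q.h a), (1 + S.pert z x).det)
      (hA _) (LinePoly.prod _ fun x _ => LinePoly.det (hA x)) (fun z => ?_) i j
    exact (Finset.prod_erase_mul _ _ (Finset.mem_univ (Q.h a))).symm
  rw [zdim_eq_coordDim]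
  have hlin : ∀ i, ∃ q : MvPolynomial (RepCoord (Q := Q) α) ℂ, ∀ W : QRep Q α,
      MvPolynomial.eval (repCoords W) q = l (fun a => W a - V a) i := by
    intro i
    let u : (RepCoord (Q := Q) α → ℂ) →ₗ[ℂ] C1sp (Q := Q) α α :=
      { toFun := fun w a => Matrix.of fun i j => w ⟨a, i, j⟩
        map_add' := fun _ _ => rfl
        map_smul' := fun _ _ => rfl }
    obtain ⟨q, hq⟩ := ((PolyFn.linear (LinearMap.proj i ∘ₗ l ∘ₗ u)).add (PolyFn.const (-(l V i))))
    refine ⟨q, fun W => ?_⟩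
    rw [← hq]
    have h4 : l (fun a => W a - V a) = l W - l V :=
      map_sub l (show C1sp (Q := Q) α α from W) (show C1sp (Q := Q) α α from V)
    rw [h4, Pi.sub_apply, sub_eq_add_neg]
    rfl
  choose y hy using hlin
  refine le_coordDim_of_dominant _ {w | ∃ z, D z ≠ 0 ∧ repCoords (F z) = w} ?_ ?_ y ?_
  · rw [isIrreducible_coordTop_iff]
    refine ⟨⟨_, 0, hD0, rfl⟩, fun p q hpq => ?_⟩
    obtain ⟨kp, Fp, hFp, hFp'⟩ := LineRat.eval_mvPolynomial hD hF p
    obtain ⟨kq, Fq, hFq, hFq'⟩ := LineRat.eval_mvPolynomial hD hF q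
    by_contra! hcon
    obtain ⟨⟨_, ⟨z, hz, rfl⟩, hpz⟩, ⟨_, ⟨z', hz', rfl⟩, hqz⟩⟩ := hcon
    have hp : Fp z * D z ≠ 0 := by
      rw [hFp' z hz]
      exact mul_ne_zero (mul_ne_zero (pow_ne_zero _ hz) hpz) hz
    have hq : Fq z' ≠ 0 := by
      rw [hFq' z' hz']
      exact mul_ne_zero (pow_ne_zero _ hz') hqz
    obtain ⟨t, ht1, ht2⟩ := (hFp.mul hD).exists_mul_ne_zero hFq hp hq
    have ht3 := right_ne_zero_of_mul ht1
    have ht1 := left_ne_zero_of_mul ht1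
    have h5 := hpq _ ⟨_, ht3, rfl⟩
    rw [hFp' _ ht3] at ht1
    rw [hFq' _ ht3] at ht2
    rw [map_mul] at h5
    exact mul_ne_zero (right_ne_zero_of_mul ht1) (right_ne_zero_of_mul ht2) h5
  · intro w hw
    let W : QRep Q α := fun a => Matrix.of fun i j => w ⟨a, i, j⟩
    have hW : repCoords W = w := rfl
    refine ⟨⟨W, ?_⟩, hW⟩
    refine mem_zclosure_iff.2 fun p hp => ?_
    rw [hW]
    refine hw p ?_
    rintro _ ⟨z, hz, rfl⟩
    obtain ⟨c', hc'⟩ := (S.deform z (hunit z hz)).hasRes h0 h1 hp0 hp1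
    exact hp _ hc'.mem_PAset
  · intro p hp
    refine mvPolynomial_eq_zero_of_curves hls p fun z => ?_
    refine ⟨fun t => l (S.slope (S.pert z) t), ?_, ?_, ?_⟩
    · have h6 : Continuous l := l.continuous_of_finiteDimensional
      refine h6.continuousAt.comp ?_
      refine continuousAt_pi.2 fun a => ?_
      exact continuousAt_pi.2 fun i => continuousAt_pi.2 fun j => S.continuousAt_slope _ a i j
    · beta_reduce
      rw [S.slope_zero]
    · have h7 : ∀ᶠ t in nhds (0 : ℂ), D (t • z) ≠ 0 := by
        obtain ⟨q, hq⟩ := hD 0 z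
        simp only [zero_add] at hq
        simp only [hq]
        refine q.continuous.continuousAt.eventually_ne ?_
        rw [← hq]
        simpa using hD0
      filter_upwards [h7.filter_mono nhdsWithin_le_nhds] with t ht
      have h8 := hp _ ⟨t • z, ht, rfl⟩
      have h9 : F (t • z) = fun a => V a + t • S.slope (S.pert z) t a := by
        have hu := hunit _ ht
        have h10 : S.pert (t • z) = t • S.pert z := map_smul S.pert t z
        simp only [h10, Pi.smul_apply] at hu
        funext a
        simp only [F, h10]
        exact S.defm_eq_add_slope _ t hu a
      rw [← h8]
      refine congrArg (fun u => MvPolynomial.eval u p) (funext fun i => ?_)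
      rw [hy, h9]
      simp only [add_sub_cancel_left]
      have h11 : l (fun a => t • S.slope (S.pert z) t a) = t • l (S.slope (S.pert z) t) :=
        map_smul l t (S.slope (S.pert z) t)
      rw [h11]

end LowerBound

section Glue

variable {α γ : Q.V → ℕ}

theorem RIso.nonempty_equiv {V : QRep Q α} {W : QRep Q γ} (h : RIso V W) :
    Nonempty (RMod V ≃ₗ[Aq Q] RMod W) := by
  obtain ⟨u, hu⟩ := h
  have hmv : ∀ x v, LinearMap.toMatrix' (u x).toLinearMap *ᵥ v = u x v := fun x v => by
    rw [← Matrix.toLin'_apply, Matrix.toLin'_toMatrix']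
    rfl
  have hφ : (fun x => LinearMap.toMatrix' (u x).toLinearMap : C0sp (Q := Q) α γ) ∈ HomS V W := by
    intro a
    refine Matrix.ext_of_mulVec_single fun i => ?_
    rw [← Matrix.mulVec_mulVec, ← Matrix.mulVec_mulVec, hmv, hmv]
    exact LinearMap.congr_fun (hu a) _
  refine ⟨LinearEquiv.ofBijective (toHom ⟨_, hφ⟩) ⟨?_, ?_⟩⟩
  · rw [injective_toHom_iff]
    intro x v w hvw
    simpa [hmv] using hvw
  · rw [surjective_toHom_iff]
    intro x v
    exact ⟨(u x).symm v, by simp [hmv]⟩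

theorem exists_gAct_eq_of_equiv {V W : QRep Q α} (e : RMod V ≃ₗ[Aq Q] RMod W) :
    ∃ g : GLb α, gAct g V = W := by
  have h1 : ∀ x, (ofHom e.symm.toLinearMap).1 x * (ofHom e.toLinearMap).1 x = 1 := by
    intro x
    rw [← ofHom_comp]
    refine Matrix.ext_of_mulVec_single fun i => ?_
    rw [ofHom_mulVec]
    rw [Matrix.one_mulVec]
    simp
  have hd : ∀ x, ((ofHom e.toLinearMap).1 x).det ≠ 0 := by
    intro x h0
    have := congrArg Matrix.det (h1 x)
    rw [Matrix.det_mul, h0] at this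
    simp at this
  obtain ⟨g, hg⟩ := exists_gAct_eq_actM (Q := Q) hd
  exact ⟨g, by rw [hg, actM_eq_of_mem (ofHom e.toLinearMap).2 hd]⟩

theorem nonempty_equiv_gAct (g : GLb α) (V : QRep Q α) : Nonempty (RMod V ≃ₗ[Aq Q] RMod (gAct g V)) := by
  have hφ : (fun x => (g x).val : C0sp (Q := Q) α α) ∈ HomS V (gAct g V) := by
    intro a
    change (g (Q.h a)).val * V a = gAct g V a * (g (Q.t a)).val
    simp only [gAct, Matrix.mul_assoc]
    have : (g (Q.t a))⁻¹.val * (g (Q.t a)).val = 1 := by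
      rw [← Units.val_mul, inv_mul_cancel]
      rfl
    rw [this]
    exact congrArg _ (Matrix.mul_one _).symm
  refine ⟨LinearEquiv.ofBijective (toHom ⟨_, hφ⟩) ⟨?_, ?_⟩⟩
  · rw [injective_toHom_iff]
    exact fun x => Matrix.mulVec_injective_iff_isUnit.2 (g x).isUnit
  · rw [surjective_toHom_iff]
    exact fun x => Matrix.mulVec_surjective_iff_isUnit.2 (g x).isUnit

theorem nonempty_equiv_iff {V W : QRep Q α} :
    Nonempty (RMod V ≃ₗ[Aq Q] RMod W) ↔ ∃ g : GLb α, gAct g V = W := by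
  constructor
  · rintro ⟨e⟩
    exact exists_gAct_eq_of_equiv e
  · rintro ⟨g, rfl⟩
    exact nonempty_equiv_gAct g V

theorem PAset.of_equiv {R : Set (FormalRel Q)} {V : QRep Q α} {W : QRep Q γ} (hV : V ∈ PAset R α)
    (e : RMod V ≃ₗ[Aq Q] RMod W) : W ∈ PAset R γ := by
  obtain ⟨c, hc⟩ := exists_hasRes_of_mem_PAset hV
  exact (hc.of_equiv e).mem_PAset

variable (Q) in
/-- Indecomposable modules. -/
def Indec (M : Type) [AddCommGroup M] [Module ℂ M] [Module (Aq Q) M] [IsScalarTower ℂ (Aq Q) M] : Prop :=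
  Nontrivial M ∧ ∀ e : M →ₗ[Aq Q] M, e ∘ₗ e = e → e = 0 ∨ e = LinearMap.id

theorem Indec.of_equiv {M N : Type} [AddCommGroup M] [Module ℂ M] [Module (Aq Q) M]
    [IsScalarTower ℂ (Aq Q) M] [AddCommGroup N] [Module ℂ N] [Module (Aq Q) N]
    [IsScalarTower ℂ (Aq Q) N] (h : Indec Q M) (f : M ≃ₗ[Aq Q] N) : Indec Q N := by
  have := h.1
  refine ⟨f.symm.toEquiv.nontrivial, fun e he => ?_⟩
  have he' : ∀ n, e (e n) = e n := fun n => LinearMap.congr_fun he n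
  rcases h.2 (f.symm.toLinearMap ∘ₗ e ∘ₗ f.toLinearMap) (LinearMap.ext fun m => by simp [he']) with h | h
  · left
    ext n
    simpa using LinearMap.congr_fun h (f.symm n)
  · right
    ext n
    have := LinearMap.congr_fun h (f.symm n)
    simpa using this

theorem isIndecRep_iff {V : QRep Q α} : IsIndecRep V ↔ Indec Q (RMod V) := by
  refine and_congr ?_ ⟨fun h e he => ?_, fun h φ hφ hi => ?_⟩
  · constructor
    · rintro ⟨x, hx⟩
      refine ⟨⟨rsingle V x (Pi.single ⟨0, Nat.pos_of_ne_zero hx⟩ 1), 0, fun h => ?_⟩⟩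
      have := congrFun (congrArg (rproj V x) h) ⟨0, Nat.pos_of_ne_zero hx⟩
      simp at this
    · intro h
      by_contra! h0
      obtain ⟨v, w, hvw⟩ := h
      refine hvw (rmod_ext V fun x => funext fun k => ?_)
      exact absurd k.2 (by simp [h0 x])
  · rcases h (ofHom e).1 (ofHom e).2 (fun x => by rw [← ofHom_comp, he]) with h0 | h0
    · left
      rw [← toHom_ofHom e]
      refine LinearMap.ext fun v => rmod_ext V fun x => ?_
      rw [rproj_toHom, h0]
      simp
    · right
      rw [← toHom_ofHom e]
      refine LinearMap.ext fun v => rmod_ext V fun x => ?_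
      rw [rproj_toHom, h0]
      simp
  · have := h (toHom ⟨φ, hφ⟩) (toHom_comp _ _ _ hi)
    rcases this with h0 | h0
    · left
      have h1 := congrArg (fun z => (ofHom z).1) h0
      simp only [ofHom_toHom] at h1
      rw [h1]
      funext x
      refine Matrix.ext_of_mulVec_single fun i => ?_
      rw [ofHom_mulVec]
      exact (map_zero (rproj V x)).trans (Matrix.zero_mulVec _).symm
    · right
      have h1 := congrArg (fun z => (ofHom z).1) h0
      simp only [ofHom_toHom] at h1
      rw [h1]
      funext x
      refine Matrix.ext_of_mulVec_single fun i => ?_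
      rw [ofHom_mulVec]
      exact (rproj_rsingle_same V x _).trans (Matrix.one_mulVec _).symm

variable {ι : Type} [Fintype ι] [DecidableEq ι] {αs : ι → Q.V → ℕ}

theorem IsSumOf.nonempty_equiv {W : QRep Q γ} {V : ∀ i, QRep Q (αs i)} (h : IsSumOf W V) :
    Nonempty (RMod W ≃ₗ[Aq Q] (∀ i, RMod (V i))) := by
  obtain ⟨u, hu⟩ := h
  let f : RMod W →ₗ[ℂ] (∀ i, RMod (V i)) :=
    { toFun := fun v i => rmk (V i) fun x k => u x (rproj W x v) ⟨i, k⟩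
      map_add' := fun v w => by
        funext i
        refine rmod_ext _ fun x => funext fun k => ?_
        simp [rproj_rmk]
      map_smul' := fun c v => by
        funext i
        refine rmod_ext _ fun x => funext fun k => ?_
        simp [rproj_rmk] }
  have hf : ∀ v i x k, rproj (V i) x (f v i) k = u x (rproj W x v) ⟨i, k⟩ := fun v i x k => rfl
  have hv : ∀ (x : Q.V) m, f ((vtx x : Aq Q) • m) = (vtx x : Aq Q) • f m := by
    intro x m
    funext i
    refine rmod_ext _ fun y => funext fun k => ?_
    rw [Pi.smul_apply, vtx_smul, vtx_smul, hf]
    by_cases hy : y = x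
    · subst hy
      rw [rproj_rsingle_same, rproj_rsingle_same, hf]
    · rw [rproj_rsingle_ne _ hy, rproj_rsingle_ne _ hy]
      simp
  have ha : ∀ (a : Q.A) m, f ((arr a : Aq Q) • m) = (arr a : Aq Q) • f m := by
    intro a m
    funext i
    refine rmod_ext _ fun y => funext fun k => ?_
    rw [Pi.smul_apply, arr_smul, arr_smul, hf]
    by_cases hy : y = Q.h a
    · subst hy
      rw [rproj_rsingle_same, rproj_rsingle_same]
      have := LinearMap.congr_fun (hu a) (rproj W (Q.t a) m)
      simp only [LinearMap.comp_apply, LinearEquiv.coe_coe, Matrix.mulVecLin_apply] at this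
      rw [this, Matrix.mulVec, dotProduct, Fintype.sum_sigma, Finset.sum_eq_single i]
      · simp only [Matrix.blockDiagonal'_apply_eq, Matrix.mulVec, dotProduct]
        rfl
      · intro j _ hj
        refine Finset.sum_eq_zero fun k' _ => ?_
        rw [Matrix.blockDiagonal'_apply_ne _ _ _ hj.symm, zero_mul]
      · simp
    · rw [rproj_rsingle_ne _ hy, rproj_rsingle_ne _ hy]
      simp
  refine ⟨LinearEquiv.ofBijective (mkAq f hv ha) ⟨fun v w hvw => ?_, fun w => ?_⟩⟩
  · refine rmod_ext W fun x => (u x).injective (funext fun ⟨i, k⟩ => ?_)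
    rw [← hf, ← hf]
    exact congrFun (congrArg (rproj (V i) x) (congrFun hvw i)) k
  · refine ⟨rmk W fun x => (u x).symm fun s => rproj (V s.1) x (w s.1) s.2, ?_⟩
    funext i
    refine rmod_ext _ fun x => funext fun k => ?_
    rw [mkAq_apply, hf, rproj_rmk, LinearEquiv.apply_symm_apply]

end Glue

section SumRep

variable {l : ℕ} {αs : Fin l → Q.V → ℕ}

/-- The direct sum of representations. -/
def sumRep (V : ∀ i, QRep Q (αs i)) : QRep Q (fun x => ∑ i, αs i x) := fun a =>
  Matrix.reindex (finSigmaFinEquiv (n := fun i => αs i (Q.h a)))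
    (finSigmaFinEquiv (n := fun i => αs i (Q.t a))) (Matrix.blockDiagonal' fun i => V i a)

theorem isSumOf_sumRep (V : ∀ i, QRep Q (αs i)) : IsSumOf (sumRep V) V := by
  refine ⟨fun x => LinearEquiv.funCongrLeft ℂ ℂ (finSigmaFinEquiv (n := fun i => αs i x)), fun a => ?_⟩
  refine LinearMap.ext fun v => funext fun s => ?_
  simp only [LinearMap.comp_apply, LinearEquiv.coe_coe, LinearEquiv.funCongrLeft_apply,
    LinearMap.funLeft_apply, Matrix.mulVecLin_apply, Matrix.mulVec, dotProduct, sumRep,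
    Matrix.reindex_apply, Matrix.submatrix_apply, Equiv.symm_apply_apply]
  exact (Equiv.sum_comp (finSigmaFinEquiv (n := fun i => αs i (Q.t a))) _).symm.trans
    (Finset.sum_congr rfl fun t _ => by simp)

/-- The module of a direct sum. -/
def sumRepEquiv (V : ∀ i, QRep Q (αs i)) : RMod (sumRep V) ≃ₗ[Aq Q] (∀ i, RMod (V i)) :=
  (isSumOf_sumRep V).nonempty_equiv.some

theorem repCoords_sumRep (c : RepCoord (Q := Q) (fun x => ∑ i, αs i x)) :
    (∀ V : ∀ i, QRep Q (αs i), repCoords (sumRep V) c = 0) ∨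
      ∃ i c', ∀ V : ∀ i, QRep Q (αs i), repCoords (sumRep V) c = repCoords (V i) c' := by
  obtain ⟨a, j, k⟩ := c
  obtain ⟨⟨i, j⟩, rfl⟩ := (finSigmaFinEquiv (n := fun i => αs i (Q.h a))).surjective j
  obtain ⟨⟨i', k⟩, rfl⟩ := (finSigmaFinEquiv (n := fun i => αs i (Q.t a))).surjective k
  by_cases h : i = i'
  · subst h
    refine Or.inr ⟨i, ⟨a, j, k⟩, fun V => ?_⟩
    simp only [repCoords, sumRep, Matrix.reindex_apply, Matrix.submatrix_apply, Equiv.symm_apply_apply,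
      Matrix.blockDiagonal'_apply_eq]
  · refine Or.inl fun V => ?_
    simp only [repCoords, sumRep, Matrix.reindex_apply, Matrix.submatrix_apply, Equiv.symm_apply_apply,
      Matrix.blockDiagonal'_apply_ne _ _ _ h]

theorem IsSumOf.exists_gAct {W : QRep Q (fun x => ∑ i, αs i x)} {V : ∀ i, QRep Q (αs i)}
    (h : IsSumOf W V) : ∃ g, gAct g (sumRep V) = W :=
  exists_gAct_eq_of_equiv ((sumRepEquiv V).trans h.nonempty_equiv.some.symm)

end SumRep

section HaradaSai

set_option linter.unusedSectionVars false

variable {ι : Type} {M : ι → Type} [∀ i, AddCommGroup (M i)] [∀ i, Module ℂ (M i)]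
  [∀ i, Module (Aq Q) (M i)] [∀ i, IsScalarTower ℂ (Aq Q) (M i)]

variable (Q M) in
/-- Composites of `n` non-isomorphisms between members of a family of modules. -/
inductive Chain : ℕ → ∀ i j, (M i →ₗ[Aq Q] M j) → Prop
  | id (i) : Chain 0 i i LinearMap.id
  | comp {n : ℕ} {i j k} {h : M i →ₗ[Aq Q] M j} {g : M j →ₗ[Aq Q] M k} (hh : ¬Function.Bijective h)
      (hg : Chain n j k g) : Chain (n + 1) i k (g ∘ₗ h)

theorem Chain.comp_right {n : ℕ} {i j k : ι} {g : M i →ₗ[Aq Q] M j} (hg : Chain Q M n i j g)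
    {h : M j →ₗ[Aq Q] M k} (hh : ¬Function.Bijective h) : Chain Q M (n + 1) i k (h ∘ₗ g) := by
  induction hg with
  | id i =>
    have := (Chain.id k).comp hh
    rwa [LinearMap.id_comp] at this
  | comp hh' _ ih =>
    rw [← LinearMap.comp_assoc]
    exact (ih hh).comp hh'

theorem Chain.split (m : ℕ) {n : ℕ} {i k : ι} {f : M i →ₗ[Aq Q] M k} (hf : Chain Q M (n + m) i k f) :
    ∃ (j : ι) (g : M i →ₗ[Aq Q] M j) (h : M j →ₗ[Aq Q] M k), Chain Q M m i j g ∧ Chain Q M n j k h ∧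
      f = h ∘ₗ g := by
  induction m generalizing i with
  | zero => exact ⟨i, LinearMap.id, f, Chain.id i, hf, rfl⟩
  | succ m ih =>
    rw [← add_assoc] at hf
    cases hf with
    | comp hh hg =>
      obtain ⟨j, g, h, hg', hh', rfl⟩ := ih hg
      exact ⟨j, _, h, Chain.comp hh hg', hh', LinearMap.comp_assoc _ _ _⟩

theorem Indec.eq_bot_or_eq_bot {N : Type} [AddCommGroup N] [Module ℂ N] [Module (Aq Q) N]
    [IsScalarTower ℂ (Aq Q) N] (h : Indec Q N) {A B : Submodule (Aq Q) N} (hAB : IsCompl A B) :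
    A = ⊥ ∨ B = ⊥ := by
  rcases h.2 (A.projection B hAB) (Submodule.isIdempotentElem_projection hAB) with h0 | h0
  · left
    have := Submodule.range_projection hAB
    rw [h0, LinearMap.range_zero] at this
    exact this.symm
  · right
    have := Submodule.ker_projection hAB
    rw [h0, LinearMap.ker_id] at this
    exact this.symm

/-- The dimension of the image of a homomorphism. -/
def rkd {N P : Type} [AddCommGroup N] [Module ℂ N] [Module (Aq Q) N] [IsScalarTower ℂ (Aq Q) N]
    [AddCommGroup P] [Module ℂ P] [Module (Aq Q) P] [IsScalarTower ℂ (Aq Q) P] (f : N →ₗ[Aq Q] P) : ℕ :=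
  Module.finrank ℂ (LinearMap.range (f.restrictScalars ℂ))

theorem Chain.rkd_le {d : ℕ} [∀ i, FiniteDimensional ℂ (M i)] (hd : ∀ i, Module.finrank ℂ (M i) = d)
    (hM : ∀ i, Indec Q (M i)) (m : ℕ) {i j : ι} {f : M i →ₗ[Aq Q] M j}
    (hf : Chain Q M (2 ^ m - 1) i j f) : rkd f ≤ d - m := by
  induction m generalizing i j with
  | zero =>
    rw [← hd j]
    exact Submodule.finrank_le _
  | succ m ih =>
    have hpow : 2 ^ (m + 1) - 1 = (2 ^ m - 1) + 1 + (2 ^ m - 1) := by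
      have := Nat.one_le_two_pow (n := m)
      omega
    rw [hpow] at hf
    obtain ⟨k, g, p, hg, hp, rfl⟩ := hf.split
    cases hp with
    | @comp _ _ k' _ h g' hh hg' =>
      by_contra! hlt
      have h1 := ih hg
      have h2 := ih hg'
      set p := (g' ∘ₗ h).restrictScalars ℂ
      set G := g.restrictScalars ℂ
      have hle : rkd ((g' ∘ₗ h) ∘ₗ g) ≤ rkd g := by
        rw [rkd, rkd]
        change Module.finrank ℂ (LinearMap.range (p ∘ₗ G)) ≤ _
        rw [LinearMap.range_comp]
        exact Submodule.finrank_map_le _ _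
      have hle' : Module.finrank ℂ (LinearMap.range p) ≤ rkd g' := by
        rw [rkd]
        change Module.finrank ℂ (LinearMap.range (g'.restrictScalars ℂ ∘ₗ h.restrictScalars ℂ)) ≤ _
        exact Submodule.finrank_mono (LinearMap.range_comp_le_range _ _)
      have hle'' : rkd ((g' ∘ₗ h) ∘ₗ g) ≤ Module.finrank ℂ (LinearMap.range p) :=
        Submodule.finrank_mono (LinearMap.range_comp_le_range G p)
      have hker := LinearMap.finrank_range_add_finrank_ker p
      rw [hd] at hker
      have hinj : LinearMap.range G ⊓ LinearMap.ker p = ⊥ := by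
        have h3 : LinearMap.ker (p.domRestrict (LinearMap.range G)) = ⊥ := by
          refine Submodule.finrank_eq_zero.1 ?_
          have := LinearMap.finrank_range_add_finrank_ker (p.domRestrict (LinearMap.range G))
          rw [LinearMap.range_domRestrict, ← LinearMap.range_comp] at this
          change rkd ((g' ∘ₗ h) ∘ₗ g) + _ = rkd g at this
          omega
        rw [← le_bot_iff]
        rintro x ⟨hx, hx'⟩
        have := LinearMap.ker_eq_bot'.1 h3 ⟨x, hx⟩ hx'
        simpa using this
      have hsup := Submodule.finrank_sup_add_finrank_inf_eq (LinearMap.range G) (LinearMap.ker p)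
      rw [hinj, finrank_bot] at hsup
      have htop : LinearMap.range G ⊔ LinearMap.ker p = ⊤ := by
        refine Submodule.eq_top_of_finrank_eq ?_
        rw [hd]
        have : rkd g = Module.finrank ℂ (LinearMap.range G) := rfl
        omega
      have hc : IsCompl (LinearMap.range g) (LinearMap.ker (g' ∘ₗ h)) := by
        refine ⟨disjoint_iff.2 ?_, codisjoint_iff.2 ?_⟩
        · rw [eq_bot_iff]
          intro x hx
          exact (Submodule.ext_iff.1 hinj x).1 hx
        · rw [eq_top_iff]
          intro x _
          obtain ⟨y, hy, z, hz, rfl⟩ := Submodule.mem_sup.1 ((Submodule.ext_iff.1 htop x).2 trivial)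
          exact Submodule.add_mem_sup hy hz
      rcases (hM k).eq_bot_or_eq_bot hc with h0 | h0
      · have : rkd g = 0 := by
          rw [rkd, Submodule.finrank_eq_zero, eq_bot_iff]
          intro x hx
          exact (Submodule.ext_iff.1 h0 x).1 hx
        omega
      · have hi : Function.Injective (h.restrictScalars ℂ) := by
          have := LinearMap.ker_eq_bot.1 h0
          exact Function.Injective.of_comp this
        exact hh ⟨hi, (LinearMap.injective_iff_surjective_of_finrank_eq_finrank (by rw [hd, hd])).1 hi⟩

theorem exists_chain_eq_zero {d : ℕ} [∀ i, FiniteDimensional ℂ (M i)]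
    (hd : ∀ i, Module.finrank ℂ (M i) = d) (hM : ∀ i, Indec Q (M i)) :
    ∃ n, ∀ (i j : ι) (f : M i →ₗ[Aq Q] M j), Chain Q M n i j f → f = 0 := by
  refine ⟨2 ^ d - 1, fun i j f hf => ?_⟩
  have h := hf.rkd_le hd hM
  rw [Nat.sub_self, Nat.le_zero, rkd, Submodule.finrank_eq_zero, LinearMap.range_eq_bot] at h
  ext x
  exact LinearMap.congr_fun h x

end HaradaSai

section IndecQuotient

set_option linter.unusedSectionVars false

variable {R : Set (FormalRel Q)}

theorem exists_not_bijective_sub_smul {M : Type} [AddCommGroup M] [Module ℂ M] [Module (Aq Q) M]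
    [IsScalarTower ℂ (Aq Q) M] [FiniteDimensional ℂ M] [Nontrivial M] (f : M →ₗ[Aq Q] M) :
    ∃ c : ℂ, ¬Function.Bijective (f - c • (LinearMap.id : M →ₗ[Aq Q] M)) := by
  obtain ⟨c, hc⟩ := Module.End.exists_eigenvalue (f.restrictScalars ℂ : Module.End ℂ M)
  obtain ⟨v, hv⟩ := hc.exists_hasEigenvector
  refine ⟨c, fun hb => hv.2 (hb.1 ?_)⟩
  have h : f v = c • v := hv.apply_eq_smul
  simp [h]

theorem eq_zero_or_eq_id_of_isNilpotent {M : Type} [AddCommGroup M] [Module ℂ M] [Module (Aq Q) M]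
    [IsScalarTower ℂ (Aq Q) M] {e : Module.End (Aq Q) M} (he : e * e = e) {c : ℂ}
    (hc : IsNilpotent (e - c • 1)) : e = 0 ∨ e = 1 := by
  by_cases h0 : c = 0
  · left
    subst h0
    obtain ⟨n, hn⟩ := hc
    rw [zero_smul, sub_zero] at hn
    have he' : IsIdempotentElem e := he
    rw [← he'.pow_succ_eq n, pow_succ, hn, zero_mul]
  · right
    have hu : IsUnit (c • (1 : Module.End (Aq Q) M)) :=
      ⟨⟨c • 1, c⁻¹ • 1, by simp [smul_smul, h0], by simp [smul_smul, h0]⟩, rfl⟩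
    have hcomm : Commute (e - c • 1) (c • (1 : Module.End (Aq Q) M)) :=
      (Commute.one_right _).smul_right c
    have h1 := hc.isUnit_add_left_of_commute hu hcomm
    rw [add_sub_cancel] at h1
    exact h1.mul_left_cancel (by rw [he, mul_one])

variable {κ : Type} [Fintype κ] [DecidableEq κ] {M : κ → Type} [∀ i, AddCommGroup (M i)]
  [∀ i, Module ℂ (M i)] [∀ i, Module (Aq Q) (M i)] [∀ i, IsScalarTower ℂ (Aq Q) (M i)]
  {U : Type} [AddCommGroup U] [Module ℂ U] [Module (Aq Q) U] [IsScalarTower ℂ (Aq Q) U]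

theorem pow_eq_zero_of_chain {n : ℕ}
    (hn : ∀ (i j : κ) (f : M i →ₗ[Aq Q] M j), Chain Q M n i j f → f = 0)
    {N : Module.End (Aq Q) (∀ i, M i)}
    (hN : ∀ i j, ¬Function.Bijective (LinearMap.proj i ∘ₗ N ∘ₗ LinearMap.single (Aq Q) M j)) :
    N ^ n = 0 := by
  have key : ∀ k ≤ n, ∀ v (i j : κ) (g : M i →ₗ[Aq Q] M j), Chain Q M (n - k) i j g →
      g ((N ^ k) v i) = 0 := by
    intro k
    induction k with
    | zero =>
      intro _ v i j g hg
      rw [hn i j g hg, LinearMap.zero_apply]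
    | succ k ih =>
      intro hk v i j g hg
      have h1 : (N ^ (k + 1)) v i =
          ∑ s, (LinearMap.proj i ∘ₗ N ∘ₗ LinearMap.single (Aq Q) M s) ((N ^ k) v s) := by
        rw [pow_succ', Module.End.mul_apply]
        conv_lhs => rw [← Finset.univ_sum_single ((N ^ k) v), map_sum, Finset.sum_apply]
        rfl
      rw [h1, map_sum]
      refine Finset.sum_eq_zero fun s _ => ih (by omega) v s j (g ∘ₗ _) ?_
      have := Chain.comp (hN i s) hg
      rwa [show n - (k + 1) + 1 = n - k by omega] at this
  refine LinearMap.ext fun v => funext fun i => ?_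
  refine key n le_rfl v i i LinearMap.id ?_
  rw [Nat.sub_self]
  exact Chain.id i

theorem indec_quotient_range (hQ : QAcyclic Q) (hR : AdmissibleRels R)
    {d : ℕ} [∀ i, Good R (M i)] [Good R U]
    (hd : ∀ i, Module.finrank ℂ (M i) = d) (hM : ∀ i, Indec Q (M i))
    (hniso : ∀ i j, i ≠ j → ∀ h : M i →ₗ[Aq Q] M j, ¬Function.Bijective h) {c : Q.V → ℤ}
    (hres : ∀ i, HasRes R (M i) c) (f : ∀ i, U →ₗ[Aq Q] M i)
    (hf : ∀ i j (h : M i →ₗ[Aq Q] M j), ¬Function.Bijective h → h ∘ₗ f i = 0)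
    (hext : ∀ i, (homd Q (M i) (LinearMap.range (LinearMap.pi f)) : ℤ) =
      eul c (dimV (LinearMap.range (LinearMap.pi f))))
    (htop : LinearMap.range (LinearMap.pi f) ≠ ⊤)
    (hsplit : ∀ i₀ i₁ : κ, ∀ s : Set κ, i₀ ∈ s → i₁ ∉ s →
      ∃ u, ∀ u', (∀ i ∈ s, f i u' = f i u) → ∃ i ∉ s, f i u' ≠ 0) :
    Indec Q ((∀ i, M i) ⧸ LinearMap.range (LinearMap.pi f)) := by
  have hfd : ∀ i, FiniteDimensional ℂ (M i) := fun i => Good.fin R (M i)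
  have hfd' : FiniteDimensional ℂ U := Good.fin R U
  set X := LinearMap.range (LinearMap.pi f) with hX
  refine ⟨Submodule.Quotient.nontrivial_iff.2 htop, fun e he => ?_⟩
  have hext' : (homd Q (∀ i, M i) X : ℤ) = eul (fun x => ∑ _i : κ, c x) (dimV X) := by
    have : FiniteDimensional ℂ X := Good.fin R X
    rw [homd_pi_left, Nat.cast_sum, Finset.sum_congr rfl fun i _ => hext i]
    exact (eul_sum_left (fun _ : κ => c) _).symm
  obtain ⟨E, hE⟩ := (HasRes.pi hres).exists_lift hQ hR X.injective_subtype X.mkQ_surjective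
    (LinearMap.exact_subtype_mkQ X) hext' (e ∘ₗ X.mkQ)
  have hnt := fun i => (hM i).1
  choose t ht using fun i =>
    exists_not_bijective_sub_smul (LinearMap.proj i ∘ₗ E ∘ₗ LinearMap.single (Aq Q) M i)
  let N : Module.End (Aq Q) (∀ i, M i) := E - LinearMap.pi fun i => t i • (LinearMap.proj i : (∀ i, M i) →ₗ[Aq Q] M i)
  have hN : ∀ i j, ¬Function.Bijective (LinearMap.proj i ∘ₗ N ∘ₗ LinearMap.single (Aq Q) M j) := by
    intro i j
    by_cases hij : j = i
    · subst hij
      have h1 : LinearMap.proj j ∘ₗ N ∘ₗ LinearMap.single (Aq Q) M j =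
          LinearMap.proj j ∘ₗ E ∘ₗ LinearMap.single (Aq Q) M j - t j • LinearMap.id :=
        LinearMap.ext fun v => by simp [N]
      rw [h1]
      exact ht j
    · exact hniso j i hij _
  have hNX : ∀ u, N (LinearMap.pi f u) = 0 := by
    intro u
    funext i
    have h1 : N (LinearMap.pi f u) i =
        ∑ s, (LinearMap.proj i ∘ₗ N ∘ₗ LinearMap.single (Aq Q) M s) (f s u) := by
      conv_lhs => rw [← Finset.univ_sum_single (LinearMap.pi f u), map_sum, Finset.sum_apply]
      rfl
    rw [h1]
    exact Finset.sum_eq_zero fun s _ => LinearMap.congr_fun (hf s i _ (hN i s)) u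
  have hEX : ∀ v ∈ X, E v ∈ X := by
    intro v hv
    have := LinearMap.congr_fun hE v
    simp only [LinearMap.comp_apply, (Submodule.Quotient.mk_eq_zero X).2 hv, Submodule.mkQ_apply,
      map_zero] at this
    exact (Submodule.Quotient.mk_eq_zero X).1 this
  have hTX : ∀ v ∈ X, (fun i => t i • v i) ∈ X := by
    rintro v ⟨u, rfl⟩
    have h1 := hNX u
    rw [LinearMap.sub_apply, sub_eq_zero] at h1
    have h2 := hEX _ ⟨u, rfl⟩
    rw [h1] at h2
    exact h2
  have hsX : ∀ s : Finset ℂ, ∀ v ∈ X, (fun i => (∏ z ∈ s, (t i - z)) • v i) ∈ X := by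
    intro s
    induction s using Finset.induction_on with
    | empty =>
      intro v hv
      simpa using hv
    | insert z s hz ih =>
      intro v hv
      have h1 := ih v hv
      have h2 := X.sub_mem (hTX _ h1) ((X.restrictScalars ℂ).smul_mem z h1)
      convert h2 using 1
      funext i
      simp only [Finset.prod_insert hz, Pi.sub_apply, Pi.smul_apply, sub_smul, smul_smul, sub_mul]
  have hteq : ∀ i j, t i = t j := by
    intro i₀ i₁
    by_contra hne
    obtain ⟨u, hu⟩ := hsplit i₀ i₁ {i | t i = t i₀} rfl (fun h => hne h.symm)
    set s := (Finset.univ.image t).erase (t i₀)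
    have hs0 : ∏ z ∈ s, (t i₀ - z) ≠ 0 :=
      Finset.prod_ne_zero_iff.2 fun z hz => sub_ne_zero.2 (Finset.ne_of_mem_erase hz).symm
    obtain ⟨w, hw⟩ := hsX s _ ⟨u, rfl⟩
    obtain ⟨i, hi, hi'⟩ := hu ((∏ z ∈ s, (t i₀ - z))⁻¹ • w) fun i hi => by
      have h1 := congrFun hw i
      have h2 : f i ((∏ z ∈ s, (t i₀ - z))⁻¹ • w) = (∏ z ∈ s, (t i₀ - z))⁻¹ • f i w :=
        LinearMap.map_smul_of_tower _ _ _
      simp only [LinearMap.pi_apply] at h1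
      rw [h2, h1, show t i = t i₀ from hi, smul_smul, inv_mul_cancel₀ hs0, one_smul]
    refine hi' ?_
    have h1 := congrFun hw i
    have h2 : f i ((∏ z ∈ s, (t i₀ - z))⁻¹ • w) = (∏ z ∈ s, (t i₀ - z))⁻¹ • f i w :=
        LinearMap.map_smul_of_tower _ _ _
    simp only [LinearMap.pi_apply] at h1
    rw [h2, h1, Finset.prod_eq_zero (i := t i)
      (Finset.mem_erase.2 ⟨hi, Finset.mem_image_of_mem _ (Finset.mem_univ i)⟩) (sub_self _),
      zero_smul, smul_zero]
  obtain ⟨c₀, hc₀⟩ : ∃ c₀, ∀ i, t i = c₀ := by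
    rcases isEmpty_or_nonempty κ with h | ⟨⟨i⟩⟩
    · exact ⟨0, fun i => h.elim i⟩
    · exact ⟨t i, fun j => hteq j i⟩
  obtain ⟨n, hn⟩ := exists_chain_eq_zero hd hM
  have hNn := pow_eq_zero_of_chain hn hN
  have hpow : ∀ k v, X.mkQ ((N ^ k) v) = ((e - c₀ • 1 : Module.End (Aq Q) _) ^ k) (X.mkQ v) := by
    intro k
    induction k with
    | zero => intro v; rfl
    | succ k ih =>
      intro v
      rw [pow_succ, pow_succ, Module.End.mul_apply, Module.End.mul_apply, ih]
      congr 1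
      have h1 := LinearMap.congr_fun hE v
      simp only [LinearMap.comp_apply] at h1
      have h2 : N v = E v - c₀ • v := by
        funext i
        simp [N, hc₀]
      rw [h2, map_sub, h1]
      rfl
  refine eq_zero_or_eq_id_of_isNilpotent he (c := c₀) ⟨n, LinearMap.ext fun y => ?_⟩
  obtain ⟨v, rfl⟩ := X.mkQ_surjective y
  rw [← hpow, hNn]
  rfl

end IndecQuotient

section Exhaustion

set_option linter.unusedSectionVars false

variable {R : Set (FormalRel Q)}

variable {ι : Type} {M : ι → Type} [∀ i, AddCommGroup (M i)]
  [∀ i, Module ℂ (M i)] [∀ i, Module (Aq Q) (M i)] [∀ i, IsScalarTower ℂ (Aq Q) (M i)]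
  {U : Type} [AddCommGroup U] [Module ℂ U] [Module (Aq Q) U] [IsScalarTower ℂ (Aq Q) U]

/-- Infinitely many members of a family have a nonzero homomorphism from `U` which is killed by all
non-isomorphisms between them. -/
theorem exists_infinite_killed [Infinite ι] {n : ℕ}
    (hn : ∀ (i j : ι) (f : M i →ₗ[Aq Q] M j), Chain Q M n i j f → f = 0)
    (hU : ∀ i, ∃ f : U →ₗ[Aq Q] M i, f ≠ 0) :
    ∃ (I : Set ι) (f : ∀ i, U →ₗ[Aq Q] M i), I.Infinite ∧ (∀ i ∈ I, f i ≠ 0) ∧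
      ∀ i ∈ I, ∀ j ∈ I, ∀ h : M i →ₗ[Aq Q] M j, ¬Function.Bijective h → h ∘ₗ f i = 0 := by
  classical
  let S : ℕ → Set ι := fun k =>
    {j | ∃ (i : ι) (g : M i →ₗ[Aq Q] M j) (f : U →ₗ[Aq Q] M i), Chain Q M k i j g ∧ g ∘ₗ f ≠ 0}
  obtain ⟨k, hk, hk'⟩ : ∃ k, (S k).Infinite ∧ ¬(S (k + 1)).Infinite := by
    by_contra! h
    have hall : ∀ k, (S k).Infinite := by
      intro k
      induction k with
      | zero =>
        have : S 0 = Set.univ := by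
          refine Set.eq_univ_of_forall fun j => ?_
          obtain ⟨f, hf⟩ := hU j
          exact ⟨j, LinearMap.id, f, Chain.id j, hf⟩
        rw [this]
        exact Set.infinite_univ
      | succ k ih => exact h k ih
    obtain ⟨j, i, g, f, hg, hgf⟩ := (hall n).nonempty
    exact hgf (by rw [hn i j g hg, LinearMap.zero_comp])
  rw [Set.not_infinite] at hk'
  have hex : ∀ j, ∃ F : U →ₗ[Aq Q] M j, j ∈ S k → F ≠ 0 ∧ ∃ (i : ι) (g : M i →ₗ[Aq Q] M j)
      (f : U →ₗ[Aq Q] M i), Chain Q M k i j g ∧ F = g ∘ₗ f := by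
    intro j
    by_cases hj : j ∈ S k
    · obtain ⟨i, g, f, hg, hgf⟩ := hj
      exact ⟨g ∘ₗ f, fun _ => ⟨hgf, i, g, f, hg, rfl⟩⟩
    · exact ⟨0, fun h => absurd h hj⟩
  choose F hF using hex
  refine ⟨S k \ S (k + 1), F, hk.sdiff hk', fun i hi => (hF i hi.1).1, fun i hi j hj h hh => ?_⟩
  obtain ⟨-, i', g, f, hg, hgf⟩ := hF i hi.1
  by_contra hne
  refine hj.2 ⟨i', h ∘ₗ g, f, hg.comp_right hh, ?_⟩
  rwa [LinearMap.comp_assoc, ← hgf]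

/-- The common kernel of finitely many members of a family of homomorphisms. -/
def comKer (f : ∀ i, U →ₗ[Aq Q] M i) (B : Finset ι) : Submodule ℂ U :=
  ⨅ i ∈ B, LinearMap.ker ((f i).restrictScalars ℂ)

theorem mem_comKer {f : ∀ i, U →ₗ[Aq Q] M i} {B : Finset ι} {u : U} :
    u ∈ comKer f B ↔ ∀ i ∈ B, f i u = 0 := by
  simp [comKer, Submodule.mem_iInf]

theorem exists_indec_quotient (hQ : QAcyclic Q) (hR : AdmissibleRels R)
    [DecidableEq ι] [∀ i, Good R (M i)] [Good R U] {d : ℕ}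
    (hd : ∀ i, Module.finrank ℂ (M i) = d) (hM : ∀ i, Indec Q (M i))
    (hniso : ∀ i j, i ≠ j → ∀ h : M i →ₗ[Aq Q] M j, ¬Function.Bijective h) {c : Q.V → ℤ}
    (hres : ∀ i, HasRes R (M i) c) (hext : ∀ i, (homd Q (M i) U : ℤ) = eul c (dimV U))
    (f : ∀ i, U →ₗ[Aq Q] M i) (S : Finset ι) (hf0 : ∀ i ∈ S, f i ≠ 0)
    (hf : ∀ i ∈ S, ∀ j ∈ S, ∀ h : M i →ₗ[Aq Q] M j, ¬Function.Bijective h → h ∘ₗ f i = 0)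
    (hS : Module.finrank ℂ U < S.card) :
    ∃ B ⊆ S, 2 ≤ B.card ∧ Indec Q ((∀ i : B, M i) ⧸ LinearMap.range (LinearMap.pi fun i : B => f i)) := by
  have hfd : ∀ i, FiniteDimensional ℂ (M i) := fun i => Good.fin R (M i)
  have hfd' : FiniteDimensional ℂ U := Good.fin R U
  obtain ⟨B, hBS, hB⟩ := exists_minimal_le_of_wellFoundedLT
    (fun B : Finset ι => Module.finrank ℂ U < B.card + Module.finrank ℂ (comKer f B)) S (by omega)
  have hBp : Module.finrank ℂ U < B.card + Module.finrank ℂ (comKer f B) := hB.prop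
  have hmin : ∀ B' ⊂ B, B'.card + Module.finrank ℂ (comKer f B') ≤ Module.finrank ℂ U := fun B' hB' => by
    have := hB.not_prop_of_lt hB'
    omega
  have hB2 : 2 ≤ B.card := by
    by_contra! hlt
    have hK : comKer f B = ⊤ := by
      refine Submodule.eq_top_of_finrank_eq ?_
      have := Submodule.finrank_le (comKer f B)
      omega
    obtain ⟨i, hi⟩ : B.Nonempty := by
      rw [Finset.nonempty_iff_ne_empty]
      rintro rfl
      have := Submodule.finrank_le (comKer f ∅)
      rw [Finset.card_empty] at hBp
      omega
    refine hf0 i (hBS hi) (LinearMap.ext fun u => ?_)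
    exact mem_comKer.1 (hK ▸ Submodule.mem_top) i hi
  refine ⟨B, hBS, hB2, indec_quotient_range (U := U) (R := R) (M := fun i : B => M i) hQ hR
    (fun i => hd i) (fun i => hM i)
    (fun i j hij => hniso i j fun h => hij (Subtype.ext h)) (fun i => hres i) (fun i : B => f i)
    (fun i j => hf i (hBS i.2) j (hBS j.2)) (fun i => ?_) ?_ ?_⟩
  · exact (hres i).ext_right hQ hR (LinearMap.surjective_rangeRestrict _) (hext i)
  · intro htop
    have hrk := LinearMap.finrank_range_add_finrank_ker
      ((LinearMap.pi fun i : B => f i).restrictScalars ℂ)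
    have hker : LinearMap.ker ((LinearMap.pi fun i : B => f i).restrictScalars ℂ) = comKer f B := by
      ext u
      rw [mem_comKer]
      simp [funext_iff]
    have hran : LinearMap.range ((LinearMap.pi fun i : B => f i).restrictScalars ℂ) = ⊤ := by
      rw [eq_top_iff]
      intro y _
      exact (Submodule.ext_iff.1 htop y).2 trivial
    rw [hker, hran, finrank_top, Module.finrank_pi_fintype, Finset.sum_congr rfl fun i _ => hd _,
      Finset.sum_const, Finset.card_univ, Fintype.card_coe, smul_eq_mul] at hrk
    have hd0 : 0 < d := by
      obtain ⟨i, hi⟩ : B.Nonempty := Finset.card_pos.1 (by omega)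
      have := (hM i).1
      rw [← hd i]
      exact Module.finrank_pos
    have := Nat.le_mul_of_pos_right B.card hd0
    omega
  · intro i₀ i₁ s h0 h1
    classical
    by_contra! hcon
    set B₁ : Finset ι := B.filter fun i => ∃ h : i ∈ B, (⟨i, h⟩ : B) ∈ s
    set B₂ : Finset ι := B.filter fun i => ¬∃ h : i ∈ B, (⟨i, h⟩ : B) ∈ s
    have hB₁ : B₁ ⊂ B := by
      refine Finset.filter_ssubset.2 ⟨i₁, i₁.2, ?_⟩
      rintro ⟨_, h⟩
      exact h1 h
    have hB₂ : B₂ ⊂ B := Finset.filter_ssubset.2 ⟨i₀, i₀.2, not_not.2 ⟨i₀.2, h0⟩⟩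
    have hcard : B₁.card + B₂.card = B.card := Finset.card_filter_add_card_filter_not _
    have h2 := hmin _ hB₁
    have h3 := hmin _ hB₂
    have hsup := Submodule.finrank_sup_add_finrank_inf_eq (comKer f B₁) (comKer f B₂)
    have htop : comKer f B₁ ⊔ comKer f B₂ = ⊤ := by
      rw [eq_top_iff]
      intro u _
      obtain ⟨u', hu, hu'⟩ := hcon u
      refine Submodule.mem_sup.2 ⟨u - u', ?_, u', ?_, sub_add_cancel _ _⟩
      · rw [mem_comKer]
        intro i hi
        obtain ⟨hi, hs⟩ := (Finset.mem_filter.1 hi).2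
        rw [map_sub, hu ⟨i, hi⟩ hs, sub_self]
      · rw [mem_comKer]
        intro i hi
        obtain ⟨hi, hs⟩ := Finset.mem_filter.1 hi
        exact hu' ⟨i, hi⟩ fun h => hs ⟨hi, h⟩
    have hinf : comKer f B ≤ comKer f B₁ ⊓ comKer f B₂ := fun u hu =>
      ⟨mem_comKer.2 fun i hi => mem_comKer.1 hu i (hB₁.1 hi),
        mem_comKer.2 fun i hi => mem_comKer.1 hu i (hB₂.1 hi)⟩
    have h4 := Submodule.finrank_mono hinf
    rw [htop, finrank_top] at hsup
    omega

end Exhaustion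

section Thinning

set_option linter.unusedSectionVars false

variable {R : Set (FormalRel Q)}

theorem dimV_pi {ι : Type} [Fintype ι] {N : ι → Type} [∀ i, AddCommGroup (N i)]
    [∀ i, Module ℂ (N i)] [∀ i, Module (Aq Q) (N i)] [∀ i, IsScalarTower ℂ (Aq Q) (N i)]
    [∀ i, FiniteDimensional ℂ (N i)] (x : Q.V) : dimV (∀ i, N i) x = ∑ i, dimV (N i) x := by
  have e : vsp (∀ i, N i) x ≃ₗ[ℂ] ∀ i, vsp (N i) x :=
    LinearEquiv.ofBijective
      (LinearMap.pi fun i => (LinearMap.proj i ∘ₗ (vsp (∀ i, N i) x).subtype).codRestrict (vsp (N i) x) (by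
        rintro ⟨-, m, rfl⟩
        exact ⟨m i, rfl⟩))
      ⟨fun m m' h => Subtype.ext (funext fun i => congrArg Subtype.val (congrFun h i)), fun m => by
        choose v hv using fun i => (m i).2
        exact ⟨⟨fun i => (m i).1, v, funext hv⟩, rfl⟩⟩
  rw [dimV, e.finrank_eq, Module.finrank_pi_fintype]
  rfl

theorem evalPath_polyEvalAt {γ : Q.V → ℕ} (N : RepR Q (Polynomial ℂ) γ) (z : ℂ) {x y : Q.V}
    (p : Quiver.Path x y) : evalPath (polyEvalAt N z : QRep Q γ) p =
      (evalPath N p).map (Polynomial.evalRingHom z) := by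
  induction p with
  | nil =>
    ext i j
    simp [evalPath, Matrix.one_apply, apply_ite]
  | cons p e ih =>
    rw [evalPath, evalPath, Matrix.map_mul, ih]
    rfl

theorem polyEvalAt_mem {γ : Q.V → ℕ} {N : RepR Q (Polynomial ℂ) γ} (hN : ∀ r ∈ R, evalLinP N r.2.2 = 0)
    (z : ℂ) : polyEvalAt N z ∈ modSet R γ := by
  intro r hr
  have h : evalLin (polyEvalAt N z) r.2.2 = (evalLinP N r.2.2).map (Polynomial.evalRingHom z) := by
    ext i j
    simp only [evalLin, evalLinP, evalPath_polyEvalAt, Finsupp.sum, Matrix.sum_apply,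
      Matrix.map_apply, Matrix.smul_apply, smul_eq_mul, Polynomial.coe_evalRingHom,
      Polynomial.eval_finsetSum, Polynomial.eval_mul, Polynomial.eval_C]
  rw [h, hN r hr]
  exact Matrix.map_zero _ (map_zero _)

theorem linePoly_polyEvalAt {γ : Q.V → ℕ} (N : RepR Q (Polynomial ℂ) γ) (q : RepCoord γ) :
    LinePoly fun z => repCoords (polyEvalAt N z) q := by
  intro a b
  refine ⟨(N q.1 q.2.1 q.2.2).comp (Polynomial.C a + Polynomial.C b * Polynomial.X), fun t => ?_⟩
  simp only [repCoords, polyEvalAt, Matrix.map_apply, Polynomial.eval_comp, Polynomial.eval_add,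
    Polynomial.eval_mul, Polynomial.eval_C, Polynomial.eval_X, smul_eq_mul, mul_comm]

theorem homd_le_add {M E : Type} [AddCommGroup M] [Module ℂ M] [Module (Aq Q) M]
    [IsScalarTower ℂ (Aq Q) M] [AddCommGroup E] [Module ℂ E] [Module (Aq Q) E]
    [IsScalarTower ℂ (Aq Q) E] [FiniteDimensional ℂ M] [FiniteDimensional ℂ E]
    (K : Submodule (Aq Q) E) : homd Q M E ≤ homd Q M K + homd Q M (E ⧸ K) := by
  have hK : FiniteDimensional ℂ K := FiniteDimensional.of_injective (K.subtype.restrictScalars ℂ)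
    K.injective_subtype
  have hK' : FiniteDimensional ℂ (E ⧸ K) := Module.Finite.of_surjective (K.mkQ.restrictScalars ℂ)
    K.mkQ_surjective
  have h1 := LinearMap.finrank_range_add_finrank_ker (postcomp M K.mkQ)
  have h2 := Submodule.finrank_le (LinearMap.range (postcomp M K.mkQ))
  have h3 : LinearMap.ker (postcomp M K.mkQ) ≤ LinearMap.range (postcomp M K.subtype) := by
    intro f hf
    have hf' : ∀ m, f m ∈ K := fun m => (Submodule.Quotient.mk_eq_zero K).1 (LinearMap.congr_fun hf m)
    exact ⟨f.codRestrict K hf', LinearMap.ext fun m => rfl⟩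
  have h4 := Submodule.finrank_mono h3
  have h5 := LinearMap.finrank_range_le (postcomp M K.subtype)
  simp only [homd] at *
  omega

variable {β : Q.V → ℕ} (M : ℂ → QRep Q β) (Λ : Set ℂ) (c : Q.V → ℤ)

/-- The members of a family having a nonzero first extension group with `W`. -/
def extSupp (W : Type) [AddCommGroup W] [Module ℂ W] [Module (Aq Q) W] [IsScalarTower ℂ (Aq Q) W] :
    Set ℂ := {z ∈ Λ | (homd Q (RMod (M z)) W : ℤ) ≠ eul c (dimV W)}

theorem extSupp_congr {W W' : Type} [AddCommGroup W] [Module ℂ W] [Module (Aq Q) W]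
    [IsScalarTower ℂ (Aq Q) W] [AddCommGroup W'] [Module ℂ W'] [Module (Aq Q) W']
    [IsScalarTower ℂ (Aq Q) W'] (e : W ≃ₗ[Aq Q] W') : extSupp M Λ c W = extSupp M Λ c W' := by
  ext z
  simp only [extSupp, Set.mem_sep_iff, homd_congr_right e, dimV_eq_of_equiv e]

variable {M Λ c} [Fintype Q.A]

theorem exists_nbhd_of_family (hQ : QAcyclic Q) (hR : AdmissibleRels R)
    (hres : ∀ z ∈ Λ, HasRes R (RMod (M z)) c) {γ : Q.V → ℕ}
    (N : ℂ → QRep Q γ) (hN : ∀ q, LinePoly fun z => repCoords (N z) q) (hmem : ∀ z, N z ∈ modSet R γ) :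
    ∃ (X : Set ℂ) (Nb : ℂ → Set ℂ), X.Finite ∧ (∀ z, (Nb z).Finite) ∧
      ∀ w, (extSupp M Λ c (RMod (N w))).Finite → ∀ z ∈ extSupp M Λ c (RMod (N w)), z ∉ X →
        extSupp M Λ c (RMod (N w)) ⊆ Nb z := by
  classical
  by_cases h0 : ∃ w₀, (extSupp M Λ c (RMod (N w₀))).Finite
  · obtain ⟨w₀, hw₀⟩ := h0
    let T : ℂ → Set ℂ := fun z =>
      {w | z ∈ extSupp M Λ c (RMod (N w)) ∧ (extSupp M Λ c (RMod (N w))).Finite}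
    refine ⟨extSupp M Λ c (RMod (N w₀)), fun z => if z ∈ extSupp M Λ c (RMod (N w₀)) then ∅ else
      ⋃ w ∈ T z, extSupp M Λ c (RMod (N w)), hw₀, fun z => ?_, fun w hw z hz hzX => ?_⟩
    · beta_reduce
      split_ifs with hz
      · exact Set.finite_empty
      refine Set.Finite.biUnion ?_ fun w hw => hw.2
      by_cases hzΛ : z ∈ Λ
      · obtain ⟨D, hD, hD0, hD1⟩ := exists_dimHom_le (V := fun _ => M z) (W := N)
          (fun q => LinePoly.const _) hN w₀
        refine (hD.finite_zeros hD0).subset fun w hw => ?_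
        by_contra hDw
        refine hw.1.2 ?_
        have h1 := hD1 w hDw
        have h2 : (homd Q (RMod (M z)) (RMod (N w₀)) : ℤ) = eul c (dimV (RMod (N w₀))) := by
          by_contra h
          exact hz ⟨hzΛ, h⟩
        have := good_rmod (hmem w)
        have h3 := (hres z hzΛ).eul_le hQ hR (RMod (N w))
        rw [dimV_rmod] at h2 h3 ⊢
        rw [homd_rmod] at h2 h3 ⊢
        omega
      · exact Set.finite_empty.subset fun w hw => hzΛ hw.1.1
    · simp only [if_neg hzX]
      exact Set.subset_biUnion_of_mem (u := fun w => extSupp M Λ c (RMod (N w))) (show w ∈ T z from ⟨hz, hw⟩)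
  · exact ⟨∅, fun _ => ∅, Set.finite_empty, fun _ => Set.finite_empty, fun w hw => (h0 ⟨w, hw⟩).elim⟩

/-- Outside a finite set, every parameter has a finite neighbourhood containing the support of
every indecomposable module of bounded dimension and finite support. -/
theorem exists_nbhd (hQ : QAcyclic Q) (hR : AdmissibleRels R)
    (htame : IsTame R) (hres : ∀ z ∈ Λ, HasRes R (RMod (M z)) c) (d : ℕ) :
    ∃ (X : Set ℂ) (Nb : ℂ → Set ℂ), X.Finite ∧ (∀ z, (Nb z).Finite) ∧
      ∀ (α : Q.V → ℕ) (V : QRep Q α), V ∈ modSet R α → ∑ x, α x = d → IsIndecRep V →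
        (extSupp M Λ c (RMod V)).Finite → ∀ z ∈ extSupp M Λ c (RMod V), z ∉ X →
          extSupp M Λ c (RMod V) ⊆ Nb z := by
  classical
  obtain ⟨s, γs, N, hN, t, βs, E, h⟩ := htame d
  choose X Nb hX hNb hNb' using fun i => exists_nbhd_of_family hQ hR hres (fun z => polyEvalAt (N i) z)
    (linePoly_polyEvalAt (N i)) (polyEvalAt_mem (hN i))
  let Y : Fin t → Set ℂ := fun k => {z | z ∈ extSupp M Λ c (RMod (E k)) ∧
    (extSupp M Λ c (RMod (E k))).Finite}
  refine ⟨(⋃ i, X i) ∪ ⋃ k, Y k, fun z => ⋃ i, Nb i z,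
    (Set.finite_iUnion hX).union (Set.finite_iUnion fun k => ?_), fun z =>
      Set.finite_iUnion fun i => hNb i z, fun α V hV hα hind hfin z hz hzX => ?_⟩
  · by_cases hk : (extSupp M Λ c (RMod (E k))).Finite
    · exact hk.subset fun z hz => hz.1
    · exact Set.finite_empty.subset fun z hz => hk hz.2
  · rw [Set.mem_union, not_or] at hzX
    obtain ⟨k, hk⟩ | ⟨i, w, hw⟩ := h α V hV hα hind
    · obtain ⟨e⟩ := hk.nonempty_equiv
      rw [← extSupp_congr M Λ c e] at hfin hz
      exact (hzX.2 (Set.mem_iUnion.2 ⟨k, hz, hfin⟩)).elim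
    · obtain ⟨e⟩ := hw.nonempty_equiv
      rw [← extSupp_congr M Λ c e] at hfin hz ⊢
      exact (hNb' i w hfin z hz fun hzi => hzX.1 (Set.mem_iUnion.2 ⟨i, hzi⟩)).trans
        (Set.subset_iUnion (fun i => Nb i z) i)

theorem exists_nbhd_le (hQ : QAcyclic Q) (hR : AdmissibleRels R)
    (htame : IsTame R) (hres : ∀ z ∈ Λ, HasRes R (RMod (M z)) c) (d : ℕ) :
    ∃ (X : Set ℂ) (Nb : ℂ → Set ℂ), X.Finite ∧ (∀ z, (Nb z).Finite) ∧
      ∀ (F : Type) [AddCommGroup F] [Module ℂ F] [Module (Aq Q) F] [IsScalarTower ℂ (Aq Q) F]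
        [Good R F], ∑ x : Q.V, dimV F x ≤ d → Indec Q F →
        (extSupp M Λ c F).Finite → ∀ z ∈ extSupp M Λ c F, z ∉ X → extSupp M Λ c F ⊆ Nb z := by
  choose X Nb hX hNb h using fun d => exists_nbhd hQ hR htame hres d
  refine ⟨⋃ k ∈ Set.Iic d, X k, fun z => ⋃ k ∈ Set.Iic d, Nb k z,
    (Set.finite_Iic d).biUnion fun k _ => hX k, fun z => (Set.finite_Iic d).biUnion fun k _ => hNb k z, ?_⟩
  intro F _ _ _ _ _ hd hF hfin z hz hzX
  obtain ⟨V, hV, ⟨e⟩⟩ := Good.exists_rep R F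
  rw [← extSupp_congr M Λ c e] at hfin hz ⊢
  refine (h _ (dimV F) V hV rfl (isIndecRep_iff.2 (hF.of_equiv e.symm)) hfin z hz fun hzX' =>
    hzX (Set.mem_biUnion (Set.mem_Iic.2 hd) hzX')).trans
      (Set.subset_biUnion_of_mem (u := fun k => Nb k z) (Set.mem_Iic.2 hd))

theorem finite_homd_ne_zero (hQ : QAcyclic Q) (hR : AdmissibleRels R)
    (htame : IsTame R) (hres : ∀ z ∈ Λ, HasRes R (RMod (M z)) c)
    (hmem : ∀ z ∈ Λ, M z ∈ modSet R β) (hind : ∀ z ∈ Λ, IsIndecRep (M z))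
    (hself : ∀ z ∈ Λ, z ∈ extSupp M Λ c (RMod (M z)))
    (hfin : ∀ z ∈ Λ, (extSupp M Λ c (RMod (M z))).Finite) {δ : Q.V → ℕ} {U : QRep Q δ}
    (hU : U ∈ modSet R δ) (hU0 : extSupp M Λ c (RMod U) = ∅) :
    {z ∈ Λ | homd Q (RMod U) (RMod (M z)) ≠ 0}.Finite := by
  classical
  by_contra hinf
  obtain ⟨X, Nb, hX, hNb, hNbs⟩ := exists_nbhd_le hQ hR htame hres
    ((Module.finrank ℂ (RMod U) + 1) * ∑ x, β x)
  obtain ⟨p, hp, hp'⟩ := exists_seq_of_forall_finset_exists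
    (fun z : ℂ => z ∈ Λ ∧ homd Q (RMod U) (RMod (M z)) ≠ 0 ∧ z ∉ X)
    (fun z w => w ∉ Nb z ∧ w ∉ extSupp M Λ c (RMod (M z))) (by
      intro s hs
      have h1 : (X ∪ ⋃ z ∈ s, (Nb z ∪ extSupp M Λ c (RMod (M z)))).Finite :=
        hX.union (s.finite_toSet.biUnion fun z hz => (hNb z).union (hfin z (hs z hz).1))
      obtain ⟨w, hw, hw'⟩ := (Set.Infinite.sdiff hinf h1).nonempty
      rw [Set.mem_union, not_or] at hw'
      refine ⟨w, ⟨hw.1, hw.2, hw'.1⟩, fun z hz => ?_⟩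
      have h2 : w ∉ Nb z ∪ extSupp M Λ c (RMod (M z)) := fun h => hw'.2 (Set.mem_biUnion hz h)
      rwa [Set.mem_union, not_or] at h2)
  have hΛ : ∀ n, p n ∈ Λ := fun n => (hp n).1
  have hgood : ∀ n, Good R (RMod (M (p n))) := fun n => good_rmod (hmem _ (hΛ n))
  have hgoodU : Good R (RMod U) := good_rmod hU
  have hM : ∀ n, Indec Q (RMod (M (p n))) := fun n => isIndecRep_iff.1 (hind _ (hΛ n))
  have hd : ∀ n, Module.finrank ℂ (RMod (M (p n))) = Module.finrank ℂ (∀ x : Q.V, Fin (β x) → ℂ) :=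
    fun n => rfl
  have hle : ∀ m n, p m ∈ extSupp M Λ c (RMod (M (p n))) → m ≤ n := fun m n h =>
    not_lt.1 fun hlt => (hp' n m hlt).2 h
  have hniso : ∀ i j, i ≠ j → ∀ h : RMod (M (p i)) →ₗ[Aq Q] RMod (M (p j)), ¬Function.Bijective h := by
    intro i j hij h hb
    have he := extSupp_congr M Λ c (LinearEquiv.ofBijective h hb)
    have h1 := hself _ (hΛ i)
    have h2 := hself _ (hΛ j)
    rw [he] at h1
    rw [← he] at h2
    exact hij (le_antisymm (hle _ _ h1) (hle _ _ h2))
  obtain ⟨n, hn⟩ := exists_chain_eq_zero hd hM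
  obtain ⟨I, f, hI, hf0, hf⟩ := exists_infinite_killed (U := RMod U) hn (fun i => by
    by_contra! h
    refine (hp i).2.1 ?_
    have : Subsingleton (RMod U →ₗ[Aq Q] RMod (M (p i))) := ⟨fun a b => by rw [h a, h b]⟩
    exact Module.finrank_zero_of_subsingleton)
  obtain ⟨S, hSI, hS⟩ := hI.exists_subset_card_eq (Module.finrank ℂ (RMod U) + 1)
  have hext : ∀ z ∈ Λ, (homd Q (RMod (M z)) (RMod U) : ℤ) = eul c (dimV (RMod U)) := by
    intro z hz
    by_contra h
    exact (hU0 ▸ (show z ∈ extSupp M Λ c (RMod U) from ⟨hz, h⟩) : z ∈ (∅ : Set ℂ))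
  obtain ⟨B, hBS, hB2, hF⟩ := exists_indec_quotient hQ hR hd hM hniso (fun i => hres _ (hΛ i))
    (fun i => hext _ (hΛ i)) f S (fun i hi => hf0 i (hSI hi))
    (fun i hi j hj => hf i (hSI hi) j (hSI hj)) (by omega)
  set K := LinearMap.range (LinearMap.pi fun i : B => f i) with hK
  have hres' := fun i => hres _ (hΛ i)
  have hsum : eul c (dimV (∀ i : B, RMod (M (p i)))) = ∑ i : B, eul c (dimV (RMod (M (p i)))) := by
    rw [← eul_sum_right]
    congr 1
    funext x
    exact dimV_pi x
  have hadd : eul c (dimV (∀ i : B, RMod (M (p i)))) = eul c (dimV K) + eul c (dimV (_ ⧸ K)) := by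
    rw [← eul_add_right]
    congr 1
    funext x
    exact dimV_of_exact (R := R) K.injective_subtype K.mkQ_surjective (LinearMap.exact_subtype_mkQ K) x
  have hdim : ∑ x : Q.V, dimV ((∀ i : B, RMod (M (p i))) ⧸ K) x ≤
      (Module.finrank ℂ (RMod U) + 1) * ∑ x, β x := by
    rw [Finset.mul_sum]
    refine Finset.sum_le_sum fun x _ => ?_
    have h1 := dimV_of_exact (R := R) K.injective_subtype K.mkQ_surjective (LinearMap.exact_subtype_mkQ K) x
    rw [dimV_pi] at h1
    simp only [dimV_rmod, Finset.sum_const, Finset.card_univ, Fintype.card_coe, smul_eq_mul] at h1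
    have h2 := Nat.mul_le_mul_right (β x) ((Finset.card_le_card hBS).trans hS.le)
    omega
  have hFfin : (extSupp M Λ c ((∀ i : B, RMod (M (p i))) ⧸ K)).Finite := by
    refine (Set.finite_iUnion fun i : B => hfin _ (hΛ i)).subset fun z hz => ?_
    by_contra hz'
    refine hz.2 ((hres z hz.1).ext_right hQ hR K.mkQ_surjective ?_)
    rw [homd_pi_right, hsum, Nat.cast_sum]
    refine Finset.sum_congr rfl fun i _ => ?_
    by_contra h
    exact hz' (Set.mem_iUnion.2 ⟨i, hz.1, h⟩)
  have hFmem : ∀ i ∈ B, p i ∈ extSupp M Λ c ((∀ i : B, RMod (M (p i))) ⧸ K) := by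
    intro i hi
    refine ⟨hΛ i, fun h => (hself _ (hΛ i)).2 ?_⟩
    have h1 : (homd Q (RMod (M (p i))) K : ℤ) = eul c (dimV K) :=
      (hres' i).ext_right hQ hR (LinearMap.surjective_rangeRestrict _) (hext _ (hΛ i))
    have h2 := homd_le_add (M := RMod (M (p i))) K
    have h3 : ∀ j ∈ Finset.univ, eul c (dimV (RMod (M (p ((j : B) : ℕ))))) ≤
        (homd Q (RMod (M (p i))) (RMod (M (p ((j : B) : ℕ)))) : ℤ) := fun j _ =>
      (hres' i).eul_le hQ hR _
    rw [homd_pi_right] at h2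
    have h4 := (Finset.sum_eq_sum_iff_of_le h3).1 (le_antisymm (Finset.sum_le_sum h3) (by
      rw [← hsum, hadd, ← h, ← h1]
      exact_mod_cast h2))
    exact (h4 ⟨i, hi⟩ (Finset.mem_univ _)).symm
  obtain ⟨i, hi, j, hj, hij⟩ := Finset.one_lt_card.1 hB2
  have hkey : ∀ i ∈ B, ∀ j ∈ B, i < j → False := fun i hi j hj hij =>
    (hp' i j hij).1 (hNbs _ hdim hF hFfin _ (hFmem i hi) (hp i).2.2 (hFmem j hj))
  rcases hij.lt_or_gt with h | h
  · exact hkey i hi j hj h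
  · exact hkey j hj i hi h

end Thinning

section Families

set_option linter.unusedSectionVars false

open MvPolynomial

variable {R : Set (FormalRel Q)}

theorem LinePoly.polyFn_coord {ι : Type} {f : ℂ → ℂ} (hf : LinePoly f) {g : (ι → ℂ) → ℂ}
    (hg : PolyFn g) : PolyFn (fun u => f (g u)) := by
  obtain ⟨p, hp⟩ := hf 0 1
  obtain ⟨q, hq⟩ := hg
  refine ⟨Polynomial.aeval q p, fun u => ?_⟩
  have h : f (g u) = p.eval (g u) := by simpa using hp (g u)
  have h' : MvPolynomial.eval u (Polynomial.aeval q p) = p.eval (MvPolynomial.eval u q) := by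
    clear h hp
    induction p using Polynomial.induction_on' with
    | add p₁ p₂ h₁ h₂ => rw [map_add, map_add, h₁, h₂, Polynomial.eval_add]
    | monomial n a => simp [Polynomial.aeval_monomial, MvPolynomial.algebraMap_eq]
  rw [h', ← hq]
  exact h

theorem linePoly_gAct {α : Q.V → ℕ} {E : Type} [AddCommGroup E] [Module ℂ E] {N : E → QRep Q α}
    (hN : ∀ q, LinePoly fun e => repCoords (N e) q) (g : GLb α) (q : RepCoord (Q := Q) α) :
    LinePoly fun e => repCoords (gAct g (N e)) q := by
  have h : ∀ i j, LinePoly fun e => ((g (Q.h q.1)).val * N e q.1) i j :=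
    LinePoly.matrix_mul (A := fun _ => (g (Q.h q.1)).val) (B := fun e => N e q.1)
      (fun _ _ => LinePoly.const _) fun i j => hN ⟨q.1, i, j⟩
  exact LinePoly.matrix_mul (B := fun _ => ((g (Q.t q.1))⁻¹).val) h (fun _ _ => LinePoly.const _) q.2.1 q.2.2

theorem polyFn_gAct {α : Q.V → ℕ} {ι : Type} {N : (ι → ℂ) → QRep Q α}
    (hN : ∀ q, PolyFn fun e => repCoords (N e) q) (g : GLb α) (q : RepCoord (Q := Q) α) :
    PolyFn fun e => repCoords (gAct g (N e)) q := by
  have h : ∀ i j, PolyFn fun e => ((g (Q.h q.1)).val * N e q.1) i j :=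
    PolyFn.matrix_mul (A := fun _ => (g (Q.h q.1)).val) (B := fun e => N e q.1)
      (fun _ _ => PolyFn.const _) fun i j => hN ⟨q.1, i, j⟩
  exact PolyFn.matrix_mul (B := fun _ => ((g (Q.t q.1))⁻¹).val) h (fun _ _ => PolyFn.const _) q.2.1 q.2.2

/-- The representation with given coordinates. -/
def ofCoords {α : Q.V → ℕ} (u : RepCoord (Q := Q) α → ℂ) : QRep Q α :=
  fun a => Matrix.of fun i j => u ⟨a, i, j⟩

theorem exists_pullback {l : ℕ} {αs : Fin l → Q.V → ℕ} (V : ∀ i, QRep Q (αs i)) (i : Fin l)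
    (g : GLb fun x => ∑ i, αs i x) (p : MvPolynomial (RepCoord (Q := Q) fun x => ∑ i, αs i x) ℂ) :
    ∃ q : MvPolynomial (RepCoord (Q := Q) (αs i)) ℂ, ∀ X,
      eval (repCoords (gAct g (sumRep (Function.update V i X)))) p = eval (repCoords X) q := by
  have h : PolyFn fun u => eval (repCoords (gAct g (sumRep (Function.update V i (ofCoords u))))) p := by
    refine PolyFn.eval_mvPolynomial (f := fun c u =>
      repCoords (gAct g (sumRep (Function.update V i (ofCoords u)))) c) (fun c => ?_) p
    refine polyFn_gAct (fun q => ?_) g c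
    obtain h0 | ⟨j, c', hc'⟩ := repCoords_sumRep (αs := αs) q
    · simp only [h0]
      exact PolyFn.const 0
    · simp only [hc']
      by_cases hj : j = i
      · subst hj
        simp only [Function.update_self]
        exact PolyFn.coord c'
      · simp only [Function.update_of_ne hj]
        exact PolyFn.const _
  obtain ⟨q, hq⟩ := h
  exact ⟨q, fun X => hq (repCoords X)⟩

theorem zclosure_sumSet_subset {l : ℕ} {αs : Fin l → Q.V → ℕ} {Cs Ss : ∀ i, Set (QRep Q (αs i))}
    (h : ∀ i, Cs i ⊆ zclosure (Ss i)) :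
    zclosure (sumSet αs Cs fun x => ∑ i, αs i x) ⊆
      zclosure {W | ∃ (g : GLb fun x => ∑ i, αs i x) (V : ∀ i, QRep Q (αs i)),
        (∀ i, V i ∈ Ss i) ∧ gAct g (sumRep V) = W} := by
  classical
  refine zclosure_minimal' ?_
  rintro W ⟨V, hV, hW⟩
  obtain ⟨g, rfl⟩ := hW.exists_gAct
  rw [mem_zclosure_iff]
  intro p hp
  have key : ∀ (s : Finset (Fin l)) (V : ∀ i, QRep Q (αs i)), (∀ i ∈ s, V i ∈ Cs i) →
      (∀ i ∉ s, V i ∈ Ss i) → eval (repCoords (gAct g (sumRep V))) p = 0 := by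
    intro s
    induction s using Finset.induction_on with
    | empty => exact fun V _ hV => hp _ ⟨g, V, fun i => hV i (Finset.notMem_empty i), rfl⟩
    | insert i s hi ih =>
      intro V hV hV'
      obtain ⟨q, hq⟩ := exists_pullback V i g p
      have h1 := hq (V i)
      rw [Function.update_eq_self] at h1
      rw [h1]
      refine mem_zclosure_iff.1 (h i (hV i (Finset.mem_insert_self i s))) q fun X hX => ?_
      rw [← hq]
      refine ih _ (fun j hj => ?_) fun j hj => ?_
      · rw [Function.update_of_ne (ne_of_mem_of_not_mem hj hi)]
        exact hV j (Finset.mem_insert_of_mem hj)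
      · by_cases hji : j = i
        · subst hji
          rwa [Function.update_self]
        · rw [Function.update_of_ne hji]
          exact hV' j (by simp [hji, hj])
  exact key Finset.univ V (fun i _ => hV i) fun i hi => absurd (Finset.mem_univ i) hi

/-- The union of the orbits of the members of a family with parameters in a given set. -/
def famSet {α : Q.V → ℕ} (N : ℂ → QRep Q α) (Λ : Set ℂ) : Set (QRep Q α) :=
  {W | ∃ (g : GLb α) (z : ℂ), z ∈ Λ ∧ gAct g (N z) = W}

theorem famSet_subset_zclosure {α : Q.V → ℕ} {N : ℂ → QRep Q α}
    (hN : ∀ q, LinePoly fun z => repCoords (N z) q) {Λ : Set ℂ} (hΛ : Λ.Infinite) (Λ' : Set ℂ) :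
    famSet N Λ' ⊆ zclosure (famSet N Λ) := by
  rintro W ⟨g, w, -, rfl⟩
  rw [mem_zclosure_iff]
  intro p hp
  have h : LinePoly fun z => eval (repCoords (gAct g (N z))) p :=
    LinePoly.eval_mvPolynomial (f := fun q z => repCoords (gAct g (N z)) q) (linePoly_gAct hN g) p
  by_contra hw
  exact hΛ ((h.finite_zeros hw).subset fun z hz => hp _ ⟨g, z, hz, rfl⟩)

theorem exists_gAct_sumRep {l : ℕ} {αs : Fin l → Q.V → ℕ} {V W : ∀ i, QRep Q (αs i)}
    (h : ∀ i, ∃ g, gAct g (V i) = W i) : ∃ g, gAct g (sumRep V) = sumRep W := by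
  choose g hg using h
  refine exists_gAct_eq_of_equiv ((sumRepEquiv V).trans ((LinearEquiv.piCongrRight fun i => ?_).trans
    (sumRepEquiv W).symm))
  exact (nonempty_equiv_iff.2 ⟨g i, hg i⟩).some

theorem sumSet_subset_of_family {l : ℕ} {αs : Fin l → Q.V → ℕ} {Cs : ∀ i, Set (QRep Q (αs i))}
    {N : ∀ i, ℂ → QRep Q (αs i)} {Λ : Fin l → Set ℂ} (h : ∀ i, Cs i ⊆ zclosure (famSet (N i) (Λ i))) :
    zclosure (sumSet αs Cs fun x => ∑ i, αs i x) ⊆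
      zclosure {W | ∃ (g : GLb fun x => ∑ i, αs i x) (z : Fin l → ℂ),
        (∀ i, z i ∈ Λ i) ∧ gAct g (sumRep fun i => N i (z i)) = W} := by
  refine (zclosure_sumSet_subset h).trans (zclosure_minimal' ?_)
  rintro W ⟨g, V, hV, rfl⟩
  refine subset_zclosure _ ?_
  choose g' z hz hg' using hV
  obtain ⟨g₁, hg₁⟩ := exists_gAct_sumRep (V := fun i => N i (z i)) (W := V) fun i => ⟨g' i, hg' i⟩
  obtain ⟨e⟩ := nonempty_equiv_gAct g₁ (sumRep fun i => N i (z i))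
  rw [hg₁] at e
  obtain ⟨e'⟩ := nonempty_equiv_gAct g (sumRep V)
  obtain ⟨g₂, hg₂⟩ := exists_gAct_eq_of_equiv (e.trans e')
  exact ⟨g₂, z, hz, hg₂⟩

theorem exists_subset_zclosure {α : Q.V → ℕ} {C : Set (QRep Q α)} (hC : zIrred C) {κ : Type} [Finite κ]
    {S : κ → Set (QRep Q α)} (h : C ⊆ zclosure (⋃ k, S k)) : ∃ k, C ⊆ zclosure (S k) := by
  classical
  let _ := zarTop (Q := Q) α
  have := Fintype.ofFinite κ
  obtain ⟨z, hz, hCz⟩ := isIrreducible_iff_sUnion_isClosed.1 hC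
    (Finset.univ.image fun k => zclosure (S k)) (fun z hz => by
      obtain ⟨k, -, rfl⟩ := Finset.mem_image.1 hz
      exact isClosed_closure) (by
      refine h.trans ?_
      rw [zclosure, closure_iUnion_of_finite]
      intro x hx
      obtain ⟨k, hk⟩ := Set.mem_iUnion.1 hx
      exact ⟨zclosure (S k), by simp, hk⟩)
  obtain ⟨k, -, rfl⟩ := Finset.mem_image.1 hz
  exact ⟨k, hCz⟩

theorem subset_zclosure_indec {α : Q.V → ℕ} (h : IsIndecComp (Cset R α) (modSet R α)) :
    Cset R α ⊆ zclosure {V | V ∈ PAset R α ∧ IsIndecRep V} := by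
  let _ := zarTop (Q := Q) α
  obtain ⟨⟨hirr, -⟩, U, hU, hCU, hind⟩ := h
  have hP : _root_.IsIrreducible (PAset R α) := isIrreducible_iff_closure.1 hirr
  have hU : IsOpen U := hU
  obtain ⟨x, hx⟩ := hirr.1
  obtain ⟨y, hy⟩ := closure_nonempty_iff.1 ⟨x, hCU hx⟩
  obtain ⟨w, hwU, hwP⟩ := mem_closure_iff.1 hy.1 U hU hy.2
  refine zclosure_minimal' fun v hv => ?_
  refine mem_closure_iff.2 fun O hO hvO => ?_
  obtain ⟨u, huP, huO, huU⟩ := hP.2 O U hO hU ⟨v, hv, hvO⟩ ⟨w, hwP, hwU⟩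
  exact ⟨u, huO, huP, hind u ⟨subset_closure huP, huU⟩⟩

theorem orbitOf_eq_famSet {α : Q.V → ℕ} (V : QRep Q α) : orbitOf V = famSet (fun _ => V) Set.univ := by
  ext W
  exact ⟨fun ⟨g, h⟩ => ⟨g, 0, trivial, h⟩, fun ⟨g, _, _, h⟩ => ⟨g, h⟩⟩

theorem isOrbitClosure_of_subset {α : Q.V → ℕ} {V : QRep Q α} (hV : V ∈ PAset R α)
    (h : Cset R α ⊆ zclosure (orbitOf V)) : IsOrbitClosure R (Cset R α) := by
  refine ⟨V, hV.1, h.antisymm (zclosure_minimal' ?_)⟩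
  rintro W ⟨g, rfl⟩
  exact subset_zclosure _ (PAset.of_equiv hV (nonempty_equiv_gAct g V).some)

theorem dim_eq_of_equiv {α γ : Q.V → ℕ} {V : QRep Q α} {W : QRep Q γ} (e : RMod V ≃ₗ[Aq Q] RMod W) :
    α = γ := by
  rw [← dimV_rmod V, ← dimV_rmod W]
  exact dimV_eq_of_equiv e

theorem exists_family_of_subset {α γ : Q.V → ℕ} (hγ : γ = α) (N₀ : RepR Q (Polynomial ℂ) γ)
    (hN₀ : ∀ r ∈ R, evalLinP N₀ r.2.2 = 0) (hirr : zIrred (Cset R α))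
    (hsingle : ∀ V ∈ PAset R α, ¬Cset R α ⊆ zclosure (orbitOf V))
    (hC : Cset R α ⊆ zclosure {V | (V ∈ PAset R α ∧ IsIndecRep V) ∧ ∃ z, RIso (polyEvalAt N₀ z) V}) :
    ∃ (N : ℂ → QRep Q α) (Λ : Set ℂ),
      (∀ q, LinePoly fun z => repCoords (N z) q) ∧ (∀ z, N z ∈ modSet R α) ∧ Λ.Infinite ∧
      (∀ z ∈ Λ, N z ∈ PAset R α ∧ IsIndecRep (N z)) ∧
      (∀ w ∈ Λ, {z | ∃ g, gAct g (N z) = N w}.Finite) ∧ Cset R α ⊆ zclosure (famSet N Λ) := by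
  subst hγ
  have hpoly := linePoly_polyEvalAt N₀
  let Λ : Set ℂ := {z | polyEvalAt N₀ z ∈ PAset R γ ∧ IsIndecRep (polyEvalAt N₀ z)}
  have hCΛ : Cset R γ ⊆ zclosure (famSet (polyEvalAt N₀) Λ) := by
    refine hC.trans (zclosure_minimal' ?_)
    rintro V ⟨⟨hV, hVi⟩, z, hz⟩
    obtain ⟨e⟩ := hz.nonempty_equiv
    obtain ⟨g, hg⟩ := exists_gAct_eq_of_equiv e
    exact subset_zclosure _ ⟨g, z, ⟨PAset.of_equiv hV e.symm,
      isIndecRep_iff.2 ((isIndecRep_iff.1 hVi).of_equiv e.symm)⟩, hg⟩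
  refine ⟨polyEvalAt N₀, Λ, hpoly, polyEvalAt_mem hN₀, fun hfin => ?_, fun z hz => hz, fun w hw => ?_, hCΛ⟩
  · have := hfin.to_subtype
    obtain ⟨k, hk⟩ := exists_subset_zclosure hirr (κ := Λ) (S := fun k => orbitOf (polyEvalAt N₀ k)) (by
      refine hCΛ.trans (zclosure_minimal' ?_)
      rintro V ⟨g, z, hz, rfl⟩
      exact subset_zclosure _ (Set.mem_iUnion.2 ⟨⟨z, hz⟩, g, rfl⟩))
    exact hsingle _ k.2.1 hk
  · by_contra hinf
    refine hsingle _ hw.1 (hCΛ.trans (zclosure_minimal' ((famSet_subset_zclosure hpoly hinf Λ).trans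
      (zclosure_minimal' ?_))))
    rintro V ⟨g, z, ⟨g', hg'⟩, rfl⟩
    obtain ⟨e⟩ := nonempty_equiv_iff.2 ⟨g', hg'⟩
    refine subset_zclosure _ (exists_gAct_eq_of_equiv ?_)
    exact e.symm.trans (nonempty_equiv_gAct g _).some

/-- An indecomposable component over a tame algebra is an orbit closure or is swept out by the
orbits of a one-parameter family of indecomposable modules. -/
theorem exists_family (htame : IsTame R) {α : Q.V → ℕ} (h : IsIndecComp (Cset R α) (modSet R α))
    (hno : ¬IsOrbitClosure R (Cset R α)) : ∃ (N : ℂ → QRep Q α) (Λ : Set ℂ),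
      (∀ q, LinePoly fun z => repCoords (N z) q) ∧ (∀ z, N z ∈ modSet R α) ∧ Λ.Infinite ∧
      (∀ z ∈ Λ, N z ∈ PAset R α ∧ IsIndecRep (N z)) ∧
      (∀ w ∈ Λ, {z | ∃ g, gAct g (N z) = N w}.Finite) ∧ Cset R α ⊆ zclosure (famSet N Λ) := by
  classical
  obtain ⟨s, γs, N, hN, t, βs, E, hNE⟩ := htame (∑ x, α x)
  let S : Fin t ⊕ Fin s → Set (QRep Q α) := Sum.elim
    (fun k => {V | (V ∈ PAset R α ∧ IsIndecRep V) ∧ RIso (E k) V})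
    (fun i => {V | (V ∈ PAset R α ∧ IsIndecRep V) ∧ ∃ lam, RIso (polyEvalAt (N i) lam) V})
  have hS : Cset R α ⊆ zclosure (⋃ k, S k) := by
    refine (subset_zclosure_indec h).trans (zclosure_minimal' fun V hV => subset_zclosure _ ?_)
    obtain ⟨k, hk⟩ | ⟨i, hi⟩ := hNE α V hV.1.1 rfl hV.2
    · exact Set.mem_iUnion.2 ⟨Sum.inl k, hV, hk⟩
    · exact Set.mem_iUnion.2 ⟨Sum.inr i, hV, hi⟩
  obtain ⟨k, hk⟩ := exists_subset_zclosure h.1.1 hS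
  obtain ⟨V₀, hV₀⟩ : (S k).Nonempty := by
    let _ := zarTop (Q := Q) α
    obtain ⟨x, hx⟩ := h.1.1.1
    exact closure_nonempty_iff.1 ⟨x, hk hx⟩
  have hsingle : ∀ V ∈ PAset R α, ¬Cset R α ⊆ zclosure (orbitOf V) := fun V hV hC =>
    hno (isOrbitClosure_of_subset hV hC)
  obtain k | i := k
  · refine absurd (hk.trans (zclosure_minimal' fun V hV => subset_zclosure _ ?_)) (hsingle V₀ hV₀.1.1)
    exact exists_gAct_eq_of_equiv (hV₀.2.nonempty_equiv.some.symm.trans hV.2.nonempty_equiv.some)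
  · obtain ⟨hV₀, lam₀, hlam₀⟩ := hV₀
    have hγ : γs i = α := dim_eq_of_equiv hlam₀.nonempty_equiv.some
    exact exists_family_of_subset hγ (N i) (hN i) h.1.1 hsingle hk

end Families

section Dimension

set_option linter.unusedSectionVars false

variable [Fintype Q.A] {R : Set (FormalRel Q)}

theorem LinePoly.exists_mem_pi {l : ℕ} {D : (Fin l → ℂ) → ℂ} (hD : LinePoly D) {z₀ : Fin l → ℂ}
    (hz₀ : D z₀ ≠ 0) {Λ : Fin l → Set ℂ} (hΛ : ∀ i, (Λ i).Infinite) :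
    ∃ z, D z ≠ 0 ∧ ∀ i, z i ∈ Λ i := by
  suffices h : ∀ s : Finset (Fin l), ∃ z, D z ≠ 0 ∧ ∀ i ∈ s, z i ∈ Λ i by
    obtain ⟨z, hz, hzs⟩ := h Finset.univ
    exact ⟨z, hz, fun i => hzs i (Finset.mem_univ i)⟩
  intro s
  induction s using Finset.induction_on with
  | empty => exact ⟨z₀, hz₀, fun i hi => absurd hi (Finset.notMem_empty i)⟩
  | insert i s hi ih =>
    obtain ⟨z, hz, hzs⟩ := ih
    obtain ⟨p, hp⟩ := hD (Function.update z i 0) (Pi.single i 1)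
    have hu : ∀ t : ℂ, Function.update z i 0 + t • Pi.single i 1 = Function.update z i t := by
      intro t
      funext j
      by_cases hj : j = i
      · subst hj
        simp
      · simp [hj]
    simp only [hu] at hp
    have hp0 : p ≠ 0 := by
      rintro rfl
      apply hz
      simpa using hp (z i)
    obtain ⟨t, ht, htp⟩ := ((hΛ i).sdiff (p.roots.toFinset.finite_toSet)).nonempty
    refine ⟨Function.update z i t, fun h0 => htp ?_, fun j hj => ?_⟩
    · rw [hp t] at h0
      simpa [hp0] using h0
    · by_cases hji : j = i
      · subst hji
        simpa using ht
      · rw [Function.update_of_ne hji]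
        exact hzs j ((Finset.mem_insert.1 hj).resolve_left hji)

theorem one_le_dimHom {α : Q.V → ℕ} (hα : ∃ x, α x ≠ 0) (V : QRep Q α) : 1 ≤ dimHom V V := by
  obtain ⟨x, hx⟩ := hα
  have : Nontrivial (HomS V V) := by
    refine ⟨⟨⟨1, one_mem_homS V⟩, 0, fun h => ?_⟩⟩
    have h' := congrFun (congrFun (congrFun (congrArg Subtype.val h) x)
      ⟨0, Nat.pos_of_ne_zero hx⟩) ⟨0, Nat.pos_of_ne_zero hx⟩
    have h1 : (1 : Matrix (Fin (α x)) (Fin (α x)) ℂ) ⟨0, Nat.pos_of_ne_zero hx⟩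
      ⟨0, Nat.pos_of_ne_zero hx⟩ = 0 := h'
    rw [Matrix.one_apply_eq] at h1
    exact one_ne_zero h1
  exact Module.finrank_pos

theorem dimHom_sumRep {l : ℕ} {αs γs : Fin l → Q.V → ℕ} (V : ∀ i, QRep Q (αs i))
    (W : ∀ i, QRep Q (γs i)) :
    dimHom (sumRep V) (sumRep W) = ∑ i, ∑ j, dimHom (V i) (W j) := by
  rw [← homd_rmod, homd_congr_left (sumRepEquiv V), homd_congr_right (sumRepEquiv W), homd_pi_left]
  simp only [homd_pi_right, homd_rmod]

theorem le_dimHom_sumRep {l : ℕ} {αs : Fin l → Q.V → ℕ} (hα : ∀ i, ∃ x, αs i x ≠ 0)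
    (V : ∀ i, QRep Q (αs i)) : l ≤ dimHom (sumRep V) (sumRep V) := by
  rw [dimHom_sumRep]
  calc l = ∑ _i : Fin l, 1 := by simp
    _ ≤ _ := Finset.sum_le_sum fun i _ => (one_le_dimHom (hα i) (V i)).trans
      (Finset.single_le_sum (f := fun j => dimHom (V i) (V j)) (fun _ _ => Nat.zero_le _) (Finset.mem_univ i))

theorem polyFn_sumRep {ι : Type} {l : ℕ} {αs : Fin l → Q.V → ℕ} {N : ∀ i, ℂ → QRep Q (αs i)}
    (hN : ∀ i q, LinePoly fun z => repCoords (N i z) q) {f : Fin l → (ι → ℂ) → ℂ} (hf : ∀ i, PolyFn (f i))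
    (c : RepCoord (Q := Q) fun x => ∑ i, αs i x) :
    PolyFn fun u => repCoords (sumRep fun i => N i (f i u)) c := by
  obtain h0 | ⟨j, c', hc'⟩ := repCoords_sumRep (αs := αs) c
  · simp only [h0]
    exact PolyFn.const 0
  · simp only [hc']
    exact (hN j c').polyFn_coord (hf j)

theorem IsIndecComp.exists_ne_zero {α : Q.V → ℕ} (h : IsIndecComp (Cset R α) (modSet R α)) :
    ∃ x, α x ≠ 0 := by
  let _ := zarTop (Q := Q) α
  obtain ⟨x, hx⟩ := h.1.1.1
  obtain ⟨V, hV⟩ := closure_nonempty_iff.1 ⟨x, subset_zclosure_indec h hx⟩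
  exact hV.2.1

theorem exists_family_univ (htame : IsTame R) {α : Q.V → ℕ} (h : IsIndecComp (Cset R α) (modSet R α)) :
    ∃ N : ℂ → QRep Q α, (∀ q, LinePoly fun z => repCoords (N z) q) ∧
      Cset R α ⊆ zclosure (famSet N Set.univ) := by
  by_cases ho : IsOrbitClosure R (Cset R α)
  · obtain ⟨V, -, hV⟩ := ho
    exact ⟨fun _ => V, fun q => LinePoly.const _, by rw [hV, orbitOf_eq_famSet]⟩
  · obtain ⟨N, Λ, hN, -, -, -, -, hC⟩ := exists_family htame h ho
    refine ⟨N, hN, hC.trans (zclosure_minimal' ?_)⟩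
    rintro W ⟨g, z, -, hW⟩
    exact subset_zclosure _ ⟨g, z, trivial, hW⟩

theorem zdim_lt_of_isOrbitClosure (htame : IsTame R) {l : ℕ} {αs : Fin l → Q.V → ℕ}
    (hindec : ∀ i, IsIndecComp (Cset R (αs i)) (modSet R (αs i)))
    (hdec : Cset R (fun x => ∑ i, αs i x) =
      zclosure (sumSet αs (fun i => Cset R (αs i)) fun x => ∑ i, αs i x))
    {i₀ : Fin l} (ho : IsOrbitClosure R (Cset R (αs i₀))) :
    zdim (Cset R fun x => ∑ i, αs i x) < glDim Q fun x => ∑ i, αs i x := by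
  obtain _ | k := l
  · exact i₀.elim0
  obtain ⟨V₀, -, hV₀⟩ := ho
  choose N' hN' hC' using fun i => exists_family_univ htame (hindec i)
  let N : ∀ i, ℂ → QRep Q (αs i) := Function.update N' i₀ fun _ => V₀
  have hN0 : ∀ z, N i₀ z = V₀ := fun z => by simp [N]
  have hN1 : ∀ i, i ≠ i₀ → N i = N' i := fun i hi => Function.update_of_ne hi _ _
  have hN : ∀ i q, LinePoly fun z => repCoords (N i z) q := by
    intro i q
    by_cases hi : i = i₀
    · subst hi
      simp only [hN0]
      exact LinePoly.const _
    · rw [hN1 i hi]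
      exact hN' i q
  have hC : ∀ i, Cset R (αs i) ⊆ zclosure (famSet (N i) Set.univ) := by
    intro i
    by_cases hi : i = i₀
    · subst hi
      rw [hV₀, orbitOf_eq_famSet]
      exact (congrArg (fun f => zclosure (famSet f Set.univ)) (funext hN0)).symm.le
    · rw [hN1 i hi]
      exact hC' i
  have hf : ∀ i, PolyFn fun u : Fin k → ℂ => (i₀.insertNth 0 u : Fin (k + 1) → ℂ) i := by
    intro i
    obtain rfl | ⟨j, rfl⟩ := Fin.eq_self_or_eq_succAbove i₀ i
    · simp only [Fin.insertNth_apply_same]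
      exact PolyFn.const 0
    · simp only [Fin.insertNth_apply_succAbove]
      exact PolyFn.coord j
  obtain ⟨n, hn, hnk⟩ := zdim_le_of_family
    (fun u : Fin k → ℂ => sumRep fun i => N i ((i₀.insertNth 0 u : Fin (k + 1) → ℂ) i)) (polyFn_sumRep hN hf)
    (fun u => le_dimHom_sumRep (fun i => (hindec i).exists_ne_zero) _) (Cset R fun x => ∑ i, αs i x) (by
      rw [hdec]
      refine (sumSet_subset_of_family hC).trans (zclosure_minimal' ?_)
      rintro W ⟨g, z, -, rfl⟩
      refine subset_zclosure _ ⟨g, fun j => z (i₀.succAbove j), congrArg (fun V => gAct g (sumRep V)) ?_⟩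
      funext i
      obtain rfl | ⟨j, rfl⟩ := Fin.eq_self_or_eq_succAbove i₀ i
      · rw [hN0, hN0]
      · rw [Fin.insertNth_apply_succAbove])
  rw [glDim_eq]
  refine hn.trans_lt ?_
  exact_mod_cast (by omega : n < ∑ x, (∑ i, αs i x) ^ 2)

/-- A family sweeping out an indecomposable component that is not an orbit closure can be chosen
such that its members have resolutions with constant dimension data and endomorphism rings of
minimal dimension. -/
theorem exists_uniform_family (hQ : QAcyclic Q) (hR : AdmissibleRels R) (htame : IsTame R) {α : Q.V → ℕ}
    (h : IsIndecComp (Cset R α) (modSet R α)) (hno : ¬IsOrbitClosure R (Cset R α)) :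
    ∃ (N : ℂ → QRep Q α) (Λ : Set ℂ) (c : Q.V → ℤ) (d : ℕ),
      (∀ q, LinePoly fun z => repCoords (N z) q) ∧ (∀ z, N z ∈ modSet R α) ∧ Λ.Infinite ∧
      (∀ z ∈ Λ, HasRes R (RMod (N z)) c ∧ IsIndecRep (N z)) ∧
      (∀ w ∈ Λ, dimHom (N w) (N w) = d ∧ {z | d ≤ dimHom (N z) (N w)}.Finite) ∧
      Cset R α ⊆ zclosure (famSet N Λ) := by
  classical
  obtain ⟨N, Λ, hN, hmem, hΛ, hΛ', hiso, hC⟩ := exists_family htame h hno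
  obtain ⟨B, hB⟩ := HasRes.exists_bound hQ hR α
  obtain ⟨z₀, hz₀⟩ : ∃ z₀, ∀ z, dimHom (N z₀) (N z₀) ≤ dimHom (N z) (N z) := by
    obtain ⟨z₀, -, h⟩ := exists_minimalFor_of_wellFoundedLT (fun _ : ℂ => True)
      (fun z => dimHom (N z) (N z)) ⟨0, trivial⟩
    exact ⟨z₀, fun z => (le_total _ _).elim id fun h' => h trivial h'⟩
  obtain ⟨D, hD, hD0, hDle⟩ := exists_dimHom_le hN hN z₀
  have hfin := hD.finite_zeros hD0
  have hinf := hΛ.sdiff hfin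
  choose! c hc using fun z (hz : z ∈ Λ) => exists_hasRes_of_mem_PAset (hΛ' z hz).1
  have hmaps : Set.MapsTo c (Λ \ {t | D t = 0}) (Set.pi Set.univ fun _ => Set.Icc (-B) B) :=
    fun z hz x _ => hB (N z) _ (hc z hz.1) x
  have hIcc : (Set.pi Set.univ fun _ : Q.V => Set.Icc (-B) B).Finite :=
    Set.Finite.pi fun _ => Set.finite_Icc _ _
  obtain ⟨c₀, -, hc₀⟩ : ∃ c₀ ∈ c '' (Λ \ {t | D t = 0}), ((Λ \ {t | D t = 0}) ∩ c ⁻¹' {c₀}).Infinite := by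
    by_contra! h'
    exact hinf (Set.Finite.of_finite_fibers c (hIcc.subset hmaps.image_subset) h')
  refine ⟨N, _, c₀, dimHom (N z₀) (N z₀), hN, hmem, hc₀, fun z hz => ?_, fun w hw => ?_,
    hC.trans (zclosure_minimal' (famSet_subset_zclosure hN hc₀ _))⟩
  · have h' := hc z hz.1.1
    rw [show c z = c₀ from hz.2] at h'
    exact ⟨h', (hΛ' z hz.1.1).2⟩
  · have hd : dimHom (N w) (N w) = dimHom (N z₀) (N z₀) := (hDle w hw.1.2).antisymm (hz₀ w)
    refine ⟨hd, ?_⟩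
    rw [← hd]
    exact finite_dimHom_le N hN w (hiso w hw.1.1)

theorem mem_extSupp_rmod {β γ : Q.V → ℕ} {M : ℂ → QRep Q β} {Λ : Set ℂ} {c : Q.V → ℤ} {W : QRep Q γ} {z : ℂ} :
    z ∈ extSupp M Λ c (RMod W) ↔ z ∈ Λ ∧ (dimHom (M z) W : ℤ) ≠ eul c γ := by
  rw [extSupp, Set.mem_sep_iff, homd_rmod, dimV_rmod]

theorem HasRes.eul_le_dimHom (hQ : QAcyclic Q) (hR : AdmissibleRels R) {α γ : Q.V → ℕ} {V : QRep Q α}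
    {c : Q.V → ℤ} (h : HasRes R (RMod V) c) {W : QRep Q γ} (hW : W ∈ modSet R γ) :
    eul c γ ≤ dimHom V W := by
  have := good_rmod hW
  simpa only [dimV_rmod, homd_rmod] using h.eul_le hQ hR (RMod W)

theorem HasRes.sumRep {l : ℕ} {αs : Fin l → Q.V → ℕ} {V : ∀ i, QRep Q (αs i)} {c : Fin l → Q.V → ℤ}
    (h : ∀ i, HasRes R (RMod (V i)) (c i)) : HasRes R (RMod (sumRep V)) fun x => ∑ i, c i x :=
  (HasRes.pi h).of_equiv (sumRepEquiv V).symm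

theorem eq_of_sum_le {l : ℕ} {a : Fin l → Fin l → ℤ} (h0 : ∀ i j, 0 ≤ a i j) (h1 : ∀ i, 1 ≤ a i i)
    (h : ∑ i, ∑ j, a i j ≤ l) (i j : Fin l) : a i j = if i = j then 1 else 0 := by
  have hb : ∀ i j, 0 ≤ a i j - if i = j then 1 else 0 := by
    intro i j
    split_ifs with hij
    · subst hij
      linarith [h1 i]
    · linarith [h0 i j]
  have hs : ∑ i, ∑ j, (a i j - if i = j then 1 else 0) = 0 := by
    refine le_antisymm ?_ (Finset.sum_nonneg fun i _ => Finset.sum_nonneg fun j _ => hb i j)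
    simp only [Finset.sum_sub_distrib, Finset.sum_ite_eq, Finset.mem_univ, if_true, Finset.sum_const,
      Finset.card_univ, Fintype.card_fin, nsmul_eq_mul, mul_one]
    linarith
  have h' := (Finset.sum_eq_zero_iff_of_nonneg fun i _ => Finset.sum_nonneg fun j _ => hb i j).1 hs i
    (Finset.mem_univ i)
  have h'' := (Finset.sum_eq_zero_iff_of_nonneg fun j _ => hb i j).1 h' j (Finset.mem_univ j)
  linarith

theorem zdim_eq_of_not_isOrbitClosure (hQ : QAcyclic Q) (hR : AdmissibleRels R) (htame : IsTame R) {l : ℕ}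
    {αs : Fin l → Q.V → ℕ} (hindec : ∀ i, IsIndecComp (Cset R (αs i)) (modSet R (αs i)))
    (hdec : Cset R (fun x => ∑ i, αs i x) =
      zclosure (sumSet αs (fun i => Cset R (αs i)) fun x => ∑ i, αs i x))
    (hno : ∀ i, ¬IsOrbitClosure R (Cset R (αs i))) :
    zdim (Cset R fun x => ∑ i, αs i x) = glDim Q fun x => ∑ i, αs i x := by
  classical
  choose N Λ c d hN hmem hΛ hres hd hC using fun i =>
    exists_uniform_family hQ hR htame (hindec i) (hno i)
  have hα := fun i => (hindec i).exists_ne_zero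
  have hCM : Cset R (fun x => ∑ i, αs i x) ⊆ zclosure {W | ∃ (g : GLb fun x => ∑ i, αs i x)
      (z : Fin l → ℂ), gAct g (sumRep fun i => N i (z i)) = W} := by
    rw [hdec]
    refine (sumSet_subset_of_family hC).trans (zclosure_minimal' ?_)
    rintro W ⟨g, z, -, hW⟩
    exact subset_zclosure _ ⟨g, z, hW⟩
  have hpoly : ∀ q, PolyFn fun z : Fin l → ℂ => repCoords (sumRep fun i => N i (z i)) q :=
    polyFn_sumRep hN fun i => PolyFn.coord i
  obtain ⟨z₀, hz₀⟩ : ∃ z₀ : Fin l → ℂ, ∀ z : Fin l → ℂ,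
      dimHom (sumRep fun i => N i (z₀ i)) (sumRep fun i => N i (z₀ i)) ≤
        dimHom (sumRep fun i => N i (z i)) (sumRep fun i => N i (z i)) := by
    obtain ⟨z₀, -, h⟩ := exists_minimalFor_of_wellFoundedLT (fun _ : Fin l → ℂ => True)
      (fun z => dimHom (sumRep fun i => N i (z i)) (sumRep fun i => N i (z i))) ⟨0, trivial⟩
    exact ⟨z₀, fun z => (le_total _ _).elim id fun h' => h trivial h'⟩
  obtain ⟨D, hD, hD0, hDle⟩ := exists_dimHom_le (fun q => (hpoly q).linePoly) (fun q => (hpoly q).linePoly) z₀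
  obtain ⟨w, hDw, hw⟩ := hD.exists_mem_pi hD0 hΛ
  have hresV : ∀ i, HasRes R (RMod (N i (w i))) (c i) := fun i => (hres i _ (hw i)).1
  have hresS := HasRes.sumRep hresV
  obtain ⟨n₁, hn₁, hn₁'⟩ := hresS.le_zdim_Cset hQ hR
  obtain ⟨n₂, hn₂, hn₂'⟩ := zdim_le_of_family _ hpoly (fun z => (hDle w hDw).trans (hz₀ z)) _ hCM
  have hn : n₁ ≤ n₂ := by exact_mod_cast hn₁.trans hn₂
  have hle : ∀ i j, eul (c i) (αs j) ≤ dimHom (N i (w i)) (N j (w j)) := fun i j =>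
    (hresV i).eul_le_dimHom hQ hR (hmem j _)
  have hself : ∀ i, eul (c i) (αs i) + 1 ≤ d i := by
    intro i
    obtain ⟨z, hz, hz'⟩ := ((hΛ i).sdiff (hd i _ (hw i)).2).nonempty
    have h1 := (hres i z hz).1.eul_le_dimHom hQ hR (hmem i (w i))
    have h2 : dimHom (N i z) (N i (w i)) < d i := not_le.1 hz'
    omega
  have hext := eq_of_sum_le (a := fun i j => (dimHom (N i (w i)) (N j (w j)) : ℤ) - eul (c i) (αs j))
    (fun i j => sub_nonneg.2 (hle i j)) (fun i => by
      rw [(hd i _ (hw i)).1]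
      linarith [hself i]) (by
      simp only [Finset.sum_sub_distrib]
      have h1 : (dimHom (sumRep fun i => N i (w i)) (sumRep fun i => N i (w i)) : ℤ) =
          ∑ i, ∑ j, (dimHom (N i (w i)) (N j (w j)) : ℤ) := by
        rw [dimHom_sumRep]
        push_cast
        rfl
      have h2 : eul (fun x => ∑ i, c i x) (fun x => ∑ i, αs i x) = ∑ i, ∑ j, eul (c i) (αs j) := by
        rw [eul_sum_left]
        exact Finset.sum_congr rfl fun i _ => eul_sum_right _ _
      rw [← h1, ← h2]
      zify at hn hn₂'
      push_cast at hn₁'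
      linarith)
  have hdi : ∀ i, (d i : ℤ) = eul (c i) (αs i) + 1 := by
    intro i
    have h := hext i i
    rw [if_pos rfl, (hd i _ (hw i)).1] at h
    linarith
  have hsuppfin : ∀ i, ∀ v ∈ Λ i, (extSupp (N i) (Λ i) (c i) (RMod (N i v))).Finite := by
    intro i v hv
    refine (hd i v hv).2.subset fun z hz => ?_
    rw [mem_extSupp_rmod] at hz
    have h1 := (hres i z hz.1).1.eul_le_dimHom hQ hR (hmem i v)
    have h2 := hdi i
    change d i ≤ dimHom (N i z) (N i v)
    have h3 := lt_of_le_of_ne h1 hz.2.symm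
    omega
  have hsuppfin' : ∀ i j, (extSupp (N i) (Λ i) (c i) (RMod (N j (w j)))).Finite := by
    intro i j
    by_cases hij : i = j
    · subst hij
      exact hsuppfin i _ (hw i)
    · obtain ⟨D', hD', hD0', hDle'⟩ := exists_dimHom_le (hN i) (fun q => LinePoly.const
        (repCoords (N j (w j)) q)) (w i)
      refine (hD'.finite_zeros hD0').subset fun z hz => ?_
      rw [mem_extSupp_rmod] at hz
      by_contra hz'
      have h1 := hDle' z hz'
      have h2 := (hres i z hz.1).1.eul_le_dimHom hQ hR (hmem j (w j))
      have h3 := hext i j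
      rw [if_neg hij] at h3
      apply hz.2
      beta_reduce at h1
      omega
  have hhom : ∀ i j, {z ∈ Λ i | dimHom (N j (w j)) (N i z) ≠ 0}.Finite := by
    intro i j
    let Λ' : Set ℂ := Λ i \ extSupp (N i) (Λ i) (c i) (RMod (N j (w j)))
    have hsub : ∀ {γ : Q.V → ℕ} (W : QRep Q γ),
        extSupp (N i) Λ' (c i) (RMod W) ⊆ extSupp (N i) (Λ i) (c i) (RMod W) :=
      fun W z hz => ⟨hz.1.1, hz.2⟩
    have h := finite_homd_ne_zero (M := N i) (Λ := Λ') (c := c i) hQ hR htame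
      (fun z hz => (hres i z hz.1).1) (fun z _ => hmem i z) (fun z hz => (hres i z hz.1).2)
      (fun z hz => by
        rw [mem_extSupp_rmod, (hd i z hz.1).1, hdi i]
        exact ⟨hz, by simp⟩)
      (fun z hz => (hsuppfin i z hz.1).subset (hsub _)) (hmem j (w j))
      (Set.eq_empty_of_forall_notMem fun z hz => hz.1.2 (hsub _ hz))
    refine (h.union (hsuppfin' i j)).subset fun z hz => ?_
    by_cases hz' : z ∈ extSupp (N i) (Λ i) (c i) (RMod (N j (w j)))
    · exact Or.inr hz'
    · exact Or.inl ⟨⟨hz.1, hz'⟩, by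
        rw [homd_rmod]
        exact hz.2⟩
  have hexists : ∀ i, ∃ z ∈ Λ i, ∀ j, dimHom (N j (w j)) (N i z) = 0 := by
    intro i
    obtain ⟨z, hz, hz'⟩ := ((hΛ i).sdiff (Set.finite_iUnion (hhom i))).nonempty
    refine ⟨z, hz, fun j => ?_⟩
    by_contra hne
    exact hz' (Set.mem_iUnion.2 ⟨j, hz, hne⟩)
  choose v hv hv0 using hexists
  have hW : sumRep (fun i => N i (v i)) ∈ modSet R fun x => ∑ i, αs i x :=
    (HasRes.sumRep fun i => (hres i _ (hv i)).1).mem_PAset.1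
  have heul := hresS.eul_le_dimHom hQ hR hW
  rw [dimHom_sumRep, Finset.sum_eq_zero fun i _ => Finset.sum_eq_zero fun j _ => hv0 j i] at heul
  obtain ⟨n₃, hn₃, hn₃'⟩ := zdim_le_of_family _ hpoly (fun z => le_dimHom_sumRep hα _) _ hCM
  rw [glDim_eq]
  refine le_antisymm (hn₃.trans ?_) (le_trans ?_ hn₁)
  · exact_mod_cast Nat.le_of_add_le_add_right hn₃'
  · have h : ∑ x, (∑ i, αs i x) ^ 2 ≤ n₁ := by
      zify
      push_cast at hn₁' heul
      linarith
    exact_mod_cast h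

end Dimension

/-- Let `A = ℂQ/⟨R⟩` be a connected, acyclic, tame bound quiver algebra
and `α` with `P_A(α) ≠ ∅`, with generic decomposition
`C(α) = closure(C(α₁) ⊕ ⋯ ⊕ C(α_l))`.  Then `dim C(α) = dim GL(α)` if and only if none of
the indecomposable irreducible components `C(α_i)` is an orbit closure. -/
theorem statement5 (Q : Quiv) [Fintype Q.A] (hconn : QConnected Q) (hacyc : QAcyclic Q)
    (R : Set (FormalRel Q)) (hRfin : R.Finite) (hRadm : AdmissibleRels R)
    (htame : IsTame R)
    (α : Q.V → ℕ) (hne : (PAset R α).Nonempty)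
    (l : ℕ) (αs : Fin l → (Q.V → ℕ))
    (hsum : ∀ x, α x = ∑ i, αs i x)
    (hnei : ∀ i, (PAset R (αs i)).Nonempty)
    (hindec : ∀ i, IsIndecComp (Cset R (αs i)) (modSet R (αs i)))
    (hdec : Cset R α = zclosure (sumSet αs (fun i => Cset R (αs i)) α)) :
    zdim (Cset R α) = glDim Q α ↔ ∀ i, ¬ IsOrbitClosure R (Cset R (αs i)) := by
  obtain rfl : α = fun x => ∑ i, αs i x := funext hsum
  refine ⟨fun h i ho => ?_, fun h => zdim_eq_of_not_isOrbitClosure hacyc hRadm htame hindec hdec h⟩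
  exact (zdim_lt_of_isOrbitClosure htame hindec hdec ho).ne h
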